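/- arXiv:1802.07978 — 2 statements merged into one kernel-verified Lean document; each statement's English description precedes it below -/
import Mathlib

section
/- For the alternating (bipartite) Coxeter element c_alt of the symmetric group Σ_{n+1}, the number of c-singletons equals Fishburn's number fb(n+1), namely: S_{c_alt} = 2^{n−2}(n+4) − (n/2)·C(n, n/2) if n is even, and S_{c_alt} = 2^{n−2}(n+4) − ((2n+1)/2)·C(n, (n−1)/2) if n is odd (with m = n+1, this equals 2^{m−3}(m+3) minus ((m−1)/2)C(m−1,(m−1)/2) for odd m and minus ((2m−3)/2)C(m−2,(m−2)/2) for even m). -/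
open CoxeterSystem

namespace Cambrian

variable {B : Type*} {W : Type*} [Group W]

/-- A single commutation move on words: swap two adjacent letters whose generators commute. -/
def CommStep (M : CoxeterMatrix B) (l₁ l₂ : List B) : Prop :=
  ∃ (u v : List B) (i j : B), M i j = 2 ∧ l₁ = u ++ i :: j :: v ∧ l₂ = u ++ j :: i :: v

/-- Two words coincide up to commutations. -/
def CommEquiv (M : CoxeterMatrix B) : List B → List B → Prop :=
  Relation.ReflTransGen (CommStep M)

/-- `u` is a prefix of `v` up to commutations. -/
def IsPrefixUpToComm (M : CoxeterMatrix B) (u v : List B) : Prop :=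
  ∃ v', CommEquiv M v v' ∧ u <+: v'

variable {M : CoxeterMatrix B}

/-- Greedy computation of the lexicographically first reduced subword of `c^∞`
representing a given element (fuelled recursion). -/
noncomputable def sortAux (cs : CoxeterSystem M W) (cw : List B) :
    ℕ → List B → W → List B
  | 0, _, _ => []
  | n + 1, [], g => sortAux cs cw n cw g
  | n + 1, s :: rest, g =>
      if cs.length (cs.simple s * g) < cs.length g then
        s :: sortAux cs cw n rest (cs.simple s * g)
      else sortAux cs cw n rest g

/-- The `c`-sorting word of `w`. -/
noncomputable def sortingWord (cs : CoxeterSystem M W) (cw : List B) (w : W) : List B :=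
  sortAux cs cw ((cs.length w + 1) * (cw.length + 1)) cw w

/-- `w` is a `c`-singleton. -/
def IsCSingleton (cs : CoxeterSystem M W) (cw : List B) (w₀ w : W) : Prop :=
  ∃ u : List B, cs.wordProd u = w ∧ cs.IsReduced u ∧
    IsPrefixUpToComm M u (sortingWord cs cw w₀)

/-- The number of `c`-singletons. -/
noncomputable def numSingletons (cs : CoxeterSystem M W) (cw : List B) (w₀ : W) : ℕ :=
  Nat.card {w : W // IsCSingleton cs cw w₀ w}

/-- Fishburn's count `fb`. -/
noncomputable def fb (m : ℕ) : ℚ :=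
  2 ^ ((m : ℤ) - 3) * ((m : ℚ) + 3) -
    (if Odd m then (((m : ℚ) - 1) / 2) * (Nat.choose (m - 1) ((m - 1) / 2) : ℚ)
     else ((2 * (m : ℚ) - 3) / 2) * (Nat.choose (m - 2) ((m - 2) / 2) : ℚ))

/-- A word for the alternating (bipartite) Coxeter element of `Σ_{n+1}` (type `A_n`):
the product of the generators of one part of the bipartition of the Coxeter graph,
followed by the product of the generators of the other part. -/
def altWord (n : ℕ) : List (Fin n) :=
  ((List.finRange n).filter (fun i => i.val % 2 = 1)) ++
    ((List.finRange n).filter (fun i => i.val % 2 = 0))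

/-! ### Counting lattice paths -/

/-- Number of `±1` walks of `N` steps reaching height `d`. -/
def hitCount : ℕ → ℤ → ℤ
  | 0, d => if d ≤ 0 then 1 else 0
  | N + 1, d => if d ≤ 0 then 2 ^ (N + 1) else hitCount N (d - 1) + hitCount N (d + 1)

theorem hitCount_nonpos (N : ℕ) (d : ℤ) (h : d ≤ 0) : hitCount N d = 2 ^ N := by
  cases N <;> simp [hitCount, h]

theorem hitCount_succ (N : ℕ) (d : ℤ) (h : 0 < d) :
    hitCount (N + 1) d = hitCount N (d - 1) + hitCount N (d + 1) := by
  simp [hitCount, h]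

theorem hitCount_big (N : ℕ) (d : ℤ) (h : (N : ℤ) < d) : hitCount N d = 0 := by
  induction N generalizing d with
  | zero => simp only [hitCount]; rw [if_neg]; push_cast at h; omega
  | succ N ih =>
    push_cast at h
    rw [hitCount_succ _ _ (by omega), ih _ (by omega), ih _ (by omega)]; rfl

theorem hitCount_diff (N : ℕ) (d : ℕ) :
    hitCount N d - hitCount N (d + 1) = (Nat.choose N ((N + d + 1) / 2) : ℤ) := by
  induction N generalizing d with
  | zero =>
    rw [hitCount_big 0 (d + 1) (by push_cast; omega)]
    rcases d with _ | d
    · simp [hitCount]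
    · rw [hitCount_big _ _ (by push_cast; omega), Nat.choose_eq_zero_of_lt (by omega)]; simp
  | succ N ih =>
    rcases d with _ | d
    · have h0 := ih 0
      have h1 := ih 1
      rw [hitCount_nonpos _ _ (by simp)] at h0
      rw [hitCount_nonpos _ _ (by simp), hitCount_succ _ _ (by simp)]
      push_cast at h0 h1 ⊢
      norm_num at h0 h1 ⊢
      rw [hitCount_nonpos N 0 (by simp)]
      have key : (Nat.choose (N + 1) ((N + 1 + 1) / 2) : ℤ)
          = Nat.choose N ((N + 1) / 2) + Nat.choose N ((N + 1 + 1) / 2) := by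
        rcases Nat.even_or_odd' N with ⟨r, rfl | rfl⟩
        · rw [show (2 * r + 1 + 1) / 2 = r + 1 by omega, show (2 * r + 1) / 2 = r by omega,
            Nat.choose_succ_succ]
          push_cast; ring
        · rw [show (2 * r + 1 + 1 + 1) / 2 = r + 1 by omega,
            show (2 * r + 1 + 1) / 2 = r + 1 by omega, Nat.choose_succ_succ,
            Nat.choose_symm_half]
          push_cast; ring
      rw [key, ← h0, ← h1, pow_succ]; ring
    · have h0 := ih d
      have h1 := ih (d + 2)
      rw [hitCount_succ _ _ (by push_cast; omega), hitCount_succ _ _ (by push_cast; omega)]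
      rw [show (N + 1 + (d + 1) + 1) / 2 = (N + d + 1) / 2 + 1 by omega, Nat.choose_succ_succ,
        Nat.succ_eq_add_one]
      rw [show (N + (d + 2) + 1) / 2 = (N + d + 1) / 2 + 1 by omega] at h1
      push_cast at h0 h1 ⊢
      rw [← h0, ← h1]
      ring_nf

theorem hitCount_one (N : ℕ) : hitCount N 1 = 2 ^ N - (Nat.choose N ((N + 1) / 2) : ℤ) := by
  have := hitCount_diff N 0
  rw [hitCount_nonpos _ _ (by simp)] at this
  simp at this; linarith

def evenSum (K N : ℕ) : ℤ := ∑ k ∈ Finset.range K, hitCount N (2 * k + 2)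
def oddSum (K N : ℕ) : ℤ := ∑ k ∈ Finset.range K, hitCount N (2 * k + 1)

theorem evenSum_succ (K N : ℕ) (h : N < 2 * K) :
    evenSum K (N + 1) = 2 * oddSum K N - hitCount N 1 := by
  have e : evenSum K (N + 1)
      = ∑ k ∈ Finset.range K, (hitCount N (2 * k + 1) + hitCount N (2 * (k + 1 : ℕ) + 1)) := by
    apply Finset.sum_congr rfl
    intro k _
    rw [hitCount_succ _ _ (by omega)]
    push_cast; ring_nf
  rw [e, Finset.sum_add_distrib]
  have := Finset.sum_range_succ' (fun k : ℕ => hitCount N (2 * k + 1)) K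
  rw [Finset.sum_range_succ, hitCount_big N (2 * K + 1) (by omega)] at this
  simp only [oddSum]
  simp at this ⊢
  linarith

theorem oddSum_succ (K N : ℕ) (h : N < 2 * K) :
    oddSum K (N + 1) = 2 * evenSum K N + 2 ^ N := by
  have e : oddSum K (N + 1)
      = ∑ k ∈ Finset.range K, (hitCount N (2 * k) + hitCount N (2 * (k + 1 : ℕ))) := by
    apply Finset.sum_congr rfl
    intro k _
    rw [hitCount_succ _ _ (by omega)]
    push_cast; ring_nf
  rw [e, Finset.sum_add_distrib]
  have := Finset.sum_range_succ' (fun k : ℕ => hitCount N (2 * k)) K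
  rw [Finset.sum_range_succ, hitCount_big N (2 * K) (by omega)] at this
  have h0 := hitCount_nonpos N 0 le_rfl
  simp only [evenSum]
  simp [mul_add] at this ⊢
  linarith

theorem sums_even (K r : ℕ) (h : r < K) :
    2 * evenSum K (2 * r) = (2 * r + 1) * (Nat.choose (2 * r) r : ℤ) - 4 ^ r ∧
      oddSum K (2 * r) = r * (Nat.choose (2 * r) r : ℤ) := by
  induction r with
  | zero =>
    constructor
    · simp [evenSum]; rw [Finset.sum_eq_zero]
      intro k _; exact hitCount_big _ _ (by push_cast; omega)
    · simp [oddSum]; rw [Finset.sum_eq_zero]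
      intro k _; exact hitCount_big _ _ (by push_cast; omega)
  | succ r ih =>
    obtain ⟨h1, h2⟩ := ih (by omega)
    have e1 := evenSum_succ K (2 * r) (by omega)
    have e2 := oddSum_succ K (2 * r) (by omega)
    have e3 := evenSum_succ K (2 * r + 1) (by omega)
    have e4 := oddSum_succ K (2 * r + 1) (by omega)
    rw [hitCount_one] at e1 e3
    rw [show (2 * r + 1) / 2 = r by omega] at e1
    rw [show (2 * r + 1 + 1) / 2 = r + 1 by omega] at e3
    have c := Nat.succ_mul_centralBinom_succ r
    simp only [Nat.centralBinom] at c
    have c2 : Nat.choose (2 * (r + 1)) (r + 1) = 2 * Nat.choose (2 * r + 1) (r + 1) := by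
      rw [show 2 * (r + 1) = 2 * r + 1 + 1 by ring, Nat.choose_succ_succ, Nat.choose_symm_half]
      ring
    zify at c c2
    rw [show 2 * (r + 1) = 2 * r + 1 + 1 by ring] at c c2 ⊢
    have p : (2 : ℤ) ^ (2 * r) = 4 ^ r := by rw [pow_mul]; norm_num
    rw [pow_succ, p] at e3 e4
    rw [p] at e1 e2
    rw [pow_succ]
    push_cast at *
    constructor
    · rw [e3, e2]; linarith
    · rw [e4, e1]; linarith

theorem sums_odd (K r : ℕ) (h : r < K) :
    evenSum K (2 * r + 1) = (2 * r + 1) * (Nat.choose (2 * r) r : ℤ) - 4 ^ r := by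
  obtain ⟨h1, h2⟩ := sums_even K r h
  rw [evenSum_succ K (2 * r) (by omega), hitCount_one, h2, show (2 * r + 1) / 2 = r by omega,
    pow_mul]
  norm_num; ring

/-- Prepend a value. -/
def consEmb (N : ℕ) (a : ℤ) : (Fin (N + 1) → ℤ) ↪ (Fin (N + 2) → ℤ) where
  toFun g := Fin.cons a g
  inj' := fun _ _ h => (Fin.cons_injective2 h).2

theorem consEmb_apply (N : ℕ) (a : ℤ) (g : Fin (N + 1) → ℤ) :
    consEmb N a g = (Fin.cons a g : Fin (N + 2) → ℤ) := rfl

/-- Walks with `N` steps, starting at `a`, staying in `[-1, n+1]`. -/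
noncomputable def walks (n : ℤ) : (N : ℕ) → ℤ → Finset (Fin (N + 1) → ℤ)
  | 0, a => if -1 ≤ a ∧ a ≤ n + 1 then {fun _ => a} else ∅
  | N + 1, a => if -1 ≤ a ∧ a ≤ n + 1 then
      (walks n N (a + 1) ∪ walks n N (a - 1)).map
        (consEmb N a) else ∅

theorem mem_walks (n : ℤ) (N : ℕ) (a : ℤ) (f : Fin (N + 1) → ℤ) :
    f ∈ walks n N a ↔ f 0 = a ∧ (∀ i, -1 ≤ f i ∧ f i ≤ n + 1) ∧
      ∀ i : Fin N, f i.succ = f i.castSucc + 1 ∨ f i.succ = f i.castSucc - 1 := by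
  induction N generalizing a with
  | zero =>
    simp only [walks]
    have e : ∀ g : Fin 1 → ℤ, g = (fun _ => g 0) := fun g => by
      ext i; rw [Subsingleton.elim i 0]
    split_ifs with h
    · simp only [Finset.mem_singleton]
      constructor
      · rintro rfl; exact ⟨rfl, fun _ => h, fun i => i.elim0⟩
      · rintro ⟨h0, -, -⟩; rw [e f, h0]
    · simp only [Finset.notMem_empty, false_iff]
      rintro ⟨h0, h1, -⟩
      exact h (h0 ▸ h1 0)
  | succ N ih =>
    simp only [walks]
    split_ifs with h
    · simp only [Finset.mem_map, Finset.mem_union, ih, consEmb_apply]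
      constructor
      · rintro ⟨g, hg, rfl⟩
        refine ⟨rfl, ?_, ?_⟩
        · intro i
          refine Fin.cases ?_ ?_ i
          · simpa using h
          · intro i; simp only [Fin.cons_succ]
            rcases hg with hg | hg <;> exact hg.2.1 i
        · intro i
          refine Fin.cases ?_ ?_ i
          · simp only [Fin.castSucc_zero, Fin.cons_zero, Fin.cons_succ]
            rcases hg with hg | hg
            · left; exact hg.1
            · right; exact hg.1
          · intro i
            rw [← Fin.succ_castSucc]; simp only [Fin.cons_succ]
            rcases hg with hg | hg <;> exact hg.2.2 i
      · rintro ⟨h0, h1, h2⟩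
        refine ⟨Fin.tail f, ?_, ?_⟩
        · have : ∀ i : Fin N, Fin.tail f i.succ = Fin.tail f i.castSucc + 1 ∨
              Fin.tail f i.succ = Fin.tail f i.castSucc - 1 := by
            intro i; exact h2 i.succ
          have h3 : ∀ i, -1 ≤ Fin.tail f i ∧ Fin.tail f i ≤ n + 1 := fun i => h1 i.succ
          rcases h2 0 with h4 | h4
          · left; exact ⟨by rw [← h0]; exact h4, h3, this⟩
          · right; exact ⟨by rw [← h0]; exact h4, h3, this⟩
        · rw [← h0]; exact Fin.cons_self_tail f
    · simp only [Finset.notMem_empty, false_iff]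
      rintro ⟨h0, h1, -⟩
      exact h (h0 ▸ h1 0)

theorem card_walks (n : ℕ) (N : ℕ) (hN : N < n + 4) (a : ℤ) (h1 : -2 ≤ a) (h2 : a ≤ n + 2) :
    ((walks n N a).card : ℤ) = 2 ^ N - hitCount N (a + 2) - hitCount N (n + 2 - a) := by
  induction N generalizing a with
  | zero =>
    simp only [walks]
    split_ifs with h
    · rw [hitCount_big _ _ (by push_cast; omega), hitCount_big _ _ (by push_cast; omega)]; simp
    · rcases (by omega : a = -2 ∨ a = n + 2) with rfl | rfl
      · rw [hitCount_nonpos _ _ (by omega), hitCount_big _ _ (by push_cast; omega)]; simp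
      · rw [hitCount_big _ _ (by push_cast; omega), hitCount_nonpos _ _ (by omega)]; simp
  | succ N ih =>
    simp only [walks]
    split_ifs with h
    · rw [Finset.card_map, Finset.card_union_of_disjoint, hitCount_succ _ _ (by omega),
        hitCount_succ _ _ (by omega)]
      · push_cast
        rw [ih (by omega) _ (by omega) (by omega), ih (by omega) _ (by omega) (by omega), pow_succ]
        ring_nf
      · rw [Finset.disjoint_left]
        intro f hf hf'
        rw [mem_walks] at hf hf'
        have := hf.1.symm.trans hf'.1
        omega
    · rcases (by omega : a = -2 ∨ a = n + 2) with rfl | rfl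
      · rw [hitCount_nonpos _ _ (by omega), hitCount_big _ _ (by push_cast; omega)]; simp
      · rw [hitCount_big _ _ (by push_cast; omega), hitCount_nonpos _ _ (by omega)]; simp

theorem total_walks (n : ℕ) (hn : 1 ≤ n) :
    (((Finset.range ((n + 1) / 2 + 1)).biUnion
      (fun k : ℕ => walks n (n - 1) (2 * (k : ℤ)))).card : ℚ) = fb (n + 1) := by
  rw [Finset.card_biUnion]
  swap
  · intro k _ l _ hkl
    simp only [Function.onFun]
    rw [Finset.disjoint_left]
    intro f hf hf'
    rw [mem_walks] at hf hf'
    have := hf.1.symm.trans hf'.1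
    omega
  have key : ((∑ k ∈ Finset.range ((n + 1) / 2 + 1), (walks n (n - 1) (2 * (k : ℤ))).card : ℕ) : ℤ)
      = ((n + 1) / 2 + 1 : ℕ) * 2 ^ (n - 1) - evenSum ((n + 1) / 2 + 1) (n - 1)
        - ∑ k ∈ Finset.range ((n + 1) / 2 + 1), hitCount (n - 1) (n + 2 - 2 * (k : ℤ)) := by
    push_cast
    rw [Finset.sum_congr rfl (fun (k : ℕ) (hk : k ∈ Finset.range ((n + 1) / 2 + 1)) =>
      card_walks n (n - 1) (by omega) (2 * (k : ℤ)) (by omega)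
      (by have := Finset.mem_range.1 hk; omega))]
    rw [Finset.sum_sub_distrib, Finset.sum_sub_distrib]
    simp [evenSum]
  rw [← Finset.sum_range_reflect (fun k : ℕ => hitCount (n - 1) ((n : ℤ) + 2 - 2 * (k : ℤ)))] at key
  rcases Nat.even_or_odd' n with ⟨r, rfl | rfl⟩
  · obtain ⟨q, rfl⟩ : ∃ q, r = q + 1 := ⟨r - 1, by omega⟩
    rw [show (2 * (q + 1) + 1) / 2 + 1 = q + 2 by omega,
      show 2 * (q + 1) - 1 = 2 * q + 1 by omega] at *
    have e : ∑ j ∈ Finset.range (q + 2), hitCount (2 * q + 1)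
        (((2 * (q + 1) : ℕ) : ℤ) + 2 - 2 * ((q + 2 - 1 - j : ℕ) : ℤ)) = evenSum (q + 2) (2 * q + 1) := by
      apply Finset.sum_congr rfl
      intro j hj
      have := Finset.mem_range.1 hj
      congr 1; omega
    rw [e, sums_odd _ _ (by omega)] at key
    have c := Nat.succ_mul_centralBinom_succ q
    simp only [Nat.centralBinom] at c
    have key' := congrArg (fun z : ℤ => (z : ℚ)) key
    have c' := congrArg (fun z : ℕ => (z : ℚ)) c
    simp only [fb]
    rw [if_pos (by exact ⟨q + 1, rfl⟩)]
    rw [show ((2 * (q + 1) + 1 : ℕ) : ℤ) - 3 = ((2 * q : ℕ) : ℤ) by push_cast; ring, zpow_natCast,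
      show 2 * (q + 1) + 1 - 1 = 2 * (q + 1) by omega, show 2 * (q + 1) / 2 = q + 1 by omega]
    have p : (2 : ℚ) ^ (2 * q) = 4 ^ q := by rw [pow_mul]; norm_num
    push_cast at key' c' ⊢
    rw [pow_succ, p] at key'
    rw [key', p]
    linarith
  · rw [show (2 * r + 1 + 1) / 2 + 1 = r + 2 by omega,
      show 2 * r + 1 - 1 = 2 * r by omega] at *
    have e : ∑ j ∈ Finset.range (r + 2), hitCount (2 * r)
        (((2 * r + 1 : ℕ) : ℤ) + 2 - 2 * ((r + 2 - 1 - j : ℕ) : ℤ)) = oddSum (r + 2) (2 * r) := by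
      apply Finset.sum_congr rfl
      intro j hj
      have := Finset.mem_range.1 hj
      congr 1; omega
    obtain ⟨h1, h2⟩ := sums_even (r + 2) r (by omega)
    rw [e, h2] at key
    have key' := congrArg (fun z : ℤ => (z : ℚ)) key
    have h1' := congrArg (fun z : ℤ => (z : ℚ)) h1
    simp only [fb]
    rw [if_neg (by rw [Nat.not_odd_iff_even]; exact ⟨r + 1, by ring⟩)]
    rw [show ((2 * r + 1 + 1 : ℕ) : ℤ) - 3 = ((2 * r : ℕ) : ℤ) - 1 by push_cast; ring,
      zpow_sub_one₀ (by norm_num), zpow_natCast,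
      show 2 * r + 1 + 1 - 2 = 2 * r by omega, show 2 * r / 2 = r by omega]
    have p : (2 : ℚ) ^ (2 * r) = 4 ^ r := by rw [pow_mul]; norm_num
    push_cast at key' h1' ⊢
    rw [p] at key' 
    rw [key', p]
    linarith

/-! ### Normal forms and the longest element -/

theorem An_self (n : ℕ) (i : Fin n) : (CoxeterMatrix.A n) i i = 1 := by
  simp [CoxeterMatrix.A]

theorem An_adj (n : ℕ) (i j : Fin n) (h : (j : ℕ) + 1 = i ∨ (i : ℕ) + 1 = j) :
    (CoxeterMatrix.A n) i j = 3 := by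
  have : i ≠ j := by rintro rfl; omega
  simp [CoxeterMatrix.A, h, this]

theorem An_comm (n : ℕ) (i j : Fin n) :
    (CoxeterMatrix.A n) i j = 2 ↔ i ≠ j ∧ (j : ℕ) + 1 ≠ i ∧ (i : ℕ) + 1 ≠ j := by
  simp only [CoxeterMatrix.A, Matrix.of_apply]
  split_ifs with h1 h2 <;> simp_all
  tauto

section group
variable {n : ℕ} {W : Type*} [Group W] (cs : CoxeterSystem (CoxeterMatrix.A n) W)

/-- The generators, indexed by natural numbers. -/
noncomputable def gen (i : ℕ) : W := if h : i < n then cs.simple ⟨i, h⟩ else 1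

theorem gen_sq (i : ℕ) : gen cs i * gen cs i = 1 := by
  simp only [gen]; split_ifs <;> simp

theorem simple_comm (i j : Fin n) (h : (CoxeterMatrix.A n) i j = 2) :
    cs.simple i * cs.simple j = cs.simple j * cs.simple i := by
  have := cs.simple_mul_simple_pow i j
  rw [h, pow_two] at this
  have h2 := eq_inv_of_mul_eq_one_left this
  simpa using h2

theorem gen_comm (i j : ℕ) (h : i + 1 < j) : gen cs i * gen cs j = gen cs j * gen cs i := by
  simp only [gen]
  split_ifs with h1 h2
  · apply simple_comm
    rw [An_comm]
    simp only [ne_eq, Fin.mk.injEq]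
    omega
  all_goals simp

theorem gen_braid (i : ℕ) (h : i + 1 < n) :
    gen cs (i + 1) * gen cs i * gen cs (i + 1) = gen cs i * gen cs (i + 1) * gen cs i := by
  simp only [gen]
  rw [dif_pos h, dif_pos (by omega)]
  have := cs.simple_mul_simple_pow ⟨i + 1, h⟩ ⟨i, by omega⟩
  rw [An_adj _ _ _ (by simp)] at this
  simp only [pow_succ, pow_zero, one_mul] at this
  have h2 := eq_inv_of_mul_eq_one_left (a := cs.simple ⟨i + 1, h⟩ * cs.simple ⟨i, by omega⟩ *
    cs.simple ⟨i + 1, h⟩) (b := cs.simple ⟨i, by omega⟩ * cs.simple ⟨i + 1, h⟩ *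
      cs.simple ⟨i, by omega⟩) (by simpa [mul_assoc] using this)
  simpa [mul_assoc] using h2

/-- `desc m k = s_{m-1} s_{m-2} ⋯ s_{m-k}`. -/
noncomputable def desc (m : ℕ) : ℕ → W
  | 0 => 1
  | k + 1 => desc m k * gen cs (m - (k + 1))

theorem desc_comm (m k i : ℕ) (hk : k ≤ m) (h : i + k + 1 < m) :
    desc cs m k * gen cs i = gen cs i * desc cs m k := by
  induction k with
  | zero => simp [desc]
  | succ k ih =>
    simp only [desc]
    rw [mul_assoc, ← gen_comm cs i _ (by omega), ← mul_assoc, ih (by omega) (by omega), mul_assoc]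

theorem desc_shift (m k i : ℕ) (hm : m ≤ n) (hk : k ≤ m) (hi : i + 1 < m) (h : m < i + 1 + k) :
    desc cs m k * gen cs (i + 1) = gen cs i * desc cs m k := by
  induction k with
  | zero => omega
  | succ k ih =>
    rcases Nat.lt_or_ge m (i + 1 + k) with h1 | h1
    · simp only [desc]
      rw [mul_assoc, gen_comm cs _ (i + 1) (by omega), ← mul_assoc, ih (by omega) h1, mul_assoc]
    · have : i + 1 + k = m := by omega
      obtain ⟨k, rfl⟩ : ∃ k', k = k' + 1 := ⟨k - 1, by omega⟩
      simp only [desc]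
      rw [show m - (k + 1) = i + 1 by omega, show m - (k + 1 + 1) = i by omega, mul_assoc, mul_assoc,
        ← mul_assoc (gen cs (i + 1)), gen_braid cs i (by omega), ← mul_assoc, ← mul_assoc,
        desc_comm cs m k i (by omega) (by omega)]
      simp only [mul_assoc]

/-- `w` has a normal form of length `L` in the parabolic subgroup on the first `m` generators. -/
def NF : ℕ → ℕ → W → Prop
  | 0, L, w => L = 0 ∧ w = 1
  | m + 1, L, w => ∃ L' w' k, NF m L' w' ∧ k ≤ m + 1 ∧ L = L' + k ∧ w = w' * desc cs (m + 1) k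

theorem NF_mul (m : ℕ) (hm : m ≤ n) (i : ℕ) (hi : i < m) (L : ℕ) (w : W) (h : NF cs m L w) :
    ∃ L', NF cs m L' (w * gen cs i) := by
  induction m generalizing i L w with
  | zero => omega
  | succ m ih =>
    obtain ⟨L', w', k, h1, h2, rfl, rfl⟩ := h
    rcases (by omega : i + k = m ∨ i + k = m + 1 ∨ i + k < m ∨ m + 1 < i + k) with h3 | h3 | h3 | h3
    · refine ⟨_, L', w', k + 1, h1, by omega, rfl, ?_⟩
      simp only [desc]
      rw [show m + 1 - (k + 1) = i by omega, mul_assoc]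
    · obtain ⟨k, rfl⟩ : ∃ k', k = k' + 1 := ⟨k - 1, by omega⟩
      refine ⟨_, L', w', k, h1, by omega, rfl, ?_⟩
      simp only [desc]
      rw [show m + 1 - (k + 1) = i by omega, mul_assoc, mul_assoc, gen_sq, mul_one]
    · obtain ⟨L'', h4⟩ := ih (by omega) i (by omega) _ _ h1
      refine ⟨_, L'', _, k, h4, h2, rfl, ?_⟩
      rw [mul_assoc, desc_comm cs (m + 1) k i (by omega) (by omega), mul_assoc]
    · obtain ⟨i, rfl⟩ : ∃ i', i = i' + 1 := ⟨i - 1, by omega⟩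
      obtain ⟨L'', h4⟩ := ih (by omega) i (by omega) _ _ h1
      refine ⟨_, L'', _, k, h4, h2, rfl, ?_⟩
      rw [mul_assoc, desc_shift cs (m + 1) k i (by omega) (by omega) (by omega) (by omega), mul_assoc]

theorem NF_one (m : ℕ) : NF cs m 0 1 := by
  induction m with
  | zero => exact ⟨rfl, rfl⟩
  | succ m ih => exact ⟨0, 1, 0, ih, by omega, rfl, by simp [desc]⟩

theorem exists_NF (w : W) : ∃ L, NF cs n L w := by
  induction w using cs.simple_induction_right with
  | one => exact ⟨0, NF_one cs n⟩
  | mul_simple_right w i ih =>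
    obtain ⟨L, h⟩ := ih
    have := NF_mul cs n le_rfl i i.2 L w h
    simpa [gen] using this

theorem length_gen_le (i : ℕ) : cs.length (gen cs i) ≤ 1 := by
  simp only [gen]; split_ifs <;> simp

theorem length_desc_le (m k : ℕ) : cs.length (desc cs m k) ≤ k := by
  induction k with
  | zero => simp [desc]
  | succ k ih =>
    simp only [desc]
    have := cs.length_mul_le (desc cs m k) (gen cs (m - (k + 1)))
    have := length_gen_le cs (m - (k + 1))
    omega

theorem NF_length (m L : ℕ) (w : W) (h : NF cs m L w) : cs.length w ≤ L := by
  induction m generalizing L w with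
  | zero => obtain ⟨rfl, rfl⟩ := h; simp
  | succ m ih =>
    obtain ⟨L', w', k, h1, h2, rfl, rfl⟩ := h
    have := ih _ _ h1
    have := cs.length_mul_le w' (desc cs (m + 1) k)
    have := length_desc_le cs (m + 1) k
    omega

theorem NF_le (m L : ℕ) (w : W) (h : NF cs m L w) : L ≤ ∑ k ∈ Finset.range (m + 1), k := by
  induction m generalizing L w with
  | zero => obtain ⟨rfl, rfl⟩ := h; simp
  | succ m ih =>
    obtain ⟨L', w', k, h1, h2, rfl, rfl⟩ := h
    have := ih _ _ h1
    rw [Finset.sum_range_succ]; omega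

theorem NF_unique (m L L' : ℕ) (w w' : W) (h : NF cs m L w) (h' : NF cs m L' w')
    (hL : ∑ k ∈ Finset.range (m + 1), k ≤ L) (hL' : ∑ k ∈ Finset.range (m + 1), k ≤ L') :
    w = w' := by
  induction m generalizing L L' w w' with
  | zero => rw [h.2, h'.2]
  | succ m ih =>
    obtain ⟨L₁, w₁, k₁, h1, h2, rfl, rfl⟩ := h
    obtain ⟨L₂, w₂, k₂, h3, h4, rfl, rfl⟩ := h'
    have := NF_le cs _ _ _ h1
    have := NF_le cs _ _ _ h3
    rw [Finset.sum_range_succ] at hL hL'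
    rw [ih _ _ _ _ h1 h3 (by omega) (by omega), show k₁ = k₂ by omega]

/-- Uniqueness of elements of maximal length. -/
theorem eq_of_length (w w' : W) (h : ∑ k ∈ Finset.range (n + 1), k ≤ cs.length w)
    (h' : ∑ k ∈ Finset.range (n + 1), k ≤ cs.length w') : w = w' := by
  obtain ⟨L, hw⟩ := exists_NF cs w
  obtain ⟨L', hww⟩ := exists_NF cs w'
  exact NF_unique cs n L L' w w' hw hww (h.trans (NF_length cs _ _ _ hw))
    (h'.trans (NF_length cs _ _ _ hww))

/-! ### The action by permutations -/

/-- Adjacent transposition. -/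
def adjSwap (i : Fin n) : Equiv.Perm (Fin (n + 1)) := Equiv.swap i.castSucc i.succ

theorem adjSwap_liftable : (CoxeterMatrix.A n).IsLiftable (adjSwap (n := n)) := by
  intro i j
  by_cases hij : i = j
  · subst hij; rw [An_self]; simp [adjSwap]
  by_cases hadj : (j : ℕ) + 1 = i ∨ (i : ℕ) + 1 = j
  · rw [An_adj _ _ _ hadj]
    have key : ∀ a b c : Fin (n + 1), a ≠ b → a ≠ c → b ≠ c →
        (Equiv.swap a b * Equiv.swap a c) ^ 3 = 1 := by
      intro a b c h1 h2 h3
      have := Equiv.Perm.isThreeCycle_swap_mul_swap_same h1 h2 h3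
      rw [← this.orderOf]; exact pow_orderOf_eq_one _
    rcases hadj with h | h
    · have e : j.succ = i.castSucc := by ext; simpa using h
      simp only [adjSwap]
      rw [Equiv.swap_comm j.castSucc, e]
      apply key <;> simp only [ne_eq, Fin.ext_iff, Fin.val_castSucc, Fin.val_succ] <;> omega
    · have e : i.succ = j.castSucc := by ext; simpa using h
      simp only [adjSwap]
      rw [Equiv.swap_comm i.castSucc, e]
      apply key <;> simp only [ne_eq, Fin.ext_iff, Fin.val_castSucc, Fin.val_succ] <;> omega
  · have h2 : (CoxeterMatrix.A n) i j = 2 := by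
      rw [An_comm]; exact ⟨hij, by omega, by omega⟩
    rw [h2]
    have hd : Equiv.Perm.Disjoint (adjSwap i) (adjSwap j) := by
      intro x
      simp only [adjSwap]
      by_cases hx : x = i.castSucc ∨ x = i.succ
      · right
        apply Equiv.swap_apply_of_ne_of_ne <;> rcases hx with rfl | rfl <;>
          simp only [ne_eq, Fin.ext_iff, Fin.val_castSucc, Fin.val_succ] at * <;> omega
      · left; push Not at hx
        exact Equiv.swap_apply_of_ne_of_ne hx.1 hx.2
    rw [hd.commute.mul_pow]
    simp [adjSwap, pow_two]

/-- The permutation representation. -/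
noncomputable def phi : W →* Equiv.Perm (Fin (n + 1)) := cs.lift ⟨adjSwap, adjSwap_liftable⟩

theorem phi_simple (i : Fin n) : phi cs (cs.simple i) = adjSwap i :=
  cs.lift_apply_simple adjSwap_liftable i

/-- Inversions. -/
def invs (p : Equiv.Perm (Fin (n + 1))) : Finset (Fin (n + 1) × Fin (n + 1)) :=
  Finset.univ.filter fun x => x.1 < x.2 ∧ p x.2 < p x.1

theorem mem_invs (p : Equiv.Perm (Fin (n + 1))) (a b : Fin (n + 1)) :
    (a, b) ∈ invs p ↔ a < b ∧ p b < p a := by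
  unfold invs; rw [Finset.mem_filter]; simp

theorem adjSwap_lt (i : Fin n) (a b : Fin (n + 1)) (h : a < b)
    (h' : ¬ (a = i.castSucc ∧ b = i.succ)) : adjSwap i a < adjSwap i b := by
  simp only [adjSwap, Equiv.swap_apply_def]
  split_ifs <;> simp only [Fin.ext_iff, Fin.lt_def, Fin.val_castSucc, Fin.val_succ] at * <;> omega

theorem adjSwap_adjSwap (i : Fin n) (a : Fin (n + 1)) : adjSwap i (adjSwap i a) = a := by
  simp [adjSwap]

theorem invs_mul_up (p : Equiv.Perm (Fin (n + 1))) (i : Fin n) (h : p i.castSucc < p i.succ) :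
    (invs (p * adjSwap i)).card = (invs p).card + 1 := by
  have e1 : adjSwap i i.castSucc = i.succ := by simp [adjSwap]
  have e2 : adjSwap i i.succ = i.castSucc := by simp [adjSwap]
  have e : invs (p * adjSwap i) = insert (i.castSucc, i.succ)
      ((invs p).image fun x => (adjSwap i x.1, adjSwap i x.2)) := by
    ext ⟨a, b⟩
    simp only [mem_invs, Finset.mem_insert, Finset.mem_image, Prod.mk.injEq, Prod.exists,
      Equiv.Perm.mul_apply]
    constructor
    · rintro ⟨h1, h2⟩
      by_cases hc : a = i.castSucc ∧ b = i.succ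
      · left; exact hc
      · right
        exact ⟨adjSwap i a, adjSwap i b, ⟨adjSwap_lt i a b h1 hc, h2⟩, adjSwap_adjSwap _ _,
          adjSwap_adjSwap _ _⟩
    · rintro (⟨rfl, rfl⟩ | ⟨c, d, ⟨h1, h2⟩, rfl, rfl⟩)
      · rw [e1, e2]; exact ⟨Fin.castSucc_lt_succ, h⟩
      · rw [adjSwap_adjSwap, adjSwap_adjSwap]
        refine ⟨adjSwap_lt i c d h1 ?_, h2⟩
        rintro ⟨rfl, rfl⟩
        exact absurd h2 (not_lt.2 h.le)
  rw [e, Finset.card_insert_of_notMem, Finset.card_image_of_injective]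
  · rintro ⟨a, b⟩ ⟨c, d⟩ hh; simpa using hh
  simp only [mem_invs, Finset.mem_image, Prod.mk.injEq, Prod.exists, not_exists, not_and]
  rintro c d ⟨h1, h2⟩ h3 h4
  have h5 : c = i.succ := by rw [← adjSwap_adjSwap i c, h3, e1]
  have h6 : d = i.castSucc := by rw [← adjSwap_adjSwap i d, h4, e2]
  subst h5 h6
  exact absurd h1 (not_lt.2 (Fin.castSucc_lt_succ).le)

theorem invs_mul_le (p : Equiv.Perm (Fin (n + 1))) (i : Fin n) :
    (invs (p * adjSwap i)).card ≤ (invs p).card + 1 := by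
  rcases lt_trichotomy (p i.castSucc) (p i.succ) with h | h | h
  · exact (invs_mul_up p i h).le
  · have := p.injective h
    exact absurd this (Fin.castSucc_lt_succ).ne
  · have := invs_mul_up (p * adjSwap i) i (by simpa [adjSwap] using h)
    rw [mul_assoc, show adjSwap i * adjSwap i = 1 from by simp [adjSwap], mul_one] at this
    omega

theorem invs_wordProd_le (u : List (Fin n)) : (invs (phi cs (cs.wordProd u))).card ≤ u.length := by
  induction u using List.reverseRecOn with
  | nil =>
    simp only [wordProd_nil, map_one, List.length_nil, Nat.le_zero, Finset.card_eq_zero]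
    ext ⟨a, b⟩
    simp only [mem_invs, Equiv.Perm.one_apply, Finset.notMem_empty, iff_false, not_and]
    intro h; exact not_lt.2 h.le
  | append_singleton u i ih =>
    rw [wordProd_append, wordProd_singleton, map_mul, phi_simple]
    have := invs_mul_le (phi cs (cs.wordProd u)) i
    simp; omega

theorem invs_le_length (w : W) : (invs (phi cs w)).card ≤ cs.length w := by
  obtain ⟨u, hu, rfl⟩ := cs.exists_isReduced w
  rw [hu.eq]; exact invs_wordProd_le cs u

theorem invs_rev (p : Equiv.Perm (Fin (n + 1))) (h : ∀ a b, a < b → p b < p a) :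
    (invs p).card = ∑ k ∈ Finset.range (n + 1), k := by
  have : invs p = Finset.univ.biUnion fun b : Fin (n + 1) => (Finset.Iio b).image
      fun a => (a, b) := by
    ext ⟨a, b⟩
    simp only [mem_invs, Finset.mem_univ, true_and, Finset.mem_biUnion,
      Finset.mem_image, Finset.mem_Iio, Prod.mk.injEq]
    constructor
    · rintro ⟨h1, -⟩; exact ⟨b, a, h1, rfl, rfl⟩
    · rintro ⟨b', a', h1, rfl, rfl⟩; exact ⟨h1, h _ _ h1⟩
  rw [this, Finset.card_biUnion]
  · rw [Finset.sum_congr rfl (fun b _ => Finset.card_image_of_injective (Finset.Iio b)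
      (f := fun a => (a, b)) (fun a a' hh => by simpa using hh))]
    simp only [Fin.card_Iio]
    exact Fin.sum_univ_eq_sum_range (fun k => k) (n + 1)
  · intro b _ b' _ hb
    simp only [Function.onFun, Finset.disjoint_left, Finset.mem_image]
    rintro x ⟨a, -, rfl⟩ ⟨a', -, h2⟩
    exact hb (Prod.mk.inj h2).2.symm

end group

/-! ### Height functions and runs -/

section heap
variable {n : ℕ}

/-- Adjacent generators. -/
def Nbr (i j : Fin n) : Prop := (j : ℕ) + 1 = i ∨ (i : ℕ) + 1 = j

/-- Height functions of order ideals of the heap. -/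
def IsPath (f : Fin n → ℤ) : Prop :=
  (∀ i, -1 ≤ f i ∧ f i ≤ n + 1) ∧ (∀ i, f i % 2 = (i : ℤ) % 2) ∧
    ∀ i j, Nbr i j → (f j = f i + 1 ∨ f j = f i - 1)

/-- Fire a letter. -/
def fire (f : Fin n → ℤ) (i : Fin n) : Fin n → ℤ := Function.update f i (f i + 2)

/-- A letter can be fired. -/
def CanFire (f : Fin n → ℤ) (i : Fin n) : Prop := (∀ j, Nbr i j → f j = f i + 1) ∧ f i + 1 ≤ n

/-- Firing the letters of a word, one after the other, leads from `f` to `g`. -/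
def Run : (Fin n → ℤ) → List (Fin n) → (Fin n → ℤ) → Prop
  | f, [], g => f = g
  | f, i :: u, g => CanFire f i ∧ Run (fire f i) u g

theorem Nbr.symm {i j : Fin n} (h : Nbr i j) : Nbr j i := by unfold Nbr at *; omega

theorem Nbr.ne {i j : Fin n} (h : Nbr i j) : i ≠ j := by rintro rfl; unfold Nbr at h; omega

theorem fire_self (f : Fin n → ℤ) (i : Fin n) : fire f i i = f i + 2 := by simp [fire]

theorem fire_ne (f : Fin n → ℤ) (i j : Fin n) (h : j ≠ i) : fire f i j = f j := by
  simp [fire, h]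

theorem fire_inj (f g : Fin n → ℤ) (i : Fin n) (h : fire f i = fire g i) : f = g := by
  ext j
  have := congrFun h j
  by_cases hj : j = i
  · subst hj; rw [fire_self, fire_self] at this; omega
  · rwa [fire_ne _ _ _ hj, fire_ne _ _ _ hj] at this

theorem fire_comm (f : Fin n → ℤ) (i j : Fin n) (h : i ≠ j) :
    fire (fire f i) j = fire (fire f j) i := by
  ext k
  by_cases hi : k = i
  · subst hi; rw [fire_ne _ _ _ h, fire_self, fire_self, fire_ne _ _ _ h]
  · by_cases hj : k = j
    · subst hj; rw [fire_self, fire_ne _ _ _ hi, fire_ne _ _ _ hi, fire_self]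
    · rw [fire_ne _ _ _ hi, fire_ne _ _ _ hj, fire_ne _ _ _ hi, fire_ne _ _ _ hj]

theorem canFire_fire (f : Fin n → ℤ) (i j : Fin n) (h : i ≠ j) (h' : ¬ Nbr i j) :
    CanFire (fire f i) j ↔ CanFire f j := by
  unfold CanFire
  rw [fire_ne _ _ _ h.symm]
  apply and_congr_left'
  apply forall_congr'
  intro k
  apply imp_congr_right
  intro hk
  rw [fire_ne]
  rintro rfl
  exact h' hk.symm

theorem run_append (f g : Fin n → ℤ) (u v : List (Fin n)) :
    Run f (u ++ v) g ↔ ∃ h, Run f u h ∧ Run h v g := by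
  induction u generalizing f with
  | nil => simp [Run]
  | cons i u ih => simp [Run, ih, and_assoc]

theorem run_snoc (f g : Fin n → ℤ) (u : List (Fin n)) (i : Fin n) :
    Run f (u ++ [i]) g ↔ ∃ h, Run f u h ∧ CanFire h i ∧ fire h i = g := by
  rw [run_append]; simp [Run]

theorem isPath_fire (f : Fin n → ℤ) (i : Fin n) (hf : IsPath f) (h : CanFire f i) :
    IsPath (fire f i) := by
  obtain ⟨h1, h2, h3⟩ := hf
  refine ⟨fun j => ?_, fun j => ?_, fun j k hjk => ?_⟩
  · by_cases hj : j = i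
    · subst hj; rw [fire_self]; have := h1 j; have := h.2; omega
    · rw [fire_ne _ _ _ hj]; exact h1 j
  · by_cases hj : j = i
    · subst hj; rw [fire_self]; have := h2 j; omega
    · rw [fire_ne _ _ _ hj]; exact h2 j
  · by_cases hj : j = i
    · subst hj; rw [fire_self, fire_ne _ _ _ hjk.ne.symm]; have := h.1 k hjk; omega
    · by_cases hk : k = i
      · subst hk; rw [fire_self, fire_ne _ _ _ hj]; have := h.1 j hjk.symm; omega
      · rw [fire_ne _ _ _ hj, fire_ne _ _ _ hk]; exact h3 j k hjk

theorem isPath_run (u : List (Fin n)) (f g : Fin n → ℤ) (hf : IsPath f) (h : Run f u g) :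
    IsPath g := by
  induction u generalizing f with
  | nil => exact h ▸ hf
  | cons i u ih => exact ih _ (isPath_fire f i hf h.1) h.2

theorem run_count (u : List (Fin n)) (f g : Fin n → ℤ) (h : Run f u g) (i : Fin n) :
    g i = f i + 2 * (u.count i : ℤ) := by
  induction u generalizing f with
  | nil => have := h; simp only [Run] at this; subst this; simp
  | cons j u ih =>
    rw [ih _ h.2, List.count_cons]
    by_cases hj : j = i
    · subst hj; rw [fire_self]; simp; ring
    · rw [fire_ne _ _ _ (Ne.symm hj)]; simp [hj]

theorem A_two_iff (i j : Fin n) : (CoxeterMatrix.A n) i j = 2 ↔ i ≠ j ∧ ¬ Nbr i j := by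
  rw [An_comm]; unfold Nbr; tauto

theorem run_commStep (f g : Fin n → ℤ) (u v : List (Fin n))
    (h : CommStep (CoxeterMatrix.A n) u v) (hu : Run f u g) : Run f v g := by
  obtain ⟨x, y, i, j, hij, rfl, rfl⟩ := h
  rw [A_two_iff] at hij
  obtain ⟨h1, h2⟩ := hij
  rw [run_append] at hu ⊢
  obtain ⟨k, hk, h3, h4, h5⟩ := hu
  refine ⟨k, hk, (canFire_fire k i j h1 h2).1 h4, ?_, ?_⟩
  · exact (canFire_fire k j i h1.symm (fun h => h2 h.symm)).2 h3
  · rwa [fire_comm k i j h1] at h5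

theorem run_commEquiv (f g : Fin n → ℤ) (u v : List (Fin n))
    (h : CommEquiv (CoxeterMatrix.A n) u v) (hu : Run f u g) : Run f v g := by
  induction h with
  | refl => exact hu
  | tail _ h2 ih => exact run_commStep _ _ _ _ h2 ih

theorem commStep_symm (u v : List (Fin n)) (h : CommStep (CoxeterMatrix.A n) u v) :
    CommStep (CoxeterMatrix.A n) v u := by
  obtain ⟨x, y, i, j, hij, rfl, rfl⟩ := h
  exact ⟨x, y, j, i, by rw [CoxeterMatrix.symmetric]; exact hij, rfl, rfl⟩

theorem commEquiv_symm (u v : List (Fin n)) (h : CommEquiv (CoxeterMatrix.A n) u v) :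
    CommEquiv (CoxeterMatrix.A n) v u := by
  induction h with
  | refl => exact Relation.ReflTransGen.refl
  | tail _ h2 ih => exact Relation.ReflTransGen.head (commStep_symm _ _ h2) ih

theorem commEquiv_ctx (x y u v : List (Fin n)) (h : CommEquiv (CoxeterMatrix.A n) u v) :
    CommEquiv (CoxeterMatrix.A n) (x ++ u ++ y) (x ++ v ++ y) := by
  induction h with
  | refl => exact Relation.ReflTransGen.refl
  | tail _ h2 ih =>
    obtain ⟨a, b, i, j, hij, rfl, rfl⟩ := h2
    exact Relation.ReflTransGen.tail ih ⟨x ++ a, b ++ y, i, j, hij, by simp, by simp⟩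

theorem commEquiv_move (i : Fin n) (v : List (Fin n))
    (h : ∀ j ∈ v, (CoxeterMatrix.A n) i j = 2) :
    CommEquiv (CoxeterMatrix.A n) (i :: v) (v ++ [i]) := by
  induction v with
  | nil => exact Relation.ReflTransGen.refl
  | cons j v ih =>
    refine Relation.ReflTransGen.head ⟨[], v, i, j, h j (by simp), rfl, rfl⟩ ?_
    have := commEquiv_ctx [j] [] _ _ (ih fun k hk => h k (by simp [hk]))
    have e3 : CommEquiv (CoxeterMatrix.A n) (j :: i :: v) (j :: v ++ [i]) := by simpa using this
    exact e3

theorem exists_last (i : Fin n) (v : List (Fin n)) (h : i ∈ v) :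
    ∃ v₁ v₂, v = v₁ ++ i :: v₂ ∧ i ∉ v₂ := by
  induction v with
  | nil => simp at h
  | cons j v ih =>
    by_cases hv : i ∈ v
    · obtain ⟨v₁, v₂, rfl, h2⟩ := ih hv
      exact ⟨j :: v₁, v₂, rfl, h2⟩
    · have : i = j := by simpa [hv] using h
      subst this
      exact ⟨[], v, rfl, hv⟩

theorem run_unique (u v : List (Fin n)) (f g : Fin n → ℤ) (hu : Run f u g) (hv : Run f v g) :
    CommEquiv (CoxeterMatrix.A n) u v := by
  induction u using List.reverseRecOn generalizing v g with
  | nil =>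
    simp only [Run] at hu; subst hu
    rcases v with _ | ⟨j, v⟩
    · exact Relation.ReflTransGen.refl
    · have := run_count _ _ _ hv j
      simp at this; omega
  | append_singleton u i ih =>
    have hc1 := run_count _ _ _ hu i
    have hc2 := run_count _ _ _ hv i
    have hmem : i ∈ v := by
      rw [← List.count_pos_iff]
      simp at hc1; omega
    obtain ⟨v₁, v₂, rfl, hi⟩ := exists_last i v hmem
    have hcomm : ∀ j ∈ v₂, (CoxeterMatrix.A n) i j = 2 := by
      intro j hj
      rw [A_two_iff]
      refine ⟨fun h => hi (h ▸ hj), fun hij => ?_⟩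
      rw [run_append] at hv
      obtain ⟨k, hk, h1, h2⟩ := hv
      rw [run_snoc] at hu
      obtain ⟨k', hk', h3, rfl⟩ := hu
      have a1 := run_count _ _ _ h2 i
      have a2 := run_count _ _ _ h2 j
      rw [List.count_eq_zero_of_not_mem hi, fire_self, fire_self] at a1
      rw [fire_ne _ _ _ hij.ne.symm, fire_ne _ _ _ hij.ne.symm, h1.1 j hij, h3.1 j hij] at a2
      have := List.count_pos_iff.2 hj
      omega
    have e1 : CommEquiv (CoxeterMatrix.A n) (v₁ ++ i :: v₂) ((v₁ ++ v₂) ++ [i]) := by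
      have := commEquiv_ctx v₁ [] _ _ (commEquiv_move i v₂ hcomm)
      simpa using this
    have hv' := run_commEquiv _ _ _ _ e1 hv
    rw [run_snoc] at hu hv'
    obtain ⟨k, hk, -, rfl⟩ := hu
    obtain ⟨k', hk', -, h3⟩ := hv'
    have := fire_inj _ _ _ h3
    subst this
    have e2 := commEquiv_ctx [] [i] _ _ (ih _ _ hk hk')
    rw [List.nil_append, List.nil_append] at e2
    exact Relation.ReflTransGen.trans e2 (commEquiv_symm _ _ e1)

/-- The flat height functions. -/
def lev (t : ℤ) (i : Fin n) : ℤ := if (i : ℤ) % 2 = t % 2 then t else t - 1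

theorem isPath_lev (t : ℤ) (h0 : 0 ≤ t) (h1 : t ≤ n + 1) : IsPath (lev t : Fin n → ℤ) := by
  refine ⟨fun i => ?_, fun i => ?_, fun i j hij => ?_⟩
  · unfold lev; split_ifs <;> omega
  · unfold lev; split_ifs <;> omega
  · unfold lev; unfold Nbr at hij; split_ifs <;> omega

theorem exists_run_from_bot (hn : 0 < n) (k : ℕ) (f : Fin n → ℤ) (hf : IsPath f)
    (hk : ∑ i, (f i + 1) ≤ k) : ∃ u, Run (lev 0) u f := by
  induction k generalizing f with
  | zero =>
    refine ⟨[], ?_⟩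
    haveI : Nonempty (Fin n) := ⟨⟨0, hn⟩⟩
    have h0 : f ⟨0, hn⟩ + 1 ≤ ∑ i, (f i + 1) :=
      Finset.single_le_sum (f := fun i => f i + 1) (fun i _ => by have := (hf.1 i).1; omega)
        (Finset.mem_univ _)
    have := hf.2.1 ⟨0, hn⟩
    have := (hf.1 ⟨0, hn⟩).1
    simp at *
    omega
  | succ k ih =>
    haveI : Nonempty (Fin n) := ⟨⟨0, hn⟩⟩
    obtain ⟨i, hi⟩ := Finite.exists_max f
    by_cases h : f i ≤ 0
    · refine ⟨[], ?_⟩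
      ext j
      have := hi j; have := (hf.1 j).1; have := hf.2.1 j
      unfold lev; split_ifs <;> omega
    · have hnb : ∀ j, Nbr i j → f j = f i - 1 := by
        intro j hj
        have := hi j
        rcases hf.2.2 i j hj with h | h <;> omega
      set g := Function.update f i (f i - 2) with hg
      have gi : g i = f i - 2 := by simp [hg]
      have gj : ∀ j, j ≠ i → g j = f j := fun j hj => by simp [hg, hj]
      have hgp : IsPath g := by
        refine ⟨fun j => ?_, fun j => ?_, fun j l hjl => ?_⟩
        · by_cases hj : j = i
          · subst hj; rw [gi]; have := hf.1 j; omega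
          · rw [gj j hj]; exact hf.1 j
        · by_cases hj : j = i
          · subst hj; rw [gi]; have := hf.2.1 j; omega
          · rw [gj j hj]; exact hf.2.1 j
        · by_cases hj : j = i
          · subst hj; rw [gi, gj l hjl.ne.symm, hnb l hjl]; omega
          · by_cases hl : l = i
            · subst hl; rw [gi, gj j hj, hnb j hjl.symm]; omega
            · rw [gj j hj, gj l hl]; exact hf.2.2 j l hjl
      have hsum : ∑ j, (g j + 1) = ∑ j, (f j + 1) - 2 := by
        have e : ∀ j, g j + 1 = (f j + 1) - (if j = i then 2 else 0) := by
          intro j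
          split_ifs with hj
          · subst hj; rw [gi]; ring
          · rw [gj j hj]; ring
        rw [Finset.sum_congr rfl fun j _ => e j, Finset.sum_sub_distrib]
        simp
      obtain ⟨u, hu⟩ := ih g hgp (by rw [hsum]; push_cast at hk; omega)
      refine ⟨u ++ [i], ?_⟩
      rw [run_snoc]
      refine ⟨g, hu, ⟨fun j hj => ?_, ?_⟩, ?_⟩
      · rw [gi, gj j hj.ne.symm, hnb j hj]; ring
      · rw [gi]; have := (hf.1 i).2; omega
      · ext j
        by_cases hj : j = i
        · subst hj; rw [fire_self, gi]; ring
        · rw [fire_ne _ _ _ hj, gj j hj]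

theorem exists_run_to_top (hn : 0 < n) (k : ℕ) (f : Fin n → ℤ) (hf : IsPath f)
    (hk : ∑ i, ((n : ℤ) + 1 - f i) ≤ k) : ∃ u, Run f u (lev (n + 1)) := by
  haveI : Nonempty (Fin n) := ⟨⟨0, hn⟩⟩
  induction k generalizing f with
  | zero =>
    refine ⟨[], ?_⟩
    have key : ∀ j, f j = n + 1 := by
      intro j
      have h0 : (n : ℤ) + 1 - f j ≤ ∑ i, ((n : ℤ) + 1 - f i) :=
        Finset.single_le_sum (f := fun i => (n : ℤ) + 1 - f i)
          (fun i _ => by have := (hf.1 i).2; omega) (Finset.mem_univ _)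
      have := (hf.1 j).2
      push_cast at hk
      omega
    ext j
    have := key j; have := hf.2.1 j
    unfold lev; split_ifs <;> omega
  | succ k ih =>
    obtain ⟨i, hi⟩ := Finite.exists_min f
    by_cases h : (n : ℤ) ≤ f i
    · refine ⟨[], ?_⟩
      ext j
      have := hi j; have := (hf.1 j).2; have := hf.2.1 j
      unfold lev; split_ifs <;> omega
    · have hc : CanFire f i := by
        refine ⟨fun j hj => ?_, by omega⟩
        have := hi j
        rcases hf.2.2 i j hj with h | h <;> omega
      have hsum : ∑ j, ((n : ℤ) + 1 - fire f i j) = ∑ j, ((n : ℤ) + 1 - f j) - 2 := by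
        have e : ∀ j, (n : ℤ) + 1 - fire f i j = ((n : ℤ) + 1 - f j) - (if j = i then 2 else 0) := by
          intro j
          split_ifs with hj
          · subst hj; rw [fire_self]; ring
          · rw [fire_ne _ _ _ hj]; ring
        rw [Finset.sum_congr rfl fun j _ => e j, Finset.sum_sub_distrib (fun j => (n : ℤ) + 1 - f j)]
        simp
      obtain ⟨u, hu⟩ := ih _ (isPath_fire f i hf hc) (by rw [hsum]; push_cast at hk; omega)
      exact ⟨i :: u, hc, hu⟩

/-- The letters of one parity. -/
def blk (n t : ℕ) : List (Fin n) := (List.finRange n).filter (fun i => i.val % 2 = t % 2)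

/-- The word obtained by concatenating `t` blocks of alternating parity. -/
def blocks (n : ℕ) : ℕ → List (Fin n)
  | 0 => []
  | t + 1 => blocks n t ++ blk n (t + 1)

theorem run_list (l : List (Fin n)) (hl : l.Nodup) (p : ℕ) (hp : ∀ i ∈ l, (i : ℕ) % 2 = p)
    (f : Fin n → ℤ) (hf : ∀ i ∈ l, CanFire f i) :
    Run f l (fun i => if i ∈ l then f i + 2 else f i) := by
  induction l generalizing f with
  | nil => simp [Run]
  | cons i l ih =>
    refine ⟨hf i (by simp), ?_⟩
    rw [List.nodup_cons] at hl
    have := ih hl.2 (fun j hj => hp j (by simp [hj])) (fire f i) (by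
      intro j hj
      rw [canFire_fire]
      · exact hf j (by simp [hj])
      · rintro rfl; exact hl.1 hj
      · intro h
        have h1 := hp i (by simp); have h2 := hp j (by simp [hj])
        unfold Nbr at h; omega)
    convert this using 1
    ext j
    by_cases hj : j = i
    · subst hj; simp [hl.1, fire_self]
    · simp [hj, fire_ne]

theorem run_blk (t : ℕ) (ht : t ≤ n) : Run (lev t) (blk n (t + 1)) (lev (t + 1)) := by
  have := run_list (blk n (t + 1)) ((List.nodup_finRange n).filter _) ((t + 1) % 2)
    (by intro i hi; simpa [blk] using hi) (lev t) (by
      intro i hi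
      have hi : (i : ℕ) % 2 = (t + 1) % 2 := by simpa [blk] using hi
      refine ⟨fun j hj => ?_, ?_⟩
      · unfold Nbr at hj; unfold lev; split_ifs <;> omega
      · unfold lev; split_ifs <;> omega)
  convert this using 1
  ext i
  simp only [blk, List.mem_filter, List.mem_finRange, true_and, decide_eq_true_eq]
  unfold lev
  split_ifs <;> omega

theorem run_blocks (t : ℕ) (ht : t ≤ n + 1) : Run (lev 0) (blocks n t) (lev t) := by
  induction t with
  | zero => simp [Run, blocks]
  | succ t ih =>
    simp only [blocks]
    rw [run_append]
    exact ⟨_, ih (by omega), by exact_mod_cast run_blk t (by omega)⟩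

theorem blocks_even (k : ℕ) : blocks n (2 * k) = (List.replicate k (altWord n)).flatten := by
  induction k with
  | zero => rfl
  | succ k ih =>
    rw [show 2 * (k + 1) = 2 * k + 1 + 1 by ring, List.replicate_succ', List.flatten_append, ← ih]
    simp only [blocks, List.flatten_singleton, List.append_assoc]
    congr 1
    unfold altWord blk
    rw [show (2 * k + 1) % 2 = 1 by omega, show (2 * k + 1 + 1) % 2 = 0 by omega]

theorem blocks_prefix (s t : ℕ) (h : s ≤ t) : blocks n s <+: blocks n t := by
  induction t, h using Nat.le_induction with
  | base => exact List.prefix_rfl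
  | succ t _ ih => exact ih.trans (List.prefix_append _ _)

/-! ### Wires -/

/-- The wire at position `j` after round `t`. -/
def wire (n : ℕ) (j t : ℤ) : ℤ :=
  if (j - t) % 2 = 0 then min (2 * n + 1 - j - t) (j + t) else max (j - t) (t - j - 1)

/-- Extension of a height function to the natural numbers. -/
def extd (f : Fin n → ℤ) (k : ℕ) : ℤ := if h : k < n then f ⟨k, h⟩ else 0

/-- The last round that was active at position `j`. -/
def tau (f : Fin n → ℤ) (j : ℕ) : ℤ := max 0 (max (extd f (j - 1)) (extd f (min j (n - 1))))

theorem extd_coe (f : Fin n → ℤ) (i : Fin n) : extd f i = f i := by simp [extd]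

theorem extd_lt (f : Fin n → ℤ) (k : ℕ) (h : k < n) : extd f k = f ⟨k, h⟩ := by simp [extd, h]

theorem extd_fire_ne (f : Fin n → ℤ) (i : Fin n) (k : ℕ) (h : k ≠ i) :
    extd (fire f i) k = extd f k := by
  unfold extd
  split_ifs with hk
  · rw [fire_ne]; rintro rfl; exact h rfl
  · rfl

theorem wire_before (hn : 0 < n) (f : Fin n → ℤ) (hf : IsPath f) (i : Fin n) (h : CanFire f i) :
    wire n i (tau f i) = max ((i : ℤ) - (f i + 1)) (f i + 1 - i - 1) ∧
    wire n ((i : ℤ) + 1) (tau f (i + 1)) = min (2 * n - i - (f i + 1)) (i + (f i + 1) + 1) := by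
  have hi := i.2
  have b1 := hf.1 i
  have b2 := hf.2.1 i
  have b3 := h.2
  have e1 : extd f (min i (n - 1)) = f i := by
    rw [min_eq_left (by omega), extd_coe]
  have e2 : extd f (i + 1 - 1) = f i := by
    rw [Nat.add_sub_cancel, extd_coe]
  constructor
  · unfold tau
    rw [e1]
    by_cases h0 : (i : ℕ) = 0
    · have e3 : extd f ((i : ℕ) - 1) = f i := by
        rw [h0]; rw [← extd_coe f i, h0]
      rw [e3]
      unfold wire
      split_ifs <;> omega
    · have e3 : extd f ((i : ℕ) - 1) = f i + 1 := by
        rw [extd_lt _ _ (by omega)]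
        apply h.1; unfold Nbr; simp; omega
      rw [e3]
      unfold wire
      split_ifs <;> omega
  · unfold tau
    rw [e2]
    by_cases h0 : (i : ℕ) + 1 = n
    · have e3 : extd f (min ((i : ℕ) + 1) (n - 1)) = f i := by
        rw [min_eq_right (by omega), ← extd_coe f i]; congr 1; omega
      rw [e3]
      unfold wire
      split_ifs <;> omega
    · have e3 : extd f (min ((i : ℕ) + 1) (n - 1)) = f i + 1 := by
        rw [min_eq_left (by omega), extd_lt _ _ (by omega)]
        apply h.1; unfold Nbr; simp
      rw [e3]
      unfold wire
      split_ifs <;> omega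

theorem wire_after (f : Fin n → ℤ) (hf : IsPath f) (i : Fin n) (h : CanFire f i) :
    wire n ((i : ℤ) + 1) (tau (fire f i) (i + 1)) = max ((i : ℤ) - (f i + 1)) (f i + 1 - i - 1) ∧
    wire n i (tau (fire f i) i) = min (2 * n - i - (f i + 1)) (i + (f i + 1) + 1) := by
  have hi := i.2
  have b1 := hf.1 i
  have b2 := hf.2.1 i
  have b3 := h.2
  have e1 : extd (fire f i) (min i (n - 1)) = f i + 2 := by
    rw [min_eq_left (by omega), extd_coe, fire_self]
  have e2 : extd (fire f i) (i + 1 - 1) = f i + 2 := by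
    rw [Nat.add_sub_cancel, extd_coe, fire_self]
  constructor
  · unfold tau
    rw [e2]
    have e3 : extd (fire f i) (min ((i : ℕ) + 1) (n - 1)) ≤ f i + 2 := by
      by_cases h0 : (i : ℕ) + 1 = n
      · rw [← fire_self f i, ← extd_coe (fire f i) i]; apply le_of_eq; congr 1; omega
      · rw [min_eq_left (by omega), extd_fire_ne _ _ _ (by omega), extd_lt _ _ (by omega),
          h.1 _ (by unfold Nbr; simp)]; omega
    rw [max_eq_left e3]
    unfold wire
    split_ifs <;> omega
  · unfold tau
    rw [e1]
    have e3 : extd (fire f i) ((i : ℕ) - 1) ≤ f i + 2 := by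
      by_cases h0 : (i : ℕ) = 0
      · rw [← fire_self f i, ← extd_coe (fire f i) i]; apply le_of_eq; congr 1; omega
      · rw [extd_fire_ne _ _ _ (by omega), extd_lt _ _ (by omega),
          h.1 _ (by unfold Nbr; simp; omega)]; omega
    rw [max_eq_right e3]
    unfold wire
    split_ifs <;> omega

theorem tau_fire_ne (f : Fin n → ℤ) (i : Fin n) (j : ℕ) (hj : j ≤ n) (h1 : j ≠ i)
    (h2 : j ≠ i + 1) : tau (fire f i) j = tau f j := by
  have := i.2
  unfold tau
  rw [extd_fire_ne _ _ _ (by omega), extd_fire_ne _ _ _ (by omega)]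

theorem wire_bot (j : ℕ) (hj : j ≤ n) : wire n j (tau (lev 0 : Fin n → ℤ) j) = j := by
  have key : ∀ k, extd (lev 0 : Fin n → ℤ) k ≤ 0 := by
    intro k; unfold extd lev; split_ifs <;> omega
  have : tau (lev 0 : Fin n → ℤ) j = 0 := by
    have := key (j - 1); have := key (min j (n - 1))
    unfold tau; omega
  rw [this]; unfold wire; split_ifs <;> omega

theorem wire_top (hn : 0 < n) (j : ℕ) (hj : j ≤ n) :
    wire n j (tau (lev (n + 1) : Fin n → ℤ) j) = n - j := by
  unfold tau
  rw [extd_lt _ (j - 1) (by omega), extd_lt _ (min j (n - 1)) (by omega)]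
  unfold lev wire
  simp only []
  rcases Nat.eq_zero_or_pos j with rfl | h
  · simp; split_ifs <;> omega
  · split_ifs <;> omega

theorem wire_ne (n : ℕ) (j a : ℤ) (h1 : 1 ≤ j) (h2 : j + 1 ≤ n) (h3 : 0 ≤ a) (h4 : a ≤ n)
    (h5 : (a + 1) % 2 = j % 2) : wire n j (a + 1) ≠ wire n j (max 0 a) := by
  rw [max_eq_right h3]
  unfold wire
  rw [if_pos (by omega), if_neg (by omega)]
  omega

theorem path_unique (hn : 0 < n) (f g : Fin n → ℤ) (hf : IsPath f) (hg : IsPath g)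
    (h : ∀ j : ℕ, j ≤ n → wire n j (tau f j) = wire n j (tau g j)) : f = g := by
  have key : ∀ k, k < n → extd f k = extd g k := by
    intro k
    induction k with
    | zero =>
      intro hk
      have h0 := h 0 (by omega)
      unfold tau at h0
      simp only [Nat.zero_sub, Nat.zero_min] at h0
      rw [extd_lt f _ hk, extd_lt g _ hk] at *
      have := hf.1 ⟨0, hk⟩; have := hg.1 ⟨0, hk⟩
      have := hf.2.1 ⟨0, hk⟩; have := hg.2.1 ⟨0, hk⟩
      simp only [max_self] at h0
      unfold wire at h0
      split_ifs at h0 <;> simp at * <;> omega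
    | succ k ih =>
      intro hk
      have hk2 : k < n := by omega
      have ih := ih hk2
      have h0 := h (k + 1) (by omega)
      unfold tau at h0
      rw [min_eq_left (by omega), Nat.add_sub_cancel, ih] at h0
      rw [extd_lt f _ hk, extd_lt g _ hk] at *
      rw [extd_lt f _ (by omega), extd_lt g _ (by omega)] at ih
      rw [extd_lt g _ (by omega)] at h0
      have a1 := hf.2.2 ⟨k, hk2⟩ ⟨k + 1, hk⟩ (by unfold Nbr; simp)
      have a2 := hg.2.2 ⟨k, hk2⟩ ⟨k + 1, hk⟩ (by unfold Nbr; simp)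
      have a3 := hf.1 ⟨k + 1, hk⟩; have a4 := hg.1 ⟨k + 1, hk⟩
      have a5 := hg.2.1 ⟨k, hk2⟩
      simp only [] at a5
      have a6 := hg.1 ⟨k, hk2⟩
      have a7 := hf.1 ⟨k, hk2⟩
      generalize f ⟨k + 1, hk⟩ = x at *
      generalize g ⟨k + 1, hk⟩ = y at *
      rw [ih] at a1 a7
      clear ih
      generalize g ⟨k, hk2⟩ = a at *
      push_cast at h0
      rcases a1 with a1 | a1 <;> rcases a2 with a2 | a2
      · rw [a1, a2]
      · exfalso
        apply wire_ne n (k + 1) a (by omega) (by omega) (by omega) (by omega) (by omega)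
        convert h0 using 2 <;> omega
      · exfalso
        apply wire_ne n (k + 1) a (by omega) (by omega) (by omega) (by omega) (by omega)
        convert h0.symm using 2 <;> omega
      · rw [a1, a2]
  ext i
  rw [← extd_coe f, ← extd_coe g]; exact key i i.2

end heap

/-! ### The main bijection -/

section main
variable {n : ℕ} {W : Type*} [Group W] (cs : CoxeterSystem (CoxeterMatrix.A n) W)

theorem invs_one : (invs (1 : Equiv.Perm (Fin (n + 1)))).card = 0 := by
  rw [Finset.card_eq_zero, Finset.eq_empty_iff_forall_notMem]
  rintro ⟨a, b⟩ h
  rw [mem_invs] at h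
  exact absurd h.1 (not_lt.2 h.2.le)

theorem run_inv (hn : 0 < n) (u : List (Fin n)) (f : Fin n → ℤ) (h : Run (lev 0) u f) :
    (∀ j : Fin (n + 1), ((phi cs (cs.wordProd u) j : ℕ) : ℤ) = wire n (j : ℕ) (tau f j)) ∧
      (invs (phi cs (cs.wordProd u))).card = u.length := by
  induction u using List.reverseRecOn generalizing f with
  | nil =>
    simp only [Run] at h
    subst h
    refine ⟨fun j => ?_, ?_⟩
    · rw [wire_bot _ (by omega)]; simp
    · simp [invs_one]
  | append_singleton u i ih =>
    rw [run_snoc] at h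
    obtain ⟨g, hg, hc, rfl⟩ := h
    obtain ⟨ih1, ih2⟩ := ih g hg
    have hp : IsPath g := isPath_run u _ _ (isPath_lev 0 le_rfl (by omega)) hg
    obtain ⟨b1, b2⟩ := wire_before hn g hp i hc
    obtain ⟨c1, c2⟩ := wire_after g hp i hc
    have hi := i.2
    have d1 := ih1 i.castSucc
    have d2 := ih1 i.succ
    simp only [Fin.val_castSucc, Fin.val_succ, Nat.cast_add, Nat.cast_one] at d1 d2
    rw [b1] at d1
    rw [b2] at d2
    have e : phi cs (cs.wordProd (u ++ [i])) = phi cs (cs.wordProd u) * adjSwap i := by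
      rw [cs.wordProd_append, map_mul, cs.wordProd_singleton, phi_simple]
    rw [e]
    refine ⟨fun j => ?_, ?_⟩
    · rw [Equiv.Perm.mul_apply]
      by_cases h1 : j = i.castSucc
      · subst h1
        rw [adjSwap, Equiv.swap_apply_left, d2, Fin.val_castSucc, c2]
      · by_cases h2 : j = i.succ
        · subst h2
          rw [adjSwap, Equiv.swap_apply_right, d1, Fin.val_succ]
          push_cast
          rw [c1]
        · rw [adjSwap, Equiv.swap_apply_of_ne_of_ne h1 h2, ih1 j, tau_fire_ne _ _ _ (by omega)]
          · intro h; exact h1 (Fin.ext h)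
          · intro h; exact h2 (Fin.ext h)
    · rw [invs_mul_up, ih2]
      · simp
      · rw [Fin.lt_def]
        have := (hp.1 i).1
        have := hc.2
        have := hp.2.1 i
        omega

theorem run_reduced (hn : 0 < n) (u : List (Fin n)) (f : Fin n → ℤ) (h : Run (lev 0) u f) :
    cs.length (cs.wordProd u) = u.length := by
  apply le_antisymm (cs.length_wordProd_le u)
  rw [← (run_inv cs hn u f h).2]
  exact invs_le_length cs _

theorem commEquiv_prod (u v : List (Fin n)) (h : CommEquiv (CoxeterMatrix.A n) u v) :
    cs.wordProd u = cs.wordProd v := by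
  induction h with
  | refl => rfl
  | tail _ h2 ih =>
    rw [ih]
    obtain ⟨a, b, i, j, hij, rfl, rfl⟩ := h2
    simp only [cs.wordProd_append, cs.wordProd_cons]
    rw [← mul_assoc (cs.simple i), simple_comm cs i j hij, mul_assoc]

theorem length_blocks (hn : 0 < n) :
    (blocks n (n + 1)).length = ∑ k ∈ Finset.range (n + 1), k := by
  have h := run_blocks (n := n) (n + 1) le_rfl
  let cs := (CoxeterMatrix.A n).toCoxeterSystem
  obtain ⟨h1, h2⟩ := run_inv cs hn _ _ h
  rw [← h2]
  apply invs_rev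
  intro a b hab
  have ha := h1 a
  have hb := h1 b
  push_cast at ha hb
  rw [wire_top hn _ (by omega)] at ha hb
  rw [Fin.lt_def] at hab ⊢
  omega

theorem longest_eq (hn : 0 < n) (w₀ : W) (hw₀ : ∀ v : W, cs.length v ≤ cs.length w₀) :
    w₀ = cs.wordProd (blocks n (n + 1)) := by
  have h := run_reduced cs hn _ _ (run_blocks (n := n) (n + 1) le_rfl)
  rw [length_blocks hn] at h
  refine eq_of_length cs _ _ ?_ h.ge
  rw [← h]; exact hw₀ _

theorem sortAux_one (cw : List (Fin n)) (fuel : ℕ) (rest : List (Fin n)) :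
    sortAux cs cw fuel rest 1 = [] := by
  induction fuel generalizing rest with
  | zero => cases rest <;> rfl
  | succ k ih =>
    cases rest with
    | nil => simp [sortAux, ih]
    | cons s rest => simp [sortAux, ih]

theorem sortAux_prefix (cw : List (Fin n)) (fuel : ℕ) (rest q : List (Fin n)) (k : ℕ)
    (hq : cs.IsReduced q) (hp : q <+: rest ++ (List.replicate k cw).flatten)
    (hf : rest.length + k * (cw.length + 1) ≤ fuel) :
    sortAux cs cw fuel rest (cs.wordProd q) = q := by
  induction fuel generalizing rest q k with
  | zero =>
    have h1 : rest = [] := List.length_eq_zero_iff.1 (by omega)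
    have h2 : k = 0 := by
      rcases k with _ | k
      · rfl
      · rw [Nat.succ_mul] at hf; omega
    subst h1; subst h2
    have : q = [] := by simpa using hp
    subst this; rfl
  | succ m ih =>
    rcases q with _ | ⟨s, q⟩
    · rw [cs.wordProd_nil, sortAux_one]
    rcases rest with _ | ⟨t, rest⟩
    · rw [sortAux]
      rcases k with _ | k
      · simp at hp
      · refine ih cw (s :: q) k hq ?_ ?_
        · simpa [List.replicate_succ] using hp
        · rw [Nat.succ_mul] at hf; simp at hf; omega
    · rw [List.cons_append, List.cons_prefix_cons] at hp
      obtain ⟨rfl, hp⟩ := hp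
      have hq2 : cs.IsReduced q := by
        have := hq.drop 1
        simpa using this
      have e : cs.simple s * cs.wordProd (s :: q) = cs.wordProd q := by
        rw [cs.wordProd_cons, ← mul_assoc, cs.simple_mul_simple_self, one_mul]
      rw [sortAux, e, if_pos, ih rest q k hq2 hp]
      · simp at hf; omega
      · unfold CoxeterSystem.IsReduced at hq hq2
        rw [hq, hq2]; simp

theorem sorting_eq (hn : 0 < n) (w₀ : W) (hw₀ : ∀ v : W, cs.length v ≤ cs.length w₀) :
    sortingWord cs (altWord n) w₀ = blocks n (n + 1) := by
  have hw := longest_eq cs hn w₀ hw₀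
  have hr := run_reduced cs hn _ _ (run_blocks (n := n) (n + 1) le_rfl)
  unfold sortingWord
  subst hw
  refine sortAux_prefix cs _ _ _ _ n hr ?_ ?_
  · have := blocks_prefix (n := n) (n + 1) (2 * (n + 1)) (by omega)
    rw [blocks_even, List.replicate_succ, List.flatten_cons] at this
    exact this
  · rw [hr, length_blocks hn, Finset.sum_range_succ]
    nlinarith [Nat.zero_le (∑ k ∈ Finset.range n, k), Nat.zero_le ((∑ k ∈ Finset.range n, k) * ((altWord n).length + 1))]

theorem run_of_isPath (hn : 0 < n) (f : Fin n → ℤ) (hf : IsPath f) : ∃ u, Run (lev 0) u f :=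
  exists_run_from_bot hn (∑ i, (f i + 1)).toNat f hf (Int.self_le_toNat _)

theorem card_singletons (hn : 0 < n) (w₀ : W) (hw₀ : ∀ v : W, cs.length v ≤ cs.length w₀) :
    numSingletons cs (altWord n) w₀ = Nat.card {f : Fin n → ℤ // IsPath f} := by
  choose! U hU using run_of_isPath (n := n) hn
  unfold numSingletons
  symm
  have hQ := run_blocks (n := n) (n + 1) le_rfl
  have hS : ∀ f, IsPath f → IsCSingleton cs (altWord n) w₀ (cs.wordProd (U f)) := by
    intro f hf
    refine ⟨U f, rfl, run_reduced cs hn _ _ (hU f hf), ?_⟩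
    rw [sorting_eq cs hn w₀ hw₀]
    obtain ⟨v, hv⟩ := exists_run_to_top hn (∑ i, ((n : ℤ) + 1 - f i)).toNat f hf
      (Int.self_le_toNat _)
    refine ⟨U f ++ v, run_unique _ _ (lev 0) (lev (n + 1)) (by exact_mod_cast hQ) ?_,
      List.prefix_append _ _⟩
    rw [run_append]
    exact ⟨f, hU f hf, hv⟩
  refine Nat.card_congr (Equiv.ofBijective
    (fun f => (⟨cs.wordProd (U f.1), hS f.1 f.2⟩ : {w : W // IsCSingleton cs (altWord n) w₀ w}))
    ⟨?_, ?_⟩)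
  · rintro ⟨f, hf⟩ ⟨g, hg⟩ h
    simp only [Subtype.mk.injEq] at h ⊢
    refine path_unique hn f g hf hg fun j hj => ?_
    have h1 := (run_inv cs hn _ _ (hU f hf)).1 ⟨j, by omega⟩
    have h2 := (run_inv cs hn _ _ (hU g hg)).1 ⟨j, by omega⟩
    rw [h] at h1
    exact h1.symm.trans h2
  · rintro ⟨w, u, rfl, -, v, hv, hp⟩
    rw [sorting_eq cs hn w₀ hw₀] at hv
    have hr := run_commEquiv _ _ _ _ hv hQ
    obtain ⟨x, rfl⟩ := hp
    rw [run_append] at hr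
    obtain ⟨f, hf, -⟩ := hr
    have hp : IsPath f := isPath_run u _ _ (isPath_lev 0 le_rfl (by omega)) hf
    refine ⟨⟨f, hp⟩, ?_⟩
    exact Subtype.ext (commEquiv_prod cs _ _ (run_unique _ _ _ _ (hU f hp) hf))

theorem isPath_iff_walk (N : ℕ) (f : Fin (N + 1) → ℤ) :
    f ∈ (Finset.range ((N + 1 + 1) / 2 + 1)).biUnion
      (fun k : ℕ => walks ((N + 1 : ℕ) : ℤ) N (2 * (k : ℤ))) ↔ IsPath f := by
  rw [Finset.mem_biUnion]
  constructor
  · rintro ⟨k, -, hf⟩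
    rw [mem_walks] at hf
    obtain ⟨h1, h2, h3⟩ := hf
    have hstep : ∀ i j : Fin (N + 1), (i : ℕ) + 1 = j → f j = f i + 1 ∨ f j = f i - 1 := by
      intro i j hij
      have hi : (i : ℕ) < N := by omega
      have e1 : i = Fin.castSucc ⟨i, hi⟩ := rfl
      have e2 : j = Fin.succ ⟨i, hi⟩ := Fin.ext hij.symm
      rw [e2]
      exact h3 ⟨i, hi⟩
    refine ⟨h2, fun i => ?_, fun i j hij => ?_⟩
    · induction i using Fin.induction with
      | zero => rw [h1]; simp
      | succ i ih =>
        have := h3 i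
        simp only [Fin.val_castSucc, Fin.val_succ] at ih ⊢
        push_cast
        omega
    · rcases hij with h | h
      · have := hstep j i h
        omega
      · exact hstep i j h
  · rintro ⟨h1, h2, h3⟩
    have a1 := h1 0
    have a2 := h2 0
    simp only [Fin.val_zero, Nat.cast_zero] at a2
    refine ⟨(f 0 / 2).toNat, ?_, ?_⟩
    · rw [Finset.mem_range]; push_cast at a1; omega
    · rw [mem_walks]
      refine ⟨by omega, h1, fun i => ?_⟩
      exact h3 i.castSucc i.succ (by unfold Nbr; simp)

theorem card_paths (hn : 1 ≤ n) : (Nat.card {f : Fin n → ℤ // IsPath f} : ℚ) = fb (n + 1) := by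
  rw [← total_walks n hn]
  obtain ⟨N, rfl⟩ : ∃ N, n = N + 1 := ⟨n - 1, by omega⟩
  congr 1
  rw [Nat.subtype_card]
  intro f
  exact isPath_iff_walk N f

end main
/-- For the alternating (bipartite) Coxeter element `c_alt` of `Σ_{n+1}` (type `A_n`), the
number of `c`-singletons equals Fishburn's number `fb(n+1)`, i.e. with `m = n+1` it equals
`2^{m−3}(m+3) − ((m−1)/2)·C(m−1,(m−1)/2)` for odd `m` and
`2^{m−3}(m+3) − ((2m−3)/2)·C(m−2,(m−2)/2)` for even `m`. -/
theorem numSingletons_alternating (n : ℕ) (hn : 2 ≤ n) {W : Type*} [Group W]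
    (cs : CoxeterSystem (CoxeterMatrix.Aₙ n) W)
    (w₀ : W) (hw₀ : ∀ v : W, cs.length v ≤ cs.length w₀) :
    (numSingletons cs (altWord n) w₀ : ℚ) = fb (n + 1) := by
  rw [← card_paths (n := n) (by omega)]
  exact congrArg _ (card_singletons (n := n) cs (by omega) w₀ hw₀)

end Cambrian
end

section
/- Let (W,S) be a path-like irreducible finite Coxeter system of rank n > 1 with Coxeter number h, and let c be a Coxeter element whose oriented Coxeter graph is a directed path (exactly one source and one sink, the minimum). Then the number of c-singletons is S_c = 2^{n−2}(h − n + 3). -/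
open CoxeterSystem

namespace Cambrian

variable {B : Type*} {W : Type*} [Group W]

/-- A word representing a Coxeter element: each generator occurs exactly once. -/
def IsCoxWord (cw : List B) : Prop := cw.Nodup ∧ ∀ b : B, b ∈ cw

variable {M : CoxeterMatrix B}

/-! ### Part 1 : the geometric representation -/

section Geom

set_option linter.unusedSectionVars false

open Real

variable {B : Type*} {W : Type*} [Group W] [Fintype B] [DecidableEq B]

/-- Entries of (twice) the Coxeter bilinear form. -/
noncomputable def kk (M : CoxeterMatrix B) (b b' : B) : ℝ := -2 * cos (π / M b b')

/-- simple root -/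
noncomputable def sr (b : B) : B → ℝ := Pi.single b 1

/-- linear functional of the simple root -/
noncomputable def ff (M : CoxeterMatrix B) (b : B) : (B → ℝ) →ₗ[ℝ] ℝ :=
  ∑ b', kk M b b' • LinearMap.proj b'

/-- simple reflection -/
noncomputable def rf (M : CoxeterMatrix B) (b : B) : Module.End ℝ (B → ℝ) :=
  LinearMap.id - (ff M b).smulRight (sr b)

lemma ff_sr (M : CoxeterMatrix B) (b b' : B) : ff M b (sr b') = kk M b b' := by
  simp [ff, sr, Pi.single_apply]

lemma rf_apply (M : CoxeterMatrix B) (b : B) (v : B → ℝ) :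
    rf M b v = v - ff M b v • sr b := by
  simp [rf]

lemma kk_self (M : CoxeterMatrix B) (b : B) : kk M b b = 2 := by
  simp [kk]

lemma kk_symm (M : CoxeterMatrix B) (b b' : B) : kk M b b' = kk M b' b := by
  simp [kk, M.symmetric b b']

lemma rf_sr_self (M : CoxeterMatrix B) (b : B) : rf M b (sr b) = - sr b := by
  rw [rf_apply, ff_sr, kk_self]; module

lemma rf_sr (M : CoxeterMatrix B) (b b' : B) : rf M b (sr b') = sr b' - kk M b b' • sr b := by
  rw [rf_apply, ff_sr]

lemma rf_rf (M : CoxeterMatrix B) (b : B) : rf M b * rf M b = 1 := by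
  ext1 v
  ext1
  simp only [LinearMap.comp_apply, Module.End.mul_apply, rf_apply, map_sub, map_smul, ff_sr,
    kk_self, Module.End.one_apply]
  module

lemma rf_fix (M : CoxeterMatrix B) (b : B) (v : B → ℝ) (h : ff M b v = 0) : rf M b v = v := by
  rw [rf_apply, h]; simp

lemma rot_pow (M : CoxeterMatrix B) (i j : B) (k : ℕ) :
    sin (π / M i j) • ((rf M i * rf M j) ^ k) (sr i) =
      sin ((2 * k + 1) * (π / M i j)) • sr i + sin (2 * k * (π / M i j)) • sr j ∧
    sin (π / M i j) • ((rf M i * rf M j) ^ k) (sr j) =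
      -sin (2 * k * (π / M i j)) • sr i - sin ((2 * k - 1) * (π / M i j)) • sr j := by
  have hk : kk M j i = -2 * cos (π / M i j) := by rw [kk_symm]; rfl
  have hk' : kk M i j = -2 * cos (π / M i j) := rfl
  set θ := π / M i j with hθ
  have h1 : (rf M i * rf M j) (sr i) = (4 * cos θ ^ 2 - 1) • sr i + (2 * cos θ) • sr j := by
    rw [Module.End.mul_apply, rf_sr, map_sub, map_smul, rf_sr, rf_sr, kk_self, hk, hk']
    module
  have h2 : (rf M i * rf M j) (sr j) = (-2 * cos θ) • sr i - (1:ℝ) • sr j := by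
    rw [Module.End.mul_apply, rf_sr_self, map_neg, rf_sr, hk']
    module
  induction k with
  | zero => constructor <;> simp
  | succ k ih =>
    obtain ⟨ih1, ih2⟩ := ih
    have e1 : sin ((2 * (k:ℝ) + 1) * θ) = sin (2 * k * θ) * cos θ + cos (2 * k * θ) * sin θ := by
      rw [← sin_add]; ring_nf
    have e2 : sin ((2 * (k:ℝ) - 1) * θ) = sin (2 * k * θ) * cos θ - cos (2 * k * θ) * sin θ := by
      rw [← sin_sub]; ring_nf
    have c2 : cos (2 * θ) = 2 * cos θ ^ 2 - 1 := cos_two_mul θ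
    have s2 : sin (2 * θ) = 2 * sin θ * cos θ := sin_two_mul θ
    have e3 : sin (2 * ((k:ℝ) + 1) * θ) = sin (2 * k * θ) * cos (2 * θ) + cos (2 * k * θ) * sin (2 * θ) := by
      rw [← sin_add]; ring_nf
    have e5 : cos (2 * ((k:ℝ) + 1) * θ) = cos (2 * k * θ) * cos (2 * θ) - sin (2 * k * θ) * sin (2 * θ) := by
      rw [← cos_add]; ring_nf
    have e4 : sin ((2 * ((k:ℝ) + 1) + 1) * θ) = sin (2 * (k + 1) * θ) * cos θ + cos (2 * (k + 1) * θ) * sin θ := by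
      rw [← sin_add]; ring_nf
    have e6 : sin ((2 * ((k:ℝ) + 1) - 1) * θ) = sin (2 * (k + 1) * θ) * cos θ - cos (2 * (k + 1) * θ) * sin θ := by
      rw [← sin_sub]; ring_nf
    have hs : sin θ ^ 2 = 1 - cos θ ^ 2 := by rw [sin_sq]
    rw [e1] at ih1
    rw [e2] at ih2
    constructor
    · rw [pow_succ', Module.End.mul_apply, ← map_smul, ih1, map_add, map_smul, map_smul, h1, h2]
      push_cast
      rw [e4, e3, e5, c2, s2]
      match_scalars
      · linear_combination (2 * sin (2 * k * θ) * cos θ) * hs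
      · ring
    · rw [pow_succ', Module.End.mul_apply, ← map_smul, ih2, map_sub, map_smul, map_smul, h1, h2]
      push_cast
      rw [e6, e3, e5, c2, s2]
      match_scalars
      · ring
      · linear_combination (2 * sin (2 * k * θ) * cos θ) * hs

lemma two_le_M (M : CoxeterMatrix B) {i j : B} (hij : i ≠ j) (h0 : M i j ≠ 0) : 2 ≤ M i j := by
  have := M.off_diagonal i j hij
  omega

lemma sin_pos_M (M : CoxeterMatrix B) {i j : B} (hij : i ≠ j) (h0 : M i j ≠ 0) :
    0 < sin (π / M i j) := by
  have h2 : (2:ℝ) ≤ M i j := by exact_mod_cast two_le_M M hij h0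
  apply sin_pos_of_pos_of_lt_pi
  · positivity
  · rw [div_lt_iff₀ (by linarith)]
    nlinarith [pi_pos]

lemma rf_liftable (M : CoxeterMatrix B) : M.IsLiftable (rf M) := by
  intro i j
  by_cases hij : i = j
  · subst hij
    rw [rf_rf]; simp
  by_cases h0 : M i j = 0
  · simp [h0]
  have hs := sin_pos_M M hij h0
  have hm : (M i j : ℝ) ≠ 0 := by exact_mod_cast h0
  obtain ⟨p1, p2⟩ := rot_pow M i j (M i j)
  have hk : kk M j i = -2 * cos (π / M i j) := by rw [kk_symm]; rfl
  have hk' : kk M i j = -2 * cos (π / M i j) := rfl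
  set T := (rf M i * rf M j) ^ (M i j)
  set θ := π / M i j with hθ
  have hmθ : 2 * (M i j : ℝ) * θ = 2 * π := by rw [hθ]; field_simp
  have q1 : T (sr i) = sr i := by
    rw [add_mul, hmθ, one_mul, sin_two_pi, add_comm (2 * π) θ, sin_add_two_pi] at p1
    have := smul_right_injective (B → ℝ) hs.ne' (a₁ := T (sr i)) (a₂ := sr i) (by simpa using p1)
    exact this
  have q2 : T (sr j) = sr j := by
    rw [sub_mul, hmθ, one_mul, sin_two_pi, sin_two_pi_sub] at p2
    have := smul_right_injective (B → ℝ) hs.ne' (a₁ := T (sr j)) (a₂ := sr j) (by simpa using p2)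
    exact this
  have fixT : ∀ z, ff M i z = 0 → ff M j z = 0 → ∀ k : ℕ, ((rf M i * rf M j) ^ k) z = z := by
    intro z hi hj k
    induction k with
    | zero => simp
    | succ k ih =>
      rw [pow_succ', Module.End.mul_apply, ih, Module.End.mul_apply, rf_fix M j z hj,
        rf_fix M i z hi]
  have hs2 : 4 * sin θ ^ 2 ≠ 0 := by positivity
  apply LinearMap.ext
  intro z
  let x := (2 * ff M i z + 2 * cos θ * ff M j z) / (4 * sin θ ^ 2)
  let y := (2 * ff M j z + 2 * cos θ * ff M i z) / (4 * sin θ ^ 2)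
  have hsc := sin_sq θ
  have a1 : ff M i (z - (x • sr i + y • sr j)) = 0 := by
    simp only [map_sub, map_add, map_smul, ff_sr, kk_self, hk', smul_eq_mul, x, y]
    field_simp
    rw [hsc]; ring
  have a2 : ff M j (z - (x • sr i + y • sr j)) = 0 := by
    simp only [map_sub, map_add, map_smul, ff_sr, kk_self, hk, smul_eq_mul, x, y]
    field_simp
    rw [hsc]; ring
  have hz : z = (z - (x • sr i + y • sr j)) + (x • sr i + y • sr j) := by simp
  rw [hz, map_add, fixT _ a1 a2, map_add, map_smul, map_smul, q1, q2]
  rfl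

variable {M : CoxeterMatrix B}

/-- the geometric representation -/
noncomputable def geo (cs : CoxeterSystem M W) : W →* Module.End ℝ (B → ℝ) :=
  cs.lift ⟨rf M, rf_liftable M⟩

@[simp] lemma geo_simple (cs : CoxeterSystem M W) (b : B) : geo cs (cs.simple b) = rf M b :=
  cs.lift_apply_simple (rf_liftable M) b

lemma geo_inj_apply (cs : CoxeterSystem M W) (w : W) {u v : B → ℝ} (h : geo cs w u = geo cs w v) :
    u = v := by
  have := congrArg (geo cs w⁻¹) h
  rwa [← Module.End.mul_apply, ← Module.End.mul_apply, ← map_mul, inv_mul_cancel, map_one] at this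

lemma sr_ne_zero (b : B) : sr b ≠ 0 := by
  simp [sr]

lemma M_ne_zero [Finite W] (cs : CoxeterSystem M W) (i j : B) : M i j ≠ 0 := by
  intro h0
  have hij : i ≠ j := by
    rintro rfl
    simp at h0
  have key : ∀ k : ℕ, geo cs ((cs.simple i * cs.simple j) ^ k) (sr i) =
      (2 * k + 1 : ℝ) • sr i + (2 * k : ℝ) • sr j := by
    have hk : kk M j i = -2 := by rw [kk_symm]; simp [kk, h0]
    have hk' : kk M i j = -2 := by simp [kk, h0]
    intro k
    induction k with
    | zero => simp
    | succ k ih =>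
      rw [pow_succ', map_mul, Module.End.mul_apply, ih, map_mul, geo_simple, geo_simple,
        Module.End.mul_apply]
      simp only [map_add, map_sub, map_smul, rf_sr, kk_self, hk, hk']
      push_cast
      module
  obtain ⟨m, hm, hm1⟩ := isOfFinOrder_iff_pow_eq_one.1 (isOfFinOrder_of_finite (cs.simple i * cs.simple j))
  have := key m
  rw [hm1, map_one, Module.End.one_apply] at this
  have := congrFun this j
  simp [sr, Pi.single_apply, hij.symm] at this
  omega

lemma alt_apply (cs : CoxeterSystem M W) (s t : B) (k : ℕ) :
    sin (π / M s t) • geo cs (cs.wordProd (alternatingWord s t k)) (sr s) =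
      if Even k then sin ((k + 1) * (π / M s t)) • sr s + sin (k * (π / M s t)) • sr t
      else sin (k * (π / M s t)) • sr s + sin ((k + 1) * (π / M s t)) • sr t := by
  have hk : kk M t s = -2 * cos (π / M s t) := by rw [kk_symm]; rfl
  have hk' : kk M s t = -2 * cos (π / M s t) := rfl
  set θ := π / M s t with hθ
  induction k with
  | zero => simp [alternatingWord]
  | succ k ih =>
    have e : sin (((k:ℝ) + 1 + 1) * θ) = 2 * cos θ * sin ((k + 1) * θ) - sin (k * θ) := by
      have a : sin (((k:ℝ) + 1 + 1) * θ) = sin ((k + 1) * θ) * cos θ + cos ((k + 1) * θ) * sin θ := by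
        rw [← sin_add]; ring_nf
      have b : sin ((k:ℝ) * θ) = sin ((k + 1) * θ) * cos θ - cos ((k + 1) * θ) * sin θ := by
        rw [← sin_sub]; ring_nf
      rw [a, b]; ring
    rw [alternatingWord_succ', wordProd_cons, map_mul, Module.End.mul_apply, ← map_smul, ih,
      geo_simple]
    by_cases h : Even k
    · have h' : ¬ Even (k + 1) := by simpa [parity_simps] using h
      simp only [h, h', if_true, if_false, map_add, map_smul, rf_sr, hk, kk_self]
      push_cast
      rw [e]
      module
    · have h' : Even (k + 1) := by simpa [parity_simps] using h
      simp only [h, h', if_true, if_false, map_add, map_smul, rf_sr, hk', kk_self]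
      push_cast
      rw [e]
      module

lemma strip (cs : CoxeterSystem M W) (N : ℕ) : ∀ (s t : B) (w : W), cs.length w ≤ N →
    ¬ cs.IsRightDescent w s → ∃ (k : ℕ) (v : W), w = v * cs.wordProd (alternatingWord s t k) ∧
      cs.length w = cs.length v + k ∧ ¬ cs.IsRightDescent v s ∧ ¬ cs.IsRightDescent v t := by
  induction N with
  | zero =>
    intro s t w hw hs
    refine ⟨0, w, by simp [alternatingWord], by simp, hs, ?_⟩
    have : w = 1 := by rw [← cs.length_eq_zero_iff]; omega
    subst this
    exact cs.not_isRightDescent_one t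
  | succ N ih =>
    intro s t w hw hs
    by_cases ht : cs.IsRightDescent w t
    · have hl := (cs.isRightDescent_iff).1 ht
      obtain ⟨k, v, h1, h2, h3, h4⟩ := ih t s (w * cs.simple t) (by omega)
        ((cs.isRightDescent_iff_not_isRightDescent_mul).1 ht)
      refine ⟨k + 1, v, ?_, by omega, h4, h3⟩
      rw [alternatingWord_succ, wordProd_concat, ← mul_assoc, ← h1]
      simp
    · exact ⟨0, w, by simp [alternatingWord], by simp, hs, ht⟩

theorem root_pos (cs : CoxeterSystem M W) (hM : ∀ i j, M i j ≠ 0) :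
    ∀ (N : ℕ) (w : W) (s : B), cs.length w ≤ N → ¬ cs.IsRightDescent w s →
      0 ≤ geo cs w (sr s) := by
  have base : ∀ s : B, (0 : B → ℝ) ≤ sr s := by
    intro s
    simp [sr]
  intro N
  induction N with
  | zero =>
    intro w s hw hs
    have : w = 1 := by rw [← cs.length_eq_zero_iff]; omega
    subst this
    simpa using base s
  | succ N ih =>
    intro w s hw hs
    by_cases h1 : w = 1
    · subst h1
      simpa using base s
    obtain ⟨t, ht⟩ := cs.exists_rightDescent_of_ne_one h1
    have hst : s ≠ t := by rintro rfl; exact hs ht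
    obtain ⟨k, v, h1, h2, h3, h4⟩ := strip cs _ s t w le_rfl hs
    have hk0 : k ≠ 0 := by
      rintro rfl
      simp [alternatingWord] at h1
      subst h1
      exact h4 ht
    have hkm : k + 1 ≤ M s t := by
      by_contra hcon
      apply cs.not_isReduced_alternatingWord t s (hM t s) (m := k + 1) (by rw [M.symmetric]; omega)
      have h5 : w * cs.simple s = v * cs.wordProd (alternatingWord t s (k + 1)) := by
        rw [alternatingWord_succ, wordProd_concat, ← mul_assoc, ← h1]
      have h6 := (cs.not_isRightDescent_iff).1 hs
      have h7 := cs.length_mul_le v (cs.wordProd (alternatingWord t s (k + 1)))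
      have h8 := cs.length_wordProd_le (alternatingWord t s (k + 1))
      rw [← h5] at h7
      rw [length_alternatingWord] at h8
      unfold CoxeterSystem.IsReduced
      rw [length_alternatingWord]
      omega
    have i1 := ih v s (by omega) h3
    have i2 := ih v t (by omega) h4
    have hsin := sin_pos_M M hst (hM s t)
    have hm : (0:ℝ) < M s t := by exact_mod_cast Nat.pos_of_ne_zero (hM s t)
    have spos : ∀ l : ℕ, l ≤ M s t → 0 ≤ sin (l * (π / M s t)) := by
      intro l hl
      apply sin_nonneg_of_nonneg_of_le_pi
      · positivity
      · have : (l:ℝ) ≤ M s t := by exact_mod_cast hl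
        rw [mul_div_assoc', div_le_iff₀ hm, mul_comm]
        exact mul_le_mul_of_nonneg_left this pi_pos.le
    have s1 := spos k (by omega)
    have s2 := spos (k + 1) hkm
    push_cast at s2
    have key : 0 ≤ sin (π / M s t) • geo cs w (sr s) := by
      rw [h1, map_mul, Module.End.mul_apply, ← map_smul, alt_apply]
      split_ifs
      · rw [map_add, map_smul, map_smul]
        exact add_nonneg (smul_nonneg s2 i1) (smul_nonneg s1 i2)
      · rw [map_add, map_smul, map_smul]
        exact add_nonneg (smul_nonneg s1 i1) (smul_nonneg s2 i2)
    intro b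
    have := key b
    simp only [Pi.zero_apply, Pi.smul_apply, smul_eq_mul] at this ⊢
    exact nonneg_of_mul_nonneg_right this hsin

theorem root_neg (cs : CoxeterSystem M W) (hM : ∀ i j, M i j ≠ 0) (w : W) (s : B)
    (h : cs.IsRightDescent w s) : geo cs w (sr s) ≤ 0 := by
  have := root_pos cs hM _ (w * cs.simple s) s le_rfl
    ((cs.isRightDescent_iff_not_isRightDescent_mul).1 h)
  rw [map_mul, Module.End.mul_apply, geo_simple, rf_sr_self, map_neg] at this
  exact neg_nonneg.1 this

lemma root_ne_zero (cs : CoxeterSystem M W) (w : W) (s : B) : geo cs w (sr s) ≠ 0 := by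
  intro h
  exact sr_ne_zero s (geo_inj_apply cs w (by rw [h, map_zero]))

lemma desc_iff (cs : CoxeterSystem M W) (hM : ∀ i j, M i j ≠ 0) (w : W) (s : B) :
    cs.IsRightDescent w s ↔ geo cs w (sr s) ≤ 0 := by
  refine ⟨root_neg cs hM w s, fun h => ?_⟩
  by_contra hn
  exact root_ne_zero cs w s (le_antisymm h (root_pos cs hM _ w s le_rfl hn))

lemma geo_faithful (cs : CoxeterSystem M W) (hM : ∀ i j, M i j ≠ 0) {w w' : W}
    (h : ∀ b, geo cs w (sr b) = geo cs w' (sr b)) : w = w' := by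
  have h1 : w'⁻¹ * w = 1 := by
    by_contra hne
    obtain ⟨t, ht⟩ := cs.exists_rightDescent_of_ne_one hne
    rw [desc_iff cs hM, map_mul, Module.End.mul_apply, h, ← Module.End.mul_apply, ← map_mul] at ht
    have := ht t
    simp [sr] at this
    linarith
  exact (inv_mul_eq_one.1 h1).symm

end Geom

/-! ### Part 2 : path-like systems, the grid of roots -/

section PathPart

open Real

set_option linter.unusedSectionVars false

variable {B : Type*} {W : Type*} [Group W] [Fintype B] [DecidableEq B]

/-- Path data: the vertices `b 1, …, b n` in order, with edge weights `C 1, …, C (n-1)`. -/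
structure PD (M : CoxeterMatrix B) (n : ℕ) where
  b : ℕ → B
  C : ℕ → ℝ
  inj : ∀ i j, 1 ≤ i → i ≤ n → 1 ≤ j → j ≤ n → b i = b j → i = j
  surj : ∀ x : B, ∃ i, 1 ≤ i ∧ i ≤ n ∧ b i = x
  C0 : C 0 = 0
  Cn : C n = 0
  Cpos : ∀ i, 1 ≤ i → i < n → 0 < C i
  adj : ∀ i, 1 ≤ i → i < n → kk M (b i) (b (i + 1)) = - C i
  nadj : ∀ i j, 1 ≤ i → j ≤ n → i + 2 ≤ j → kk M (b i) (b j) = 0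
  comm : ∀ i j, 1 ≤ i → j ≤ n → i + 2 ≤ j → M (b i) (b j) = 2
  ncomm : ∀ i, 1 ≤ i → i < n → M (b i) (b (i + 1)) ≠ 2

variable {M : CoxeterMatrix B} {n : ℕ} (P : PD M n)

namespace PD

/-- the roots `β_i` -/
noncomputable def be : ℕ → B → ℝ
  | 0 => 0
  | i + 1 => sr (P.b (i + 1)) + P.C i • be i

lemma be_succ (i : ℕ) : P.be (i + 1) = sr (P.b (i + 1)) + P.C i • P.be i := rfl

/-- the prefix products `s_1 ⋯ s_i` -/
def pre (cs : CoxeterSystem M W) : ℕ → W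
  | 0 => 1
  | i + 1 => pre cs i * cs.simple (P.b (i + 1))

lemma pre_succ (cs : CoxeterSystem M W) (i : ℕ) :
    P.pre cs (i + 1) = P.pre cs i * cs.simple (P.b (i + 1)) := rfl

variable (cs : CoxeterSystem M W)

/-- refl on non adjacent -/
lemma rf_far (i j : ℕ) (hi : 1 ≤ i) (hi' : i ≤ n) (hj : 1 ≤ j) (hj' : j ≤ n)
    (h : i + 2 ≤ j ∨ j + 2 ≤ i) : rf M (P.b i) (sr (P.b j)) = sr (P.b j) := by
  rw [rf_sr]
  rcases h with h | h
  · rw [P.nadj i j hi hj' h]; simp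
  · rw [kk_symm, P.nadj j i hj hi' h]; simp

lemma rf_up (i : ℕ) (hi : 1 ≤ i) (hi' : i < n) :
    rf M (P.b i) (sr (P.b (i + 1))) = sr (P.b (i + 1)) + P.C i • sr (P.b i) := by
  rw [rf_sr, P.adj i hi hi']; module

lemma rf_down (i : ℕ) (hi : 1 ≤ i) (hi' : i < n) :
    rf M (P.b (i + 1)) (sr (P.b i)) = sr (P.b i) + P.C i • sr (P.b (i + 1)) := by
  rw [rf_sr, kk_symm, P.adj i hi hi']; module

lemma pre_far (i j : ℕ) (h : i + 2 ≤ j) (hj : j ≤ n) :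
    geo cs (P.pre cs i) (sr (P.b j)) = sr (P.b j) := by
  induction i with
  | zero => simp [pre]
  | succ i ih =>
    rw [pre_succ, map_mul, Module.End.mul_apply, geo_simple,
      P.rf_far _ _ (by omega) (by omega) (by omega) hj (by omega), ih (by omega)]

lemma pre_be (i : ℕ) (h : i + 1 ≤ n) :
    geo cs (P.pre cs i) (sr (P.b (i + 1))) = P.be (i + 1) := by
  induction i with
  | zero => simp [pre, be]
  | succ i ih =>
    rw [pre_succ, map_mul, Module.End.mul_apply, geo_simple, P.rf_up _ (by omega) (by omega),
      map_add, map_smul, ih (by omega), P.pre_far cs _ _ (by omega) h, be_succ P (i + 1)]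

lemma pre_self (i : ℕ) (h : i + 1 ≤ n) :
    geo cs (P.pre cs (i + 1)) (sr (P.b (i + 1))) = - P.be (i + 1) := by
  rw [pre_succ, map_mul, Module.End.mul_apply, geo_simple, rf_sr_self, map_neg, P.pre_be cs i h]

lemma pre_large (i m : ℕ) (h1 : 1 ≤ i) (hm : i + 1 ≤ m) (h : m ≤ n) :
    geo cs (P.pre cs m) (sr (P.b i)) = P.C i • P.be (i + 1) - P.be i := by
  induction m, hm using Nat.le_induction with
  | base =>
    rw [pre_succ, map_mul, Module.End.mul_apply, geo_simple, P.rf_down _ h1 (by omega),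
      map_add, map_smul, P.pre_be cs i h]
    obtain ⟨i, rfl⟩ : ∃ j, i = j + 1 := ⟨i - 1, by omega⟩
    rw [P.pre_self cs i (by omega)]
    abel
  | succ m hm ih =>
    rw [pre_succ, map_mul, Module.End.mul_apply, geo_simple,
      P.rf_far _ _ (by omega) (by omega) (by omega) (by omega) (by omega), ih (by omega)]

/-- the Coxeter element -/
def cox : W := P.pre cs n

lemma cox_sr (i : ℕ) (h1 : 1 ≤ i) (h : i ≤ n) :
    geo cs (P.cox cs) (sr (P.b i)) = P.C i • P.be (i + 1) - P.be i := by
  rcases h.lt_or_eq with h | rfl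
  · exact P.pre_large cs i n h1 h le_rfl
  · obtain ⟨i, rfl⟩ : ∃ j, i = j + 1 := ⟨i - 1, by omega⟩
    rw [cox, P.pre_self cs i (by omega), P.Cn]
    simp

/-- The grid of roots `ρ_{i,k} = c^k β_i`. -/
noncomputable def ro (i k : ℕ) : B → ℝ := geo cs (P.cox cs ^ k) (P.be i)

lemma ro_zero_left (k : ℕ) : P.ro cs 0 k = 0 := by simp [ro, be]

lemma ro_zero (i : ℕ) : P.ro cs i 0 = P.be i := by simp [ro]

lemma ro_add (i k l : ℕ) : P.ro cs i (k + l) = geo cs (P.cox cs ^ k) (P.ro cs i l) := by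
  rw [ro, ro, pow_add, map_mul, Module.End.mul_apply]

lemma ro_succ (i k : ℕ) : P.ro cs i (k + 1) = geo cs (P.cox cs) (P.ro cs i k) := by
  rw [add_comm, ro_add, pow_one]

lemma mesh (i k : ℕ) (h : i + 1 ≤ n) :
    P.ro cs (i + 1) k + P.ro cs (i + 1) (k + 1) =
      P.C (i + 1) • P.ro cs (i + 2) k + P.C i • P.ro cs i (k + 1) := by
  have h0 : P.be (i + 1) + geo cs (P.cox cs) (P.be (i + 1)) =
      P.C (i + 1) • P.be (i + 2) + P.C i • geo cs (P.cox cs) (P.be i) := by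
    have := P.cox_sr cs (i + 1) (by omega) h
    rw [be_succ P i, map_add, map_smul, this, be_succ P i]
    abel
  have h1 : ∀ j, P.ro cs j (k + 1) = geo cs (P.cox cs ^ k) (geo cs (P.cox cs) (P.be j)) := by
    intro j
    rw [ro_add, ← P.ro_zero cs, ← P.ro_succ cs]
  rw [h1, h1]
  have := congrArg (geo cs (P.cox cs ^ k)) h0
  simp only [map_add, map_smul] at this
  exact this

/-- roots -/
def IsRoot (v : B → ℝ) : Prop := ∃ (w : W) (x : B), v = geo cs w (sr x)

lemma be_root (i : ℕ) (h1 : 1 ≤ i) (h : i ≤ n) : IsRoot cs (P.be i) := by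
  obtain ⟨i, rfl⟩ : ∃ j, i = j + 1 := ⟨i - 1, by omega⟩
  exact ⟨_, _, (P.pre_be cs i h).symm⟩

lemma IsRoot.map {v : B → ℝ} (h : IsRoot cs v) (w : W) : IsRoot cs (geo cs w v) := by
  obtain ⟨u, x, rfl⟩ := h
  exact ⟨w * u, x, by rw [map_mul, Module.End.mul_apply]⟩

lemma ro_root (i k : ℕ) (h1 : 1 ≤ i) (h : i ≤ n) : IsRoot cs (P.ro cs i k) :=
  (P.be_root cs i h1 h).map cs _

lemma IsRoot.ne_zero {v : B → ℝ} (h : IsRoot cs v) : v ≠ 0 := by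
  obtain ⟨u, x, rfl⟩ := h
  exact root_ne_zero cs u x

lemma IsRoot.sign (hM : ∀ i j, M i j ≠ 0) {v : B → ℝ} (h : IsRoot cs v) : 0 ≤ v ∨ v ≤ 0 := by
  obtain ⟨u, x, rfl⟩ := h
  by_cases hd : cs.IsRightDescent u x
  · exact Or.inr (root_neg cs hM u x hd)
  · exact Or.inl (root_pos cs hM _ u x le_rfl hd)

lemma IsRoot.nonneg (hM : ∀ i j, M i j ≠ 0) {v : B → ℝ} (h : IsRoot cs v) (x : B) (hx : 0 < v x) :
    0 ≤ v := by
  rcases h.sign cs hM with h | h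
  · exact h
  · exact absurd (h x) (by simpa using hx)

lemma IsRoot.nonpos (hM : ∀ i j, M i j ≠ 0) {v : B → ℝ} (h : IsRoot cs v) (x : B) (hx : v x < 0) :
    v ≤ 0 := by
  rcases h.sign cs hM with h | h
  · exact absurd (h x) (by simpa using hx)
  · exact h

/-! the invariant form -/

lemma sr_sum (v : B → ℝ) : v = ∑ b, v b • sr b := by
  ext x
  simp [sr, Finset.sum_apply, Pi.single_apply]

/-- the invariant form -/
noncomputable def F (M : CoxeterMatrix B) : (B → ℝ) →ₗ[ℝ] (B → ℝ) →ₗ[ℝ] ℝ :=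
  ∑ b, (LinearMap.proj b : (B → ℝ) →ₗ[ℝ] ℝ).smulRight (ff M b)

lemma F_sr (x : B) (v : B → ℝ) : F M (sr x) v = ff M x v := by
  simp [F, sr, Pi.single_apply, LinearMap.sum_apply]

lemma F_sr' (x : B) (v : B → ℝ) : F M v (sr x) = ff M x v := by
  simp only [F, LinearMap.sum_apply, LinearMap.smulRight_apply, LinearMap.smul_apply, ff_sr]
  simp [ff, kk_symm M x, mul_comm]

lemma F_rf (b : B) (u v : B → ℝ) : F M (rf M b u) (rf M b v) = F M u v := by
  rw [rf_apply, rf_apply]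
  simp only [map_sub, map_smul, LinearMap.sub_apply, LinearMap.smul_apply, F_sr, F_sr', ff_sr,
    kk_self, smul_eq_mul]
  ring

lemma F_geo (w : W) : ∀ (u v : B → ℝ), F M (geo cs w u) (geo cs w v) = F M u v := by
  induction w using cs.simple_induction_left with
  | one => simp
  | mul_simple_left w i ih =>
    intro u v
    rw [map_mul, Module.End.mul_apply, Module.End.mul_apply, geo_simple, F_rf, ih]

lemma root_simple {v : B → ℝ} (h : IsRoot cs v) (h0 : 0 ≤ v) (b : B) (h1 : rf M b v ≤ 0) :
    v = sr b := by
  have hv : v = v b • sr b := by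
    ext x
    by_cases hx : x = b
    · subst hx; simp [sr]
    · have a1 := h1 x
      have a2 := h0 x
      rw [rf_apply] at a1
      simp [sr, hx] at a1 a2 ⊢
      linarith
  have hF : F M v v = 2 := by
    obtain ⟨w, x, rfl⟩ := h
    rw [F_geo, F_sr, ff_sr, kk_self]
  rw [hv] at hF
  simp only [map_smul, LinearMap.smul_apply, F_sr, ff_sr, kk_self, smul_eq_mul] at hF
  have hb := h0 b
  simp only [Pi.zero_apply] at hb
  have : v b = 1 := by nlinarith
  rw [hv, this, one_smul]

lemma pre_neg (hM : ∀ i j, M i j ≠ 0) (j : ℕ) (hj : j ≤ n) (v : B → ℝ) (h : IsRoot cs v)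
    (h0 : 0 ≤ v) (h1 : geo cs (P.pre cs j) v ≤ 0) :
    ∃ m, 1 ≤ m ∧ m ≤ j ∧ geo cs (P.pre cs j) v = - P.be m := by
  induction j generalizing v with
  | zero =>
    simp [pre] at h1
    exact absurd (le_antisymm h1 h0) (h.ne_zero cs)
  | succ j ih =>
    rw [pre_succ, map_mul, Module.End.mul_apply, geo_simple] at h1 ⊢
    have hr : IsRoot cs (rf M (P.b (j + 1)) v) := by
      rw [← geo_simple cs]; exact h.map cs _
    rcases hr.sign cs hM with h2 | h2
    · obtain ⟨m, a, b, c⟩ := ih (by omega) _ hr h2 h1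
      exact ⟨m, a, by omega, c⟩
    · have := root_simple cs h h0 _ h2
      refine ⟨j + 1, by omega, le_rfl, ?_⟩
      rw [this, rf_sr_self, map_neg, P.pre_be cs j hj]

/-! the Euler form -/

/-- Euler form -/
noncomputable def E : (B → ℝ) →ₗ[ℝ] (B → ℝ) →ₗ[ℝ] ℝ :=
  ∑ i ∈ Finset.Icc 1 n, (LinearMap.proj (P.b i) : (B → ℝ) →ₗ[ℝ] ℝ).smulRight
    ((LinearMap.proj (P.b i) : (B → ℝ) →ₗ[ℝ] ℝ) - P.C (i - 1) • LinearMap.proj (P.b (i - 1)))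

lemma sr_b (i j : ℕ) (hi : 1 ≤ i) (hi' : i ≤ n) (hj : 1 ≤ j) (hj' : j ≤ n) :
    (sr (P.b i) : B → ℝ) (P.b j) = if i = j then 1 else 0 := by
  by_cases h : i = j
  · subst h; simp [sr]
  · have : P.b j ≠ P.b i := fun hh => h (P.inj _ _ hi hi' hj hj' hh.symm)
    simp [sr, h, this]

lemma E_apply (x y : B → ℝ) : P.E x y =
    ∑ i ∈ Finset.Icc 1 n, x (P.b i) * (y (P.b i) - P.C (i - 1) * y (P.b (i - 1))) := by
  simp [E, LinearMap.sum_apply]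

lemma E_sr_left (j : ℕ) (hj : 1 ≤ j) (hj' : j ≤ n) (y : B → ℝ) :
    P.E (sr (P.b j)) y = y (P.b j) - P.C (j - 1) * y (P.b (j - 1)) := by
  rw [E_apply, Finset.sum_eq_single j]
  · rw [P.sr_b _ _ hj hj' hj hj']; simp
  · intro i hi hij
    rw [Finset.mem_Icc] at hi
    rw [P.sr_b _ _ hj hj' hi.1 hi.2, if_neg (Ne.symm hij)]; simp
  · intro h
    exact absurd (Finset.mem_Icc.2 ⟨hj, hj'⟩) h

lemma E_sr_right (j : ℕ) (hj : 1 ≤ j) (hj' : j ≤ n) (y : B → ℝ) :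
    P.E y (sr (P.b j)) = y (P.b j) - P.C j * y (P.b (j + 1)) := by
  have h1 : ∀ i ∈ Finset.Icc 1 n, y (P.b i) * ((sr (P.b j) : B → ℝ) (P.b i) -
      P.C (i - 1) * (sr (P.b j) : B → ℝ) (P.b (i - 1))) =
      (if i = j then y (P.b j) else 0) - (if i = j + 1 then P.C j * y (P.b (j + 1)) else 0) := by
    intro i hi
    rw [Finset.mem_Icc] at hi
    rw [P.sr_b j i hj hj' hi.1 hi.2]
    rcases Nat.lt_or_ge 1 i with h | h
    · rw [P.sr_b j (i - 1) hj hj' (by omega) (by omega)]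
      by_cases a : i = j
      · subst a
        have a1 : i ≠ i - 1 := by omega
        simp [a1]
      · by_cases b : i = j + 1
        · subst b; simp; ring
        · have b1 : j ≠ i - 1 := by omega
          simp [a, b, b1, Ne.symm a]
    · obtain rfl : i = 1 := by omega
      have b1 : ¬ (1 = j + 1) := by omega
      simp only [Nat.sub_self, P.C0, zero_mul, sub_zero, b1, if_false]
      by_cases a : 1 = j
      · subst a; simp
      · simp [a, Ne.symm a]
  rw [E_apply, Finset.sum_congr rfl h1, Finset.sum_sub_distrib, Finset.sum_ite_eq',
    Finset.sum_ite_eq', if_pos (Finset.mem_Icc.2 ⟨hj, hj'⟩)]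
  by_cases h : j + 1 ≤ n
  · rw [if_pos (Finset.mem_Icc.2 ⟨by omega, h⟩)]
  · obtain rfl : j = n := by omega
    rw [if_neg (by simp), P.Cn]; simp

lemma E_be (i : ℕ) (hi : 1 ≤ i) (hi' : i ≤ n) (y : B → ℝ) : P.E (P.be i) y = y (P.b i) := by
  induction i, hi using Nat.le_induction with
  | base => simp only [be, map_add, P.C0, zero_smul, add_zero]; rw [P.E_sr_left _ le_rfl hi']; simp [P.C0]
  | succ i hi ih =>
    rw [be_succ, map_add, map_smul, LinearMap.add_apply, LinearMap.smul_apply, ih (by omega),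
      P.E_sr_left _ (by omega) hi']
    simp

lemma E_cox (x y : B → ℝ) : P.E (geo cs (P.cox cs) x) y = - P.E y x := by
  have h1 : ∀ b, P.E (geo cs (P.cox cs) (sr b)) y = - P.E y (sr b) := by
    intro b
    obtain ⟨i, hi, hi', rfl⟩ := P.surj b
    rw [P.cox_sr cs i hi hi', P.E_sr_right i hi hi', map_sub, map_smul, LinearMap.sub_apply,
      LinearMap.smul_apply, P.E_be i hi hi']
    rcases hi'.lt_or_eq with h | rfl
    · rw [P.E_be (i + 1) (by omega) h]; simp
    · rw [P.Cn]; simp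
  rw [sr_sum x]
  simp only [map_sum, map_smul, LinearMap.sum_apply, LinearMap.smul_apply, h1, smul_neg,
    Finset.sum_neg_distrib]

lemma E_inv (k : ℕ) (x y : B → ℝ) :
    P.E (geo cs (P.cox cs ^ k) x) (geo cs (P.cox cs ^ k) y) = P.E x y := by
  induction k generalizing x y with
  | zero => simp
  | succ k ih =>
    rw [pow_succ, map_mul, Module.End.mul_apply, Module.End.mul_apply, ih, E_cox, E_cox, neg_neg]

/-! triangularity -/

lemma be_tri (j m : ℕ) (h : j < m) (hm : m ≤ n) : P.be j (P.b m) = 0 := by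
  induction j with
  | zero => simp [be]
  | succ j ih =>
    rw [be_succ, Pi.add_apply, Pi.smul_apply, ih (by omega),
      P.sr_b _ _ (by omega) (by omega) (by omega) hm, if_neg (by omega)]
    simp

lemma be_self (j : ℕ) (h : 1 ≤ j) (hm : j ≤ n) : P.be j (P.b j) = 1 := by
  obtain ⟨j, rfl⟩ : ∃ i, j = i + 1 := ⟨j - 1, by omega⟩
  rw [be_succ, Pi.add_apply, Pi.smul_apply, P.be_tri _ _ (by omega) hm,
      P.sr_b _ _ (by omega) (by omega) (by omega) hm, if_pos rfl]
  simp

lemma be_next (j : ℕ) (h : 1 ≤ j) (hm : j + 1 ≤ n) : P.be (j + 1) (P.b j) = P.C j := by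
  rw [be_succ, Pi.add_apply, Pi.smul_apply, P.be_self _ h (by omega),
      P.sr_b _ _ (by omega) (by omega) (by omega) (by omega), if_neg (by omega)]
  simp

lemma ro_tri (d : ℕ) : ∀ j m, j + d < m → m ≤ n → P.ro cs j d (P.b m) = 0 := by
  induction d with
  | zero => intro j m h hm; rw [ro_zero, P.be_tri _ _ (by omega) hm]
  | succ d ihd =>
    intro j
    induction j with
    | zero => intro m _ _; simp [ro_zero_left]
    | succ j ihj =>
      intro m h hm
      have := congrFun (P.mesh cs j d (by omega)) (P.b m)
      simp only [Pi.add_apply, Pi.smul_apply, smul_eq_mul] at this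
      rw [ihd _ _ (by omega) hm, ihd _ _ (by omega) hm, ihj _ (by omega) hm] at this
      linarith

lemma ro_diag (d : ℕ) : ∀ j, 1 ≤ j → j + d ≤ n → 0 < P.ro cs j d (P.b (j + d)) := by
  induction d with
  | zero => intro j h hm; rw [ro_zero, add_zero, P.be_self _ h (by omega)]; norm_num
  | succ d ihd =>
    intro j h hm
    obtain ⟨j, rfl⟩ : ∃ i, j = i + 1 := ⟨j - 1, by omega⟩
    have := congrFun (P.mesh cs j d (by omega)) (P.b (j + 1 + (d + 1)))
    simp only [Pi.add_apply, Pi.smul_apply, smul_eq_mul] at this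
    rw [P.ro_tri cs d (j + 1) _ (by omega) hm, P.ro_tri cs (d + 1) j _ (by omega) hm] at this
    have h2 := ihd (j + 2) (by omega) (by omega)
    have h3 := P.Cpos (j + 1) (by omega) (by omega)
    rw [show j + 1 + (d + 1) = j + 2 + d by omega] at this ⊢
    have := mul_pos h3 h2
    linarith

lemma cox_inv_be (x : B → ℝ) (i : ℕ) (hi : 1 ≤ i) (hi' : i ≤ n)
    (h : geo cs (P.cox cs) x = P.be i) : x (P.b i) = -1 := by
  have h1 := P.E_be i hi hi' x
  have h2 := P.E_cox cs x (P.be i)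
  rw [h, P.E_be i hi hi', P.be_self i hi hi'] at h2
  linarith

end PD

end PathPart

/-! ### Part 3 : structure of the grid -/

section StructPart

open Real

set_option linter.unusedSectionVars false

variable {B : Type*} {W : Type*} [Group W] [Fintype B] [DecidableEq B]

variable {M : CoxeterMatrix B} {n : ℕ} (P : PD M n) (cs : CoxeterSystem M W)

namespace PD

/-- the first power of `c` making `β_i` negative -/
noncomputable def a (i : ℕ) : ℕ := sInf {k | P.ro cs i k ≤ 0}

variable {P cs}


lemma ro_neg_of_succ (hM : ∀ i j, M i j ≠ 0) (i j k : ℕ) (hi : 1 ≤ i) (hi' : i ≤ n)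
    (h : P.ro cs j (k + 1) = P.be i) : ¬ 0 ≤ P.ro cs j k := by
  intro h0
  rw [ro_succ] at h
  have h2 := P.cox_inv_be cs _ i hi hi' h
  have := h0 (P.b i)
  rw [h2] at this
  simp at this
  linarith


lemma a_ne [Finite W] (hM : ∀ i j, M i j ≠ 0) (i : ℕ) (hi : 1 ≤ i) (hi' : i ≤ n) : P.ro cs i (P.a cs i) ≤ 0 := by
  have : ({k | P.ro cs i k ≤ 0} : Set ℕ).Nonempty := by
    have h1 : 0 < orderOf (P.cox cs) := orderOf_pos _
    obtain ⟨k, hk⟩ : ∃ k, orderOf (P.cox cs) = k + 1 := ⟨_, (Nat.succ_pred_eq_of_pos h1).symm⟩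
    refine ⟨k, ?_⟩
    have h2 : P.ro cs i (k + 1) = P.be i := by
      rw [ro, ← hk, pow_orderOf_eq_one]; simp
    rcases (P.ro_root cs i k hi hi').sign cs hM with h3 | h3
    · exact absurd h3 (ro_neg_of_succ hM i i k hi hi' h2)
    · exact h3
  exact Nat.sInf_mem this

lemma a_lt (hM : ∀ i j, M i j ≠ 0) (i k : ℕ) (hi : 1 ≤ i) (hi' : i ≤ n) (h : k < P.a cs i) : 0 ≤ P.ro cs i k := by
  have := Nat.notMem_of_lt_sInf h
  exact ((P.ro_root cs i k hi hi').sign cs hM).resolve_right this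

lemma a_le_of (hM : ∀ i j, M i j ≠ 0) (i k m : ℕ) (hi : 1 ≤ i) (hi' : i ≤ n) (hm : 1 ≤ m) (hm' : m ≤ n)
    (h : P.ro cs i k = - P.be m) : P.a cs i ≤ k := by
  by_contra hc
  have := a_lt hM (P := P) (cs := cs) i k hi hi' (by omega) (P.b m)
  rw [h, Pi.neg_apply, P.be_self m hm hm'] at this
  simp at this
  linarith

lemma a_pos [Finite W] (hM : ∀ i j, M i j ≠ 0) (i : ℕ) (hi : 1 ≤ i) (hi' : i ≤ n) : 1 ≤ P.a cs i := by
  by_contra hc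
  have h0 : P.a cs i = 0 := by omega
  have := a_ne hM (P := P) (cs := cs) i hi hi' (P.b i)
  rw [h0, ro_zero, P.be_self i hi hi'] at this
  simp at this
  linarith

lemma sig_ex [Finite W] (hM : ∀ i j, M i j ≠ 0) (i : ℕ) (hi : 1 ≤ i) (hi' : i ≤ n) :
    ∃ m, (1 ≤ m ∧ m ≤ n) ∧ P.ro cs i (P.a cs i) = - P.be m := by
  have h1 := a_pos hM (P := P) (cs := cs) i hi hi'
  obtain ⟨k, hk⟩ : ∃ k, P.a cs i = k + 1 := ⟨_, (Nat.succ_pred_eq_of_pos h1).symm⟩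
  have h2 := a_ne hM (P := P) (cs := cs) i hi hi'
  rw [hk, ro_succ] at h2 ⊢
  obtain ⟨m, a, b, c⟩ := P.pre_neg cs hM n le_rfl _ (P.ro_root cs i k hi hi')
    (a_lt hM i k hi hi' (by omega)) h2
  exact ⟨m, ⟨a, b⟩, c⟩

lemma be_inj (i j : ℕ) (hi : 1 ≤ i) (hi' : i ≤ n) (hj : 1 ≤ j) (hj' : j ≤ n)
    (h : P.be i = P.be j) : i = j := by
  rcases lt_trichotomy i j with h1 | h1 | h1
  · have := P.be_self j hj hj'
    rw [← h, P.be_tri i j h1 hj'] at this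
    norm_num at this
  · exact h1
  · have := P.be_self i hi hi'
    rw [h, P.be_tri j i h1 hi'] at this
    norm_num at this

lemma sig_inj' (hM : ∀ i j, M i j ≠ 0) (i j : ℕ) (hi : 1 ≤ i) (hi' : i ≤ n) (hj : 1 ≤ j) (hj' : j ≤ n)
    (hle : P.a cs i ≤ P.a cs j)
    (h : P.ro cs i (P.a cs i) = P.ro cs j (P.a cs j)) : i = j := by
  obtain ⟨d, hd⟩ := Nat.exists_eq_add_of_le hle
  have h1 : P.be i = P.ro cs j d := by
    rw [hd, ro_add] at h
    exact geo_inj_apply cs _ h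
  rcases d with _ | d
  · rw [ro_zero] at h1
    exact be_inj i j hi hi' hj hj' h1
  · exact absurd (a_lt hM j d hj hj' (by omega)) (ro_neg_of_succ hM i j d hi hi' h1.symm)

lemma sig_inj (hM : ∀ i j, M i j ≠ 0) (i j : ℕ) (hi : 1 ≤ i) (hi' : i ≤ n) (hj : 1 ≤ j) (hj' : j ≤ n)
    (h : P.ro cs i (P.a cs i) = P.ro cs j (P.a cs j)) : i = j := by
  rcases le_total (P.a cs i) (P.a cs j) with h1 | h1
  · exact sig_inj' hM i j hi hi' hj hj' h1 h
  · exact (sig_inj' hM j i hj hj' hi hi' h1 h.symm).symm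

lemma tau_ex [Finite W] (hM : ∀ i j, M i j ≠ 0) : ∃ τ : ℕ → ℕ, ∀ m, 1 ≤ m → m ≤ n → (1 ≤ τ m ∧ τ m ≤ n) ∧
    P.ro cs (τ m) (P.a cs (τ m)) = - P.be m := by
  have h1 : ∀ i, ∃ m, 1 ≤ i → i ≤ n →
      ((1 ≤ m ∧ m ≤ n) ∧ P.ro cs i (P.a cs i) = - P.be m) := by
    intro i
    by_cases h : 1 ≤ i ∧ i ≤ n
    · obtain ⟨m, hm⟩ := sig_ex hM (P := P) (cs := cs) i h.1 h.2
      exact ⟨m, fun _ _ => hm⟩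
    · exact ⟨0, fun h1 h2 => absurd ⟨h1, h2⟩ h⟩
  choose σ hσ using h1
  have hs : Set.SurjOn σ (Finset.Icc 1 n : Finset ℕ) (Finset.Icc 1 n : Finset ℕ) := by
    apply Finset.surjOn_of_injOn_of_card_le
    · intro i hi
      simp only [Finset.coe_Icc, Set.mem_Icc] at hi ⊢
      exact (hσ i hi.1 hi.2).1
    · intro i hi j hj hij
      simp only [Finset.coe_Icc, Set.mem_Icc] at hi hj
      apply sig_inj hM (P := P) (cs := cs) i j hi.1 hi.2 hj.1 hj.2
      rw [(hσ i hi.1 hi.2).2, (hσ j hj.1 hj.2).2, hij]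
    · exact le_rfl
  have h2 : ∀ m, ∃ i, 1 ≤ m → m ≤ n →
      ((1 ≤ i ∧ i ≤ n) ∧ P.ro cs i (P.a cs i) = - P.be m) := by
    intro m
    by_cases h : 1 ≤ m ∧ m ≤ n
    · obtain ⟨i, hi, hm⟩ := hs (show m ∈ _ by simpa using h)
      simp only [Finset.coe_Icc, Set.mem_Icc] at hi
      refine ⟨i, fun _ _ => ⟨hi, ?_⟩⟩
      rw [(hσ i hi.1 hi.2).2, hm]
    · exact ⟨0, fun h1 h2 => absurd ⟨h1, h2⟩ h⟩
  choose τ hτ using h2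
  exact ⟨τ, hτ⟩

lemma pos_E (hM : ∀ i j, M i j ≠ 0) (i j k l : ℕ) (hi : 1 ≤ i) (hi' : i ≤ n) (hj : 1 ≤ j) (hj' : j ≤ n)
    (hk : k ≤ P.a cs i) (h : 0 < P.E (P.ro cs i k) (P.ro cs j l)) :
    k ≤ l ∧ i ≤ j + (l - k) := by
  rcases le_or_gt k l with hl | hl
  · refine ⟨hl, ?_⟩
    obtain ⟨d, rfl⟩ := Nat.exists_eq_add_of_le hl
    rw [ro_add, ro, E_inv, P.E_be i hi hi'] at h
    by_contra hc
    rw [P.ro_tri cs d j i (by omega) hi'] at h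
    exact lt_irrefl _ h
  · exfalso
    obtain ⟨t, rfl⟩ : ∃ t, k = l + (t + 1) := ⟨k - l - 1, by omega⟩
    rw [ro_add, ro_succ, show P.ro cs j l = geo cs (P.cox cs ^ l) (P.be j) from rfl, E_inv, E_cox, P.E_be j hj hj'] at h
    have := a_lt hM (P := P) (cs := cs) i t hi hi' (by omega) (P.b j)
    simp at this
    linarith

lemma tau_step [Finite W] (hM : ∀ i j, M i j ≠ 0) (m i j : ℕ) (hm : 1 ≤ m) (hm' : m < n)
    (hi : 1 ≤ i) (hi' : i ≤ n) (hj : 1 ≤ j) (hj' : j ≤ n)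
    (h1 : P.ro cs i (P.a cs i) = - P.be m) (h2 : P.ro cs j (P.a cs j) = - P.be (m + 1)) :
    (P.a cs j = P.a cs i ∧ j = i + 1) ∨ (P.a cs j = P.a cs i + 1 ∧ i = j + 1) := by
  have e1 := pos_E hM (P := P) (cs := cs) i j (P.a cs i) (P.a cs j) hi hi' hj hj' le_rfl (by
    rw [h1, h2, map_neg, map_neg, LinearMap.neg_apply, neg_neg, P.E_be m hm (by omega),
      P.be_next m hm (by omega)]
    exact P.Cpos m hm hm')
  have e2 := pos_E hM (P := P) (cs := cs) j i (P.a cs j) (P.a cs i + 1) hj hj' hi hi' le_rfl (by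
    rw [ro_succ, h1, h2, map_neg, map_neg, map_neg, LinearMap.neg_apply, neg_neg,
      P.E_be (m + 1) (by omega) (by omega), ← P.ro_zero cs, ← P.ro_succ cs]
    exact P.ro_diag cs 1 m hm (by omega))
  have hne : i ≠ j := by
    rintro rfl
    rw [h1, neg_inj] at h2
    have := be_inj _ _ hm (by omega) (by omega) (by omega) h2
    omega
  omega

lemma pow_one_of (hM : ∀ i j, M i j ≠ 0) (K : ℕ) (h : ∀ i, 1 ≤ i → i ≤ n → P.ro cs i K = P.be i) : P.cox cs ^ K = 1 := by
  apply geo_faithful cs hM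
  intro x
  obtain ⟨i, hi, hi', rfl⟩ := P.surj x
  have hh : ∀ i, i ≤ n → geo cs (P.cox cs ^ K) (P.be i) = P.be i := by
    intro i hi'
    rcases i with _ | i
    · simp [be]
    · exact h _ (by omega) hi'
  obtain ⟨i, rfl⟩ : ∃ j, i = j + 1 := ⟨i - 1, by omega⟩
  have : sr (P.b (i + 1)) = P.be (i + 1) - P.C i • P.be i := by rw [be_succ]; abel
  rw [this, map_sub, map_smul, hh _ hi', hh i (by omega)]
  simp

lemma order_eq [Finite W] (hM : ∀ i j, M i j ≠ 0) (hn : 1 ≤ n) (K : ℕ) (s : ℕ → ℕ) (hs : ∀ i, 1 ≤ i → i ≤ n → 1 ≤ s i ∧ s i ≤ n)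
    (hss : ∀ i, 1 ≤ i → i ≤ n → s (s i) = i)
    (h : ∀ i, 1 ≤ i → i ≤ n → P.ro cs i (P.a cs i) = - P.be (s i))
    (hK : ∀ i, 1 ≤ i → i ≤ n → P.a cs i + P.a cs (s i) = K) : orderOf (P.cox cs) = K := by
  have hK0 : 0 < K := by
    have := hK 1 le_rfl hn
    have := a_pos hM (P := P) (cs := cs) 1 le_rfl hn
    omega
  apply le_antisymm
  · apply orderOf_le_of_pow_eq_one hK0
    apply pow_one_of hM
    intro i hi hi'
    have := hs i hi hi'
    rw [← hK i hi hi', add_comm, ro_add, h i hi hi', map_neg, ← ro,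
      h (s i) this.1 this.2, hss i hi hi', neg_neg]
  · have h1 : 0 < orderOf (P.cox cs) := orderOf_pos _
    obtain ⟨k, hk⟩ : ∃ k, orderOf (P.cox cs) = k + 1 := ⟨_, (Nat.succ_pred_eq_of_pos h1).symm⟩
    have h2 : P.ro cs 1 (k + 1) = P.be 1 := by
      rw [ro, ← hk, pow_orderOf_eq_one]; simp
    have h3 := ro_neg_of_succ hM 1 1 k le_rfl hn h2
    have h4 : P.a cs 1 ≤ k := by
      by_contra hc
      exact h3 (a_lt hM 1 k le_rfl hn (by omega))
    obtain ⟨r, rfl⟩ := Nat.exists_eq_add_of_le h4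
    have h5 : P.ro cs (s 1) (r + 1) = - P.be 1 := by
      rw [show P.a cs 1 + r + 1 = (r + 1) + P.a cs 1 by omega, ro_add, h 1 le_rfl hn, map_neg,
        ← ro] at h2
      rw [← h2, neg_neg]
    have hs1 := hs 1 le_rfl hn
    have := a_le_of hM (s 1) (r + 1) 1 hs1.1 hs1.2 le_rfl hn h5
    rw [hk, ← hK 1 le_rfl hn]
    omega

theorem struct [Finite W] (hM : ∀ i j, M i j ≠ 0) (hn : 1 < n) :
    (∃ N, n ≤ N ∧ orderOf (P.cox cs) = 2 * N ∧ ∀ i, 1 ≤ i → i ≤ n →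
      P.a cs i = N ∧ P.ro cs i (P.a cs i) = - P.be i) ∨
    (∃ A, 1 ≤ A ∧ orderOf (P.cox cs) = 2 * A + n - 1 ∧ ∀ i, 1 ≤ i → i ≤ n →
      P.a cs i = A + (n - i) ∧ P.ro cs i (P.a cs i) = - P.be (n + 1 - i)) := by
  obtain ⟨τ, hτ⟩ := tau_ex hM (P := P) (cs := cs)
  have hst : ∀ m, 1 ≤ m → m < n → (P.a cs (τ (m + 1)) = P.a cs (τ m) ∧ τ (m + 1) = τ m + 1) ∨
      (P.a cs (τ (m + 1)) = P.a cs (τ m) + 1 ∧ τ m = τ (m + 1) + 1) := by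
    intro m hm hm'
    have t1 := hτ m hm (by omega)
    have t2 := hτ (m + 1) (by omega) (by omega)
    exact tau_step hM m _ _ hm hm' t1.1.1 t1.1.2 t2.1.1 t2.1.2 t1.2 t2.2
  have hne : ∀ m, 1 ≤ m → m + 2 ≤ n → τ (m + 2) ≠ τ m := by
    intro m hm hm' he
    have t1 := hτ m hm (by omega)
    have t2 := hτ (m + 2) (by omega) (by omega)
    rw [he, t1.2, neg_inj] at t2
    have := be_inj _ _ hm (by omega) (by omega) (by omega) t2.2
    omega
  have b1 := hτ 1 le_rfl (by omega)
  have bn := hτ n (by omega) le_rfl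
  rcases hst 1 le_rfl hn with h1 | h1
  · left
    have key : ∀ m, 1 ≤ m → m + 1 ≤ n → τ m = τ 1 + (m - 1) ∧ P.a cs (τ m) = P.a cs (τ 1) ∧
        τ (m + 1) = τ m + 1 ∧ P.a cs (τ (m + 1)) = P.a cs (τ 1) := by
      intro m hm
      induction m, hm using Nat.le_induction with
      | base => intro _; exact ⟨rfl, rfl, h1.2, h1.1⟩
      | succ m hm ih =>
        intro h
        have i1 := ih (by omega)
        have i2 := hst (m + 1) (by omega) (by omega)
        have i3 := hne m hm (by omega)
        rw [show m + 1 + 1 = m + 2 from rfl] at *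
        omega
    have k0 := key (n - 1) (by omega) (by omega)
    rw [show n - 1 + 1 = n by omega] at k0
    have t1 : τ 1 = 1 := by omega
    have tm : ∀ m, 1 ≤ m → m ≤ n → τ m = m ∧ P.a cs (τ m) = P.a cs (τ 1) := by
      intro m hm hm'
      rcases hm'.lt_or_eq with h | h
      · have := key m hm h; omega
      · subst h; omega
    have main : ∀ i, 1 ≤ i → i ≤ n →
      P.a cs i = P.a cs 1 ∧ P.ro cs i (P.a cs i) = - P.be i := by
      intro i hi hi'
      have u1 := tm i hi hi'
      have u2 := hτ i hi hi'
      have u3 := u1.1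
      rw [u3, t1] at u1
      rw [u3] at u2
      exact ⟨u1.2, u2.2⟩
    refine ⟨P.a cs 1, ?_, ?_, main⟩
    · by_contra hc
      have v1 := P.ro_diag cs (P.a cs 1) 1 le_rfl (by omega)
      have v2 := a_ne hM (P := P) (cs := cs) 1 le_rfl (by omega) (P.b (1 + P.a cs 1))
      exact absurd v2 (by simpa using v1)
    · apply order_eq hM (by omega) _ (fun i => i) (fun i h h' => ⟨h, h'⟩) (fun _ _ _ => rfl)
      · intro i h h'; exact (main i h h').2
      · intro i h h'; rw [(main i h h').1]; ring
  · right
    have key : ∀ m, 1 ≤ m → m + 1 ≤ n → τ m + (m - 1) = τ 1 ∧ P.a cs (τ m) = P.a cs (τ 1) + (m - 1) ∧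
        τ m = τ (m + 1) + 1 ∧ P.a cs (τ (m + 1)) = P.a cs (τ 1) + m := by
      intro m hm
      induction m, hm using Nat.le_induction with
      | base => intro _; exact ⟨rfl, rfl, h1.2, h1.1⟩
      | succ m hm ih =>
        intro h
        have i1 := ih (by omega)
        have i2 := hst (m + 1) (by omega) (by omega)
        have i3 := hne m hm (by omega)
        rw [show m + 1 + 1 = m + 2 from rfl] at *
        omega
    have k0 := key (n - 1) (by omega) (by omega)
    rw [show n - 1 + 1 = n by omega] at k0
    have t1 : τ 1 = n := by omega
    have tm : ∀ m, 1 ≤ m → m ≤ n → τ m = n + 1 - m ∧ P.a cs (τ m) = P.a cs (τ 1) + (m - 1) := by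
      intro m hm hm'
      rcases hm'.lt_or_eq with h | h
      · have := key m hm h; omega
      · subst h; omega
    have main : ∀ i, 1 ≤ i → i ≤ n →
      P.a cs i = P.a cs n + (n - i) ∧ P.ro cs i (P.a cs i) = - P.be (n + 1 - i) := by
      intro i hi hi'
      have u1 := tm (n + 1 - i) (by omega) (by omega)
      have u2 := hτ (n + 1 - i) (by omega) (by omega)
      have u3 : τ (n + 1 - i) = i := by omega
      rw [u3, t1] at u1
      rw [u3] at u2
      exact ⟨by omega, u2.2⟩
    refine ⟨P.a cs n, a_pos hM n (by omega) le_rfl, ?_, main⟩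
    apply order_eq hM (by omega) _ (fun i => n + 1 - i)
    · intro i h h'; omega
    · intro i h h'; omega
    · intro i h h'; exact (main i h h').2
    · intro i h h'
      have := (main i h h').1
      have := (main (n + 1 - i) (by omega) (by omega)).1
      omega

end PD

end StructPart

/-! ### Part 4 : profiles and paths -/

section ProfPart

open Real

set_option linter.unusedSectionVars false

variable {B : Type*} {W : Type*} [Group W]

lemma CommEquiv.cons {M : CoxeterMatrix B} {l m : List B} (c : B) (h : CommEquiv M l m) :
    CommEquiv M (c :: l) (c :: m) := by
  induction h with
  | refl => exact Relation.ReflTransGen.refl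
  | tail _ h2 ih =>
    refine Relation.ReflTransGen.tail ih ?_
    obtain ⟨u, v, i, j, h, rfl, rfl⟩ := h2
    exact ⟨c :: u, v, i, j, h, rfl, rfl⟩

/-- slices of the grid -/
def Slice (n : ℕ) (x : ℕ → ℕ) : Prop :=
  (∀ i, i = 0 ∨ n < i → x i = 0) ∧ ∀ i, 1 ≤ i → i < n → x (i + 1) ≤ x i ∧ x i ≤ x (i + 1) + 1

/-- addable positions -/
def Addable (n : ℕ) (x : ℕ → ℕ) (i : ℕ) : Prop :=
  (1 ≤ i ∧ i ≤ n) ∧ (i = 1 ∨ x (i - 1) = x i + 1) ∧ (i = n ∨ x (i + 1) = x i)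

/-- adding a box -/
def stp (x : ℕ → ℕ) (i : ℕ) : ℕ → ℕ := Function.update x i (x i + 1)

lemma stp_self (x : ℕ → ℕ) (i : ℕ) : stp x i i = x i + 1 := by simp [stp]

lemma stp_ne (x : ℕ → ℕ) (i j : ℕ) (h : j ≠ i) : stp x i j = x j := by simp [stp, h]

lemma stp_apply (x : ℕ → ℕ) (i j : ℕ) : stp x i j = if j = i then x i + 1 else x j := by
  simp [stp, Function.update_apply]

lemma stp_comm (x : ℕ → ℕ) (i j : ℕ) (h : i ≠ j) : stp (stp x i) j = stp (stp x j) i := by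
  ext k
  simp only [stp_apply]
  split_ifs <;> omega

lemma Slice.stp {n : ℕ} {x : ℕ → ℕ} {i : ℕ} (hx : Slice n x) (hi : Addable n x i) :
    Slice n (stp x i) := by
  obtain ⟨h1, h2, h3⟩ := hi
  constructor
  · intro j hj
    rw [stp_ne _ _ _ (by omega)]
    exact hx.1 j hj
  · intro j hj hj'
    have := hx.2 j hj hj'
    simp only [stp_apply]
    by_cases e1 : j = i
    · subst e1
      simp
      omega
    · by_cases e2 : j + 1 = i
      · subst e2
        simp
        simp at h2
        omega
      · simp [e1, e2]
        omega

lemma addable_swap {n : ℕ} {x : ℕ → ℕ} {p q : ℕ} (h : p + 2 ≤ q ∨ q + 2 ≤ p) (h2 : Addable n (stp x p) q) :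
    Addable n x q := by
  obtain ⟨h1, h2, h3⟩ := h2
  rw [stp_ne _ _ q (by omega)] at h2 h3
  refine ⟨h1, ?_, ?_⟩
  · rcases h2 with h2 | h2
    · exact Or.inl h2
    · rw [stp_ne _ _ _ (by omega)] at h2
      exact Or.inr h2
  · rcases h3 with h2 | h2
    · exact Or.inl h2
    · rw [stp_ne _ _ _ (by omega)] at h2
      exact Or.inr h2

lemma addable_swap' {n : ℕ} {x : ℕ → ℕ} {p q : ℕ} (h : p + 2 ≤ q ∨ q + 2 ≤ p) (h2 : Addable n x q) :
    Addable n (stp x p) q := by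
  obtain ⟨h1, h2, h3⟩ := h2
  refine ⟨h1, ?_, ?_⟩
  · rw [stp_ne _ _ _ (by omega), stp_ne _ _ _ (by omega)]; exact h2
  · rw [stp_ne _ _ _ (by omega), stp_ne _ _ _ (by omega)]; exact h3

lemma addable_far {n : ℕ} {x : ℕ → ℕ} {p q : ℕ} (hne : p ≠ q) (hp : Addable n x p)
    (hq : Addable n x q) : p + 2 ≤ q ∨ q + 2 ≤ p := by
  obtain ⟨h1, h2, h3⟩ := hp
  obtain ⟨k1, k2, k3⟩ := hq
  by_contra hc
  rcases (show q = p + 1 ∨ p = q + 1 by omega) with rfl | rfl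
  · simp at k2; omega
  · simp at h2; omega

variable [Fintype B] [DecidableEq B]

variable {M : CoxeterMatrix B} {n : ℕ} (P : PD M n) (cs : CoxeterSystem M W)

namespace PD

/-- paths in the lattice of slices -/
def Path : (ℕ → ℕ) → List B → (ℕ → ℕ) → Prop
  | x, [], y => x = y
  | x, c :: l, y => ∃ i, P.b i = c ∧ Addable n x i ∧ Path (stp x i) l y

variable {P}

lemma Path.append {x y z : ℕ → ℕ} {l m : List B} (h : P.Path x l y) (h' : P.Path y m z) :
    P.Path x (l ++ m) z := by
  induction l generalizing x with
  | nil => cases h; exact h'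
  | cons c l ih =>
    obtain ⟨i, h1, h2, h3⟩ := h
    exact ⟨i, h1, h2, ih h3⟩

lemma Path.split {x z : ℕ → ℕ} {l m : List B} (h : P.Path x (l ++ m) z) :
    ∃ y, P.Path x l y ∧ P.Path y m z := by
  induction l generalizing x with
  | nil => exact ⟨x, rfl, h⟩
  | cons c l ih =>
    obtain ⟨i, h1, h2, h3⟩ := h
    obtain ⟨y, h4, h5⟩ := ih h3
    exact ⟨y, ⟨i, h1, h2, h4⟩, h5⟩

lemma Path.slice {x y : ℕ → ℕ} {l : List B} (h : P.Path x l y) (hx : Slice n x) : Slice n y := by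
  induction l generalizing x with
  | nil => cases h; exact hx
  | cons c l ih =>
    obtain ⟨i, h1, h2, h3⟩ := h
    exact ih h3 (hx.stp h2)

lemma Path.count {x y : ℕ → ℕ} {l : List B} (h : P.Path x l y) (i : ℕ) (hi : 1 ≤ i) (hi' : i ≤ n) :
    y i = x i + l.count (P.b i) := by
  induction l generalizing x with
  | nil => cases h; simp
  | cons c l ih =>
    obtain ⟨j, h1, h2, h3⟩ := h
    rw [ih h3, ← h1, List.count_cons, stp_apply]
    by_cases hj : i = j
    · subst hj; simp; omega
    · have : P.b j ≠ P.b i := fun hh => hj (P.inj _ _ h2.1.1 h2.1.2 hi hi' hh).symm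
      simp [hj, this]

lemma Path.comm_step {x y : ℕ → ℕ} {l m : List B} (h : P.Path x l y) (hc : CommStep M l m) :
    P.Path x m y := by
  obtain ⟨u, v, s, t, hst, rfl, rfl⟩ := hc
  obtain ⟨z, h1, h2⟩ := h.split
  refine h1.append ?_
  obtain ⟨p, rfl, hp, q, rfl, hq, h3⟩ := h2
  have hpq : p + 2 ≤ q ∨ q + 2 ≤ p := by
    by_contra hc
    rcases (show p = q ∨ q = p + 1 ∨ p = q + 1 by omega) with rfl | rfl | rfl
    · simp at hst
    · exact P.ncomm p hp.1.1 (by have := hq.1.2; omega) hst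
    · rw [M.symmetric] at hst
      exact P.ncomm q hq.1.1 (by have := hp.1.2; omega) hst
  refine ⟨q, rfl, addable_swap hpq hq, p, rfl, addable_swap' hpq.symm hp, ?_⟩
  rw [stp_comm _ _ _ (by omega)]
  exact h3

lemma Path.comm_equiv {x y : ℕ → ℕ} {l m : List B} (h : P.Path x l y) (hc : CommEquiv M l m) :
    P.Path x m y := by
  induction hc with
  | refl => exact h
  | tail _ h2 ih => exact ih.comm_step h2

lemma far_two {p q : ℕ} (h : p + 2 ≤ q ∨ q + 2 ≤ p) (hp : 1 ≤ p ∧ p ≤ n) (hq : 1 ≤ q ∧ q ≤ n) :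
    M (P.b p) (P.b q) = 2 := by
  rcases h with h | h
  · exact P.comm _ _ hp.1 hq.2 h
  · rw [M.symmetric]; exact P.comm _ _ hq.1 hp.2 h

lemma Path.front {x y : ℕ → ℕ} {l : List B} {i : ℕ} (h : P.Path x l y) (hi : Addable n x i)
    (hl : P.b i ∈ l) : ∃ l', CommEquiv M l (P.b i :: l') := by
  induction l generalizing x with
  | nil => simp at hl
  | cons c l ih =>
    obtain ⟨j, rfl, h2, h3⟩ := h
    by_cases hij : j = i
    · subst hij; exact ⟨l, Relation.ReflTransGen.refl⟩
    · have hf := addable_far hij h2 hi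
      have hb : P.b i ∈ l := by
        rcases List.mem_cons.1 hl with h | h
        · exact absurd (P.inj _ _ hi.1.1 hi.1.2 h2.1.1 h2.1.2 h).symm hij
        · exact h
      obtain ⟨l', hl'⟩ := ih h3 (addable_swap' hf hi) hb
      exact ⟨P.b j :: l', (hl'.cons _).tail ⟨[], l', _, _, far_two hf h2.1 hi.1, rfl, rfl⟩⟩

lemma Path.first {x y : ℕ → ℕ} {l : List B} {i : ℕ} (h : P.Path x (P.b i :: l) y)
    (hi : 1 ≤ i) (hi' : i ≤ n) : Addable n x i ∧ P.Path (stp x i) l y := by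
  obtain ⟨j, h1, h2, h3⟩ := h
  obtain rfl := P.inj _ _ h2.1.1 h2.1.2 hi hi' h1
  exact ⟨h2, h3⟩

lemma Path.equiv {x y : ℕ → ℕ} {l l' : List B} (h : P.Path x l y) (h' : P.Path x l' y) :
    CommEquiv M l' l := by
  induction l generalizing x l' with
  | nil =>
    cases h
    cases l' with
    | nil => exact Relation.ReflTransGen.refl
    | cons c l' =>
      obtain ⟨i, rfl, h2, h3⟩ := h'
      have := h3.count i h2.1.1 h2.1.2
      rw [stp_self] at this
      omega
  | cons c l ih =>
    have hh := h
    obtain ⟨i, rfl, h2, h3⟩ := h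
    have c1 := hh.count i h2.1.1 h2.1.2
    have c2 := h'.count i h2.1.1 h2.1.2
    rw [List.count_cons_self] at c1
    have hm : P.b i ∈ l' := List.count_pos_iff.1 (by omega)
    obtain ⟨m, hm⟩ := h'.front h2 hm
    have := (h'.comm_equiv hm).first h2.1.1 h2.1.2
    exact hm.trans ((ih h3 this.2).cons _)

lemma path_exists {y : ℕ → ℕ} (hy : Slice n y) (N : ℕ) : ∀ x, Slice n x → (∀ i, x i ≤ y i) →
    ∑ i ∈ Finset.Icc 1 n, (y i - x i) ≤ N → ∃ l, P.Path x l y := by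
  induction N with
  | zero =>
    intro x hx hxy h
    refine ⟨[], ?_⟩
    funext i
    by_cases hi : 1 ≤ i ∧ i ≤ n
    · have := Finset.sum_eq_zero_iff.1 (Nat.le_zero.1 h) i (Finset.mem_Icc.2 hi)
      have := hxy i
      omega
    · rw [hx.1 i (by omega), hy.1 i (by omega)]
  | succ N ih =>
    intro x hx hxy h
    by_cases hne : ((Finset.Icc 1 n).filter (fun i => x i < y i)).Nonempty
    · obtain ⟨i, hi, hmin⟩ := Finset.exists_min_image _ (fun i => x i * (n + 1) + i) hne
      simp only [Finset.mem_filter, Finset.mem_Icc] at hi hmin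
      have hadd : Addable n x i := by
        refine ⟨hi.1, ?_, ?_⟩
        · by_contra hc
          push Not at hc
          have s1 := hx.2 (i - 1) (by omega) (by omega)
          have s2 := hy.2 (i - 1) (by omega) (by omega)
          rw [show i - 1 + 1 = i by omega] at s1 s2
          have e : x (i - 1) = x i := by omega
          have := hmin (i - 1) ⟨by omega, by omega⟩
          rw [e] at this
          omega
        · by_contra hc
          push Not at hc
          have s1 := hx.2 i (by omega) (by omega)
          have s2 := hy.2 i (by omega) (by omega)
          have e : x i = x (i + 1) + 1 := by omega
          have := hmin (i + 1) ⟨by omega, by omega⟩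
          rw [e, add_mul] at this
          omega
      have hsum : ∑ j ∈ Finset.Icc 1 n, (y j - stp x i j) <
          ∑ j ∈ Finset.Icc 1 n, (y j - x j) := by
        apply Finset.sum_lt_sum
        · intro j _
          rw [stp_apply]
          split_ifs with e
          · subst e; omega
          · omega
        · exact ⟨i, Finset.mem_Icc.2 hi.1, by rw [stp_self]; omega⟩
      obtain ⟨l, hl⟩ := ih (stp x i) (hx.stp hadd) (by
        intro j
        rw [stp_apply]
        split_ifs with e
        · subst e; omega
        · exact hxy j) (by omega)
      exact ⟨P.b i :: l, i, rfl, hadd, hl⟩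
    · refine ⟨[], ?_⟩
      funext i
      by_cases hi : 1 ≤ i ∧ i ≤ n
      · rw [Finset.not_nonempty_iff_eq_empty] at hne
        have := Finset.filter_eq_empty_iff.1 hne (Finset.mem_Icc.2 hi)
        have := hxy i
        omega
      · rw [hx.1 i (by omega), hy.1 i (by omega)]

lemma path_ex {x y : ℕ → ℕ} (hx : Slice n x) (hy : Slice n y) (h : ∀ i, x i ≤ y i) :
    ∃ l, P.Path x l y := path_exists hy _ x hx h le_rfl

lemma Path.le {x y : ℕ → ℕ} {l : List B} (h : P.Path x l y) (hx : Slice n x) (i : ℕ) : x i ≤ y i := by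
  by_cases hi : 1 ≤ i ∧ i ≤ n
  · have := h.count i hi.1 hi.2; omega
  · rw [hx.1 i (by omega)]; omega

variable (P)

/-- `p` has profile `x` -/
def HasProf (p : W) (x : ℕ → ℕ) : Prop := ∀ i, 1 ≤ i → i ≤ n →
  geo cs p (sr (P.b i)) = P.ro cs i (x i)
    - (if x (i - 1) = x i then P.C (i - 1) • P.ro cs (i - 1) (x (i - 1)) else 0)
    - (if x (i + 1) + 1 = x i then P.C i • P.ro cs (i + 1) (x (i + 1)) else 0)

variable {P cs}

lemma prof_zero : P.HasProf cs 1 (fun _ => 0) := by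
  intro i hi hi'
  obtain ⟨i, rfl⟩ : ∃ j, i = j + 1 := ⟨i - 1, by omega⟩
  simp [ro_zero, be_succ]

lemma prof_addable {p : W} {x : ℕ → ℕ} {i : ℕ} (h : P.HasProf cs p x) (hi : Addable n x i) :
    geo cs p (sr (P.b i)) = P.ro cs i (x i) := by
  rw [h i hi.1.1 hi.1.2]
  obtain ⟨h1, h2, h3⟩ := hi
  have e1 : (if x (i - 1) = x i then P.C (i - 1) • P.ro cs (i - 1) (x (i - 1)) else 0) = 0 := by
    rcases h2 with rfl | h2
    · simp [P.C0]
    · rw [if_neg (by omega)]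
  have e2 : (if x (i + 1) + 1 = x i then P.C i • P.ro cs (i + 1) (x (i + 1)) else 0) = 0 := by
    rcases h3 with rfl | h3
    · simp [P.Cn]
    · rw [if_neg (by omega)]
  rw [e1, e2]; simp

lemma prof_step {p : W} {x : ℕ → ℕ} {i : ℕ} (h : P.HasProf cs p x) (hi : Addable n x i) :
    P.HasProf cs (p * cs.simple (P.b i)) (stp x i) := by
  have ha := prof_addable h hi
  obtain ⟨h1, h2, h3⟩ := hi
  intro j hj hj'
  rw [map_mul, Module.End.mul_apply, geo_simple]
  by_cases e1 : j = i
  · subst e1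
    rw [rf_sr_self, map_neg, ha, stp_self, stp_ne _ _ _ (by omega), stp_ne _ _ _ (by omega)]
    obtain ⟨j, rfl⟩ : ∃ k, j = k + 1 := ⟨j - 1, by omega⟩
    have hm := P.mesh cs j (x (j + 1)) hj'
    simp only [Nat.add_sub_cancel] at h2 ⊢
    have e1 : (if x j = x (j + 1) + 1 then P.C j • P.ro cs j (x j) else 0) =
        P.C j • P.ro cs j (x (j + 1) + 1) := by
      rcases h2 with h2 | h2
      · obtain rfl : j = 0 := by omega
        simp [P.C0]
      · rw [if_pos h2, h2]
    have e2 : (if x (j + 1 + 1) + 1 = x (j + 1) + 1 then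
        P.C (j + 1) • P.ro cs (j + 1 + 1) (x (j + 1 + 1)) else 0) =
        P.C (j + 1) • P.ro cs (j + 2) (x (j + 1)) := by
      rcases h3 with h3 | h3
      · rw [h3, P.Cn]; simp
      · rw [if_pos (by omega), h3]
    rw [e1, e2]
    have : P.ro cs (j + 1) (x (j + 1) + 1) = P.C (j + 1) • P.ro cs (j + 2) (x (j + 1)) +
      P.C j • P.ro cs j (x (j + 1) + 1) - P.ro cs (j + 1) (x (j + 1)) := by rw [← hm]; abel
    rw [this]; abel
  by_cases e2 : j = i + 1
  · subst e2
    have h3' : x (i + 1) = x i := by omega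
    rw [P.rf_up i (by omega) (by omega), map_add, map_smul, ha, h (i + 1) hj hj']
    simp only [Nat.add_sub_cancel]
    rw [stp_self, stp_ne _ _ (i + 1) (by omega), stp_ne _ _ (i + 1 + 1) (by omega), if_pos h3'.symm,
      if_neg (show ¬ (x i + 1 = x (i + 1)) by omega)]
    abel
  by_cases e3 : i = j + 1
  · subst e3
    simp only [Nat.add_sub_cancel] at h2
    have h2' : x j = x (j + 1) + 1 := by omega
    rw [P.rf_down j (by omega) (by omega), map_add, map_smul, ha, h j hj hj']
    rw [stp_self, stp_ne _ _ j (by omega), stp_ne _ _ (j - 1) (by omega), if_pos h2'.symm,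
      if_neg (show ¬ (x (j + 1) + 1 + 1 = x j) by omega)]
    abel
  rw [P.rf_far i j h1.1 h1.2 hj hj' (by omega), h j hj hj', stp_ne _ _ j (by omega),
    stp_ne _ _ (j - 1) (by omega), stp_ne _ _ (j + 1) (by omega)]

lemma prof_unique (hM : ∀ i j, M i j ≠ 0) {p q : W} {x : ℕ → ℕ} (hp : P.HasProf cs p x) (hq : P.HasProf cs q x) : p = q := by
  apply geo_faithful cs hM
  intro c
  obtain ⟨i, h1, h2, rfl⟩ := P.surj c
  rw [hp i h1 h2, hq i h1 h2]

lemma not_desc_of (hM : ∀ i j, M i j ≠ 0) {w : W} {c : B} (h : 0 ≤ geo cs w (sr c)) :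
    ¬ cs.IsRightDescent w c := by
  intro hd
  exact root_ne_zero cs w c (le_antisymm (root_neg cs hM w c hd) h)

lemma Path.prof (hM : ∀ i j, M i j ≠ 0) {x y : ℕ → ℕ} {l : List B} (h : P.Path x l y)
    (hy : ∀ i, 1 ≤ i → i ≤ n → y i ≤ P.a cs i) {p : W} (hp : P.HasProf cs p x) :
    P.HasProf cs (p * cs.wordProd l) y ∧ cs.length (p * cs.wordProd l) = cs.length p + l.length := by
  induction l generalizing x p with
  | nil => cases h; simpa using hp
  | cons c l ih =>
    obtain ⟨i, rfl, h2, h3⟩ := h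
    have hd : ¬ cs.IsRightDescent p (P.b i) := by
      apply not_desc_of hM
      rw [prof_addable hp h2]
      apply a_lt hM _ _ h2.1.1 h2.1.2
      have := h3.count i h2.1.1 h2.1.2
      rw [stp_self] at this
      have := hy i h2.1.1 h2.1.2
      omega
    have hl := cs.not_isRightDescent_iff.1 hd
    have := ih h3 (prof_step hp h2)
    rw [cs.wordProd_cons, ← mul_assoc]
    refine ⟨this.1, ?_⟩
    rw [this.2, hl, List.length_cons]
    omega

lemma Path.red (hM : ∀ i j, M i j ≠ 0) {x : ℕ → ℕ} {l : List B} (h : P.Path (fun _ => 0) l x)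
    (hy : ∀ i, 1 ≤ i → i ≤ n → x i ≤ P.a cs i) :
    P.HasProf cs (cs.wordProd l) x ∧ cs.IsReduced l := by
  have := h.prof hM hy (prof_zero (P := P) (cs := cs))
  rw [one_mul, cs.length_one, zero_add] at this
  exact this

lemma geo_avoid (c : B) (l : List B) (h : c ∉ l) (v : B → ℝ) :
    geo cs (cs.wordProd l) v c = v c := by
  induction l with
  | nil => simp
  | cons d l ih =>
    rw [cs.wordProd_cons, map_mul, Module.End.mul_apply, geo_simple, rf_apply]
    simp only [List.mem_cons, not_or] at h
    rw [Pi.sub_apply, ih h.2]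
    simp [sr, h.1]

lemma avoid_not_desc (hM : ∀ i j, M i j ≠ 0) (c : B) (l : List B) (h : c ∉ l) :
    ¬ cs.IsLeftDescent (cs.wordProd l) c := by
  rw [← cs.isRightDescent_inv_iff, ← cs.wordProd_reverse, desc_iff cs hM]
  intro h1
  have := h1 c
  rw [geo_avoid c _ (by simpa using h)] at this
  simp [sr] at this
  linarith

lemma longest_unique (hM : ∀ i j, M i j ≠ 0) (w₀ p : W) (hw₀ : ∀ v : W, cs.length v ≤ cs.length w₀)
    (hp : ∀ c, geo cs p (sr c) ≤ 0) : p = w₀ := by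
  have hd : ∀ c, geo cs w₀⁻¹ (sr c) ≤ 0 := by
    intro c
    apply root_neg cs hM
    unfold CoxeterSystem.IsRightDescent
    have h1 := hw₀ (w₀⁻¹ * cs.simple c)
    rw [← cs.length_inv w₀] at h1
    exact lt_of_le_of_ne h1 (cs.length_mul_simple_ne _ _)
  have h1 : w₀⁻¹ * p = 1 := by
    by_contra hne
    obtain ⟨t, ht⟩ := cs.exists_rightDescent_of_ne_one hne
    refine not_desc_of hM ?_ ht
    rw [map_mul, Module.End.mul_apply, sr_sum (geo cs p (sr t)), map_sum]
    apply Finset.sum_nonneg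
    intro c _
    rw [map_smul]
    exact smul_nonneg_of_nonpos_of_nonpos (hp t c) (hd c)
  exact (inv_mul_eq_one.1 h1).symm

/-- the final profile -/
noncomputable def fin (P : PD M n) (cs : CoxeterSystem M W) : ℕ → ℕ :=
  fun i => if 1 ≤ i ∧ i ≤ n then P.a cs i else 0

lemma fin_apply (i : ℕ) (hi : 1 ≤ i) (hi' : i ≤ n) : P.fin cs i = P.a cs i := by
  simp [fin, hi, hi']

lemma fin_slice [Finite W] (hM : ∀ i j, M i j ≠ 0) (hn : 1 < n) : Slice n (P.fin cs) := by
  constructor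
  · intro i hi
    simp only [fin]
    rw [if_neg (by omega)]
  · intro i hi hi'
    rw [fin_apply i hi (by omega), fin_apply (i + 1) (by omega) (by omega)]
    rcases struct hM (P := P) (cs := cs) hn with ⟨N, _, _, h⟩ | ⟨A, _, _, h⟩
    · rw [(h i (by omega) (by omega)).1, (h (i + 1) (by omega) (by omega)).1]; omega
    · rw [(h i (by omega) (by omega)).1, (h (i + 1) (by omega) (by omega)).1]; omega

lemma fin_neg [Finite W] (hM : ∀ i j, M i j ≠ 0) (hn : 1 < n) {p : W} (hp : P.HasProf cs p (P.fin cs)) (c : B) :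
    geo cs p (sr c) ≤ 0 := by
  obtain ⟨i, hi, hi', rfl⟩ := P.surj c
  have hr : IsRoot cs (geo cs p (sr (P.b i))) := ⟨p, P.b i, rfl⟩
  have hf := fin_apply (P := P) (cs := cs)
  rcases struct hM (P := P) (cs := cs) hn with ⟨N, hN, _, h⟩ | ⟨A, _, _, h⟩
  · apply hr.nonpos cs hM (P.b i)
    rw [hp i hi hi', hf i hi hi']
    have e1 : (if P.fin cs (i - 1) = P.a cs i then P.C (i - 1) • P.ro cs (i - 1) (P.fin cs (i - 1))
        else 0) (P.b i) = 0 := by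
      rcases hi.lt_or_eq with h1 | h1
      · have := (h (i - 1) (by omega) (by omega))
        rw [hf _ (by omega) (by omega), this.2]
        split_ifs
        · simp [P.be_tri (i - 1) i (by omega) hi']
        · rfl
      · rw [← h1]; simp [P.C0]
    have e2 : (if P.fin cs (i + 1) + 1 = P.a cs i then P.C i • P.ro cs (i + 1) (P.fin cs (i + 1))
        else 0) (P.b i) = 0 := by
      rcases hi'.lt_or_eq with h1 | h1
      · have := (h (i + 1) (by omega) (by omega)).1
        have := (h i (by omega) (by omega)).1
        rw [hf _ (by omega) (by omega), if_neg (by omega)]; rfl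
      · rw [h1]; simp [P.Cn]
    rw [Pi.sub_apply, Pi.sub_apply, e1, e2, (h i hi hi').2, Pi.neg_apply, P.be_self i hi hi']
    norm_num
  · apply hr.nonpos cs hM (P.b (n + 1 - i))
    rw [hp i hi hi', hf i hi hi']
    have e1 : (if P.fin cs (i - 1) = P.a cs i then P.C (i - 1) • P.ro cs (i - 1) (P.fin cs (i - 1))
        else 0) (P.b (n + 1 - i)) = 0 := by
      rcases hi.lt_or_eq with h1 | h1
      · have := (h (i - 1) (by omega) (by omega)).1
        have := (h i (by omega) (by omega)).1
        rw [hf _ (by omega) (by omega), if_neg (by omega)]; rfl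
      · rw [← h1]; simp [P.C0]
    have e2 : (if P.fin cs (i + 1) + 1 = P.a cs i then P.C i • P.ro cs (i + 1) (P.fin cs (i + 1))
        else 0) (P.b (n + 1 - i)) = 0 := by
      rcases hi'.lt_or_eq with h1 | h1
      · have := (h (i + 1) (by omega) (by omega))
        rw [hf _ (by omega) (by omega), this.2]
        split_ifs
        · simp [P.be_tri (n - i) (n + 1 - i) (by omega) (by omega)]
        · rfl
      · rw [h1]; simp [P.Cn]
    rw [Pi.sub_apply, Pi.sub_apply, e1, e2, (h i hi hi').2, Pi.neg_apply,
      P.be_self (n + 1 - i) (by omega) (by omega)]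
    norm_num

end PD

end ProfPart

/-! ### Part 5 : the sorting word and the singletons -/

section SortPart

set_option linter.unusedSectionVars false

variable {B : Type*} {W : Type*} [Group W] [Fintype B] [DecidableEq B]

variable {M : CoxeterMatrix B} {n : ℕ} {P : PD M n} {cs : CoxeterSystem M W}

namespace PD



lemma prof_ex (hM : ∀ i j, M i j ≠ 0) {x : ℕ → ℕ} (hx : Slice n x) (hxa : ∀ i, 1 ≤ i → i ≤ n → x i ≤ P.a cs i) :
    ∃ l, P.Path (fun _ => 0) l x ∧ P.HasProf cs (cs.wordProd l) x ∧ cs.IsReduced l := by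
  obtain ⟨l, hl⟩ := path_ex (P := P) (x := fun _ => 0) (y := x) ⟨fun _ _ => rfl, by simp⟩ hx (by simp)
  exact ⟨l, hl, hl.red hM hxa⟩

lemma word_eq (hM : ∀ i j, M i j ≠ 0) {x y : ℕ → ℕ} (hx : Slice n x) (hya : ∀ i, 1 ≤ i → i ≤ n → y i ≤ P.a cs i)
    {l m : List B} (hl : P.Path x l y) (hm : P.Path x m y) : cs.wordProd l = cs.wordProd m := by
  obtain ⟨u, _, hu, _⟩ := prof_ex hM (cs := cs) hx (fun i h h' => (hl.le hx i).trans (hya i h h'))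
  have h1 := (hl.prof hM hya hu).1
  have h2 := (hm.prof hM hya hu).1
  exact mul_left_cancel (prof_unique hM h1 h2)

lemma word_red (hM : ∀ i j, M i j ≠ 0) {x y : ℕ → ℕ} (hx : Slice n x) (hya : ∀ i, 1 ≤ i → i ≤ n → y i ≤ P.a cs i)
    {l : List B} (hl : P.Path x l y) : cs.length (cs.wordProd l) = l.length := by
  obtain ⟨u, _, hu, _⟩ := prof_ex hM (cs := cs) hx (fun i h h' => (hl.le hx i).trans (hya i h h'))
  have h1 := (hl.prof hM hya hu).2
  have h2 := cs.length_mul_le (cs.wordProd u) (cs.wordProd l)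
  have h3 := cs.length_wordProd_le l
  omega

lemma prof_inj (hM : ∀ i j, M i j ≠ 0) {x y : ℕ → ℕ} (hx : Slice n x) (hxa : ∀ i, 1 ≤ i → i ≤ n → x i ≤ P.a cs i)
    (hy : Slice n y) (hya : ∀ i, 1 ≤ i → i ≤ n → y i ≤ P.a cs i) {w : W}
    (h1 : P.HasProf cs w x) (h2 : P.HasProf cs w y) : x = y := by
  have hz : Slice n (fun i => min (x i) (y i)) := by
    constructor
    · intro i hi
      simp [hx.1 i hi]
    · intro i hi hi'
      have := hx.2 i hi hi'
      have := hy.2 i hi hi'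
      dsimp only
      omega
  obtain ⟨l, hl⟩ := path_ex (P := P) hz hx (fun i => min_le_left _ _)
  obtain ⟨m, hm⟩ := path_ex (P := P) hz hy (fun i => min_le_right _ _)
  obtain ⟨u, _, hu, _⟩ := prof_ex hM (cs := cs) hz
    (fun i h h' => (min_le_left _ _).trans (hxa i h h'))
  have e1 := prof_unique hM (hl.prof hM hxa hu).1 h1
  have e2 := prof_unique hM (hm.prof hM hya hu).1 h2
  have e : cs.wordProd l = cs.wordProd m := mul_left_cancel (e1.trans e2.symm)
  have key : ∀ (l m : List B) (x y : ℕ → ℕ), P.Path (fun i => min (x i) (y i)) l x →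
      P.Path (fun i => min (x i) (y i)) m y → cs.wordProd l = cs.wordProd m →
      Slice n (fun i => min (x i) (y i)) → (∀ i, 1 ≤ i → i ≤ n → x i ≤ P.a cs i) →
      (fun i => min (x i) (y i)) = x := by
    intro l m x y hl hm e hz hxa
    cases l with
    | nil => exact hl
    | cons c l =>
      exfalso
      have hl' := hl
      obtain ⟨i, rfl, hi, hl2⟩ := hl'
      have c1 := hl.count i hi.1.1 hi.1.2
      have c2 := hm.count i hi.1.1 hi.1.2
      rw [List.count_cons_self] at c1
      have hnm : P.b i ∉ m := by
        intro hmem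
        have := List.count_pos_iff.2 hmem
        omega
      apply avoid_not_desc (cs := cs) hM (P.b i) m hnm
      rw [← e]
      unfold CoxeterSystem.IsLeftDescent
      rw [word_red hM hz hxa hl, cs.wordProd_cons, cs.simple_mul_simple_cancel_left]
      have := cs.length_wordProd_le l
      simp only [List.length_cons]
      omega
  have k1 := key l m x y hl hm e hz hxa
  have k2 := key m l y x (by simpa only [min_comm] using hm) (by simpa only [min_comm] using hl)
    e.symm (by simpa only [min_comm] using hz) hya
  rw [← k1]
  conv_rhs => rw [← k2]
  funext i
  exact min_comm _ _

/-- the tail of the Coxeter word -/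
def wd (P : PD M n) (i : ℕ) : List B := (List.range' (i + 1) (n - i)).map P.b

lemma wd_n : P.wd n = [] := by simp [wd]

lemma wd_lt (i : ℕ) (h : i < n) : P.wd i = P.b (i + 1) :: P.wd (i + 1) := by
  rw [wd, show n - i = (n - (i + 1)) + 1 by omega, List.range'_succ]
  rfl


lemma fin_le (i : ℕ) (hi : 1 ≤ i) (hi' : i ≤ n) : P.fin cs i ≤ P.a cs i := by
  rw [fin_apply i hi hi']


lemma sort_path [Finite W] (hM : ∀ i j, M i j ≠ 0) (hn : 1 < n) (K : ℕ) (hK : ∀ j, 1 ≤ j → j ≤ n → P.a cs j ≤ K) (f : ℕ) :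
    ∀ (k i : ℕ) (x : ℕ → ℕ) (l : List B), i ≤ n → Slice n x →
      (∀ j, 1 ≤ j → j ≤ n → x j = if j ≤ i then min (k + 1) (P.a cs j) else min k (P.a cs j)) →
      P.Path x l (P.fin cs) → K * (n + 1) ≤ f + i + k * (n + 1) →
      P.Path x (sortAux cs (P.wd 0) f (P.wd i) (cs.wordProd l)) (P.fin cs) := by
  have hfs := fin_slice hM (P := P) (cs := cs) hn
  have hfl := fin_le (P := P) (cs := cs)
  induction f with
  | zero =>
    intro k i x l hi hx hxk hl hf
    have hk : K ≤ k := by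
      by_contra hc
      have := Nat.mul_le_mul_right (n + 1) (show k + 1 ≤ K by omega)
      rw [add_mul] at this
      omega
    show x = P.fin cs
    funext j
    by_cases hj : 1 ≤ j ∧ j ≤ n
    · have := hK j hj.1 hj.2
      rw [hxk j hj.1 hj.2, fin_apply j hj.1 hj.2]
      split_ifs <;> omega
    · rw [hx.1 j (by omega), hfs.1 j (by omega)]
  | succ f ih =>
    intro k i x l hi hx hxk hl hf
    rcases hi.lt_or_eq with hi | rfl
    · rw [wd_lt i hi, sortAux]
      have hxi := hxk (i + 1) (by omega) (by omega)
      rw [if_neg (by omega)] at hxi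
      by_cases hlt : x (i + 1) < P.a cs (i + 1)
      · have hadd : Addable n x (i + 1) := by
          refine ⟨by omega, ?_, ?_⟩
          · by_cases h0 : i = 0
            · left; omega
            · right
              have h1 := hxk i (by omega) (by omega)
              have h2 := hfs.2 i (by omega) (by omega)
              rw [fin_apply i (by omega) (by omega), fin_apply (i + 1) (by omega) (by omega)] at h2
              rw [if_pos le_rfl] at h1
              simp only [Nat.add_sub_cancel]
              omega
          · by_cases h0 : i + 1 = n
            · left; exact h0
            · right
              have h1 := hxk (i + 1 + 1) (by omega) (by omega)
              have h2 := hfs.2 (i + 1) (by omega) (by omega)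
              rw [fin_apply (i + 1 + 1) (by omega) (by omega),
                fin_apply (i + 1) (by omega) (by omega)] at h2
              rw [if_neg (by omega)] at h1
              omega
        obtain ⟨m, hm⟩ := path_ex (P := P) (hx.stp hadd) hfs (by
          intro j
          rw [stp_apply]
          split_ifs with e
          · subst e
            rw [fin_apply (i + 1) (by omega) (by omega)]; omega
          · exact hl.le hx j)
        have hm2 : P.Path x (P.b (i + 1) :: m) (P.fin cs) := ⟨i + 1, rfl, hadd, hm⟩
        have e := word_eq hM hx hfl hl hm2
        have hr := word_red hM (cs := cs) hx hfl hm2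
        have hr2 := word_red hM (cs := cs) (hx.stp hadd) hfl hm
        have e2 : cs.simple (P.b (i + 1)) * cs.wordProd l = cs.wordProd m := by
          rw [e, cs.wordProd_cons, cs.simple_mul_simple_cancel_left]
        rw [if_pos (by rw [e2, hr2, e, hr, List.length_cons]; omega), e2]
        refine ⟨i + 1, rfl, hadd, ?_⟩
        apply ih k (i + 1) _ m (by omega) (hx.stp hadd) _ hm (by omega)
        intro j hj hj'
        rw [stp_apply]
        by_cases e : j = i + 1
        · subst e
          rw [if_pos rfl, if_pos le_rfl]
          omega
        · rw [if_neg e, hxk j hj hj']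
          split_ifs <;> omega
      · have hc := hl.count (i + 1) (by omega) (by omega)
        rw [fin_apply (i + 1) (by omega) (by omega)] at hc
        have hnm : P.b (i + 1) ∉ l := by
          intro hmem
          have := List.count_pos_iff.2 hmem
          omega
        have hnd : ¬ cs.length (cs.simple (P.b (i + 1)) * cs.wordProd l) <
            cs.length (cs.wordProd l) := avoid_not_desc (cs := cs) hM _ l hnm
        rw [if_neg hnd]
        apply ih k (i + 1) _ l (by omega) hx _ hl (by omega)
        intro j hj hj'
        rw [hxk j hj hj']
        by_cases e : j = i + 1
        · subst e
          rw [if_neg (by omega), if_pos le_rfl]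
          omega
        · split_ifs <;> omega
    · rw [wd_n, sortAux]
      apply ih (k + 1) 0 x l (by omega) hx _ hl (by rw [add_mul]; omega)
      intro j hj hj'
      rw [hxk j hj hj', if_pos hj', if_neg (by omega)]

lemma sorting_path [Finite W] (hM : ∀ i j, M i j ≠ 0) (hn : 1 < n) (w₀ : W) (hw₀ : ∀ v : W, cs.length v ≤ cs.length w₀) :
    P.Path (fun _ => 0) (sortingWord cs (P.wd 0) w₀) (P.fin cs) := by
  have hfs := fin_slice hM (P := P) (cs := cs) hn
  have hfl := fin_le (P := P) (cs := cs)
  obtain ⟨l, hl, hp, hr⟩ := prof_ex hM (cs := cs) (P := P) hfs hfl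
  have hw : cs.wordProd l = w₀ := longest_unique hM w₀ _ hw₀ (fin_neg hM hn hp)
  have hlen : cs.length w₀ = l.length := by rw [← hw]; exact hr
  rw [sortingWord, ← hw]
  apply sort_path hM hn (l.length + 1) _ _ 0 0 _ l (by omega) ⟨fun _ _ => rfl, by simp⟩ _ hl
  · rw [hw, hlen]
    simp [wd]
  · intro j hj hj'
    have := hl.count j hj hj'
    rw [fin_apply j hj hj'] at this
    have := List.count_le_length (a := P.b j) (l := l)
    omega
  · intro j hj hj'
    rw [if_neg (by omega)]; simp

lemma singleton_iff [Finite W] (hM : ∀ i j, M i j ≠ 0) (hn : 1 < n) (w₀ : W) (hw₀ : ∀ v : W, cs.length v ≤ cs.length w₀) (w : W) :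
    IsCSingleton cs (P.wd 0) w₀ w ↔
      ∃ x, (Slice n x ∧ ∀ i, x i ≤ P.fin cs i) ∧ P.HasProf cs w x := by
  have hfs := fin_slice hM (P := P) (cs := cs) hn
  have hfl := fin_le (P := P) (cs := cs)
  have hs := sorting_path hM hn (P := P) w₀ hw₀
  have hz : Slice n (fun _ => 0) := ⟨fun _ _ => rfl, by simp⟩
  constructor
  · rintro ⟨u, rfl, hu, v, hv, m, rfl⟩
    have h1 := hs.comm_equiv hv
    obtain ⟨y, hy1, hy2⟩ := h1.split
    have hys := hy1.slice hz
    exact ⟨y, ⟨hys, hy2.le hys⟩,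
      (hy1.red hM (fun i h h' => (hy2.le hys i).trans (hfl i h h'))).1⟩
  · rintro ⟨x, ⟨hx, hxf⟩, hw⟩
    obtain ⟨l, hl, hp, hr⟩ := prof_ex hM (cs := cs) (P := P) hx
      (fun i h h' => (hxf i).trans (hfl i h h'))
    obtain ⟨m, hm⟩ := path_ex (P := P) hx hfs hxf
    refine ⟨l, prof_unique hM hp hw, hr, l ++ m, ?_, m, rfl⟩
    exact (hl.append hm).equiv hs

lemma num_eq [Finite W] (hM : ∀ i j, M i j ≠ 0) (hn : 1 < n) (w₀ : W) (hw₀ : ∀ v : W, cs.length v ≤ cs.length w₀) :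
    numSingletons cs (P.wd 0) w₀ = Nat.card {x : ℕ → ℕ // Slice n x ∧ ∀ i, x i ≤ P.fin cs i} := by
  have hfl := fin_le (P := P) (cs := cs)
  have hx : ∀ x : {x : ℕ → ℕ // Slice n x ∧ ∀ i, x i ≤ P.fin cs i}, ∃ w, P.HasProf cs w x.1 := by
    rintro ⟨x, hx, hxf⟩
    obtain ⟨l, hl, hp, hr⟩ := prof_ex hM (cs := cs) (P := P) hx
      (fun i h h' => (hxf i).trans (hfl i h h'))
    exact ⟨_, hp⟩
  choose g hg using hx
  symm
  apply Nat.card_congr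
  refine Equiv.ofBijective (fun x => ⟨g x, (singleton_iff hM hn w₀ hw₀ _).2 ⟨x.1, x.2, hg x⟩⟩) ⟨?_, ?_⟩
  · intro x y hxy
    simp only [Subtype.mk.injEq] at hxy
    have h1 := hg x
    rw [hxy] at h1
    exact Subtype.ext (prof_inj hM x.2.1 (fun i h h' => (x.2.2 i).trans (hfl i h h'))
      y.2.1 (fun i h h' => (y.2.2 i).trans (hfl i h h')) h1 (hg y))
  · rintro ⟨w, hw⟩
    obtain ⟨x, hx, hp⟩ := (singleton_iff hM hn w₀ hw₀ _).1 hw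
    exact ⟨⟨x, hx⟩, Subtype.ext (prof_unique hM (hg ⟨x, hx⟩) hp)⟩

end PD

end SortPart

/-! ### Part 6 : counting slices -/

section CountPart

/-- number of descents at or after `i` -/
def tl (D : Finset ℕ) (i : ℕ) : ℕ := (D.filter (fun j => i ≤ j)).card

lemma tl_succ (D : Finset ℕ) (i : ℕ) : tl D i = tl D (i + 1) + if i ∈ D then 1 else 0 := by
  unfold tl
  split_ifs with h
  · rw [← Finset.card_insert_of_notMem (a := i) (by simp)]
    congr 1
    ext j
    simp only [Finset.mem_filter, Finset.mem_insert]
    constructor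
    · rintro ⟨a, b⟩
      by_cases hh : j = i
      · exact Or.inl hh
      · exact Or.inr ⟨a, by omega⟩
    · rintro (rfl | ⟨a, b⟩)
      · exact ⟨h, le_rfl⟩
      · exact ⟨a, by omega⟩
  · rw [add_zero]
    congr 1
    ext j
    simp only [Finset.mem_filter]
    constructor
    · rintro ⟨a, b⟩
      refine ⟨a, ?_⟩
      by_contra hc
      obtain rfl : i = j := by omega
      exact h a
    · rintro ⟨a, b⟩
      exact ⟨a, by omega⟩

lemma tl_n (D : Finset ℕ) (n : ℕ) (hD : D ⊆ Finset.Ico 1 n) : tl D n = 0 := by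
  rw [tl, Finset.card_eq_zero, Finset.filter_eq_empty_iff]
  intro j hj
  have := Finset.mem_Ico.1 (hD hj)
  omega

lemma tl_one (D : Finset ℕ) (n : ℕ) (hD : D ⊆ Finset.Ico 1 n) : tl D 1 = D.card := by
  rw [tl, Finset.filter_true_of_mem]
  intro j hj
  exact (Finset.mem_Ico.1 (hD hj)).1

lemma tl_le_card (D : Finset ℕ) (i : ℕ) : tl D i ≤ D.card := Finset.card_filter_le _ _

lemma tl_le (D : Finset ℕ) (n i : ℕ) (hD : D ⊆ Finset.Ico 1 n) : tl D i ≤ n - i := by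
  rw [tl, ← Nat.card_Ico]
  apply Finset.card_le_card
  intro j hj
  rw [Finset.mem_filter] at hj
  have := Finset.mem_Ico.1 (hD hj.1)
  rw [Finset.mem_Ico]
  omega

/-- the slice attached to a descent set -/
def mkx (n : ℕ) (D : Finset ℕ) (t : ℕ) : ℕ → ℕ := fun i => if 1 ≤ i ∧ i ≤ n then t + tl D i else 0

lemma mkx_apply (n : ℕ) (D : Finset ℕ) (t i : ℕ) (hi : 1 ≤ i) (hi' : i ≤ n) :
    mkx n D t i = t + tl D i := by simp [mkx, hi, hi']

lemma mkx_slice (n : ℕ) (D : Finset ℕ) (t : ℕ) : Slice n (mkx n D t) := by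
  constructor
  · intro i hi
    rw [mkx, if_neg (by omega)]
  · intro i hi hi'
    rw [mkx_apply _ _ _ _ hi (by omega), mkx_apply _ _ _ _ (by omega) (by omega), tl_succ D i]
    split_ifs <;> omega

lemma mkx_surj (n : ℕ) (x : ℕ → ℕ) (hx : Slice n x) :
    x = mkx n ((Finset.Ico 1 n).filter (fun i => x i = x (i + 1) + 1)) (x n) := by
  set D := (Finset.Ico 1 n).filter (fun i => x i = x (i + 1) + 1) with hD
  have hsub : D ⊆ Finset.Ico 1 n := Finset.filter_subset _ _
  have key : ∀ k i, 1 ≤ i → i + k = n → x i = x n + tl D i := by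
    intro k
    induction k with
    | zero =>
      intro i hi h
      obtain rfl : i = n := by omega
      rw [tl_n D i hsub]; rfl
    | succ k ih =>
      intro i hi h
      have h1 := ih (i + 1) (by omega) (by omega)
      have h2 := hx.2 i hi (by omega)
      rw [tl_succ D i]
      split_ifs with hm
      · rw [hD, Finset.mem_filter] at hm
        omega
      · rw [hD, Finset.mem_filter, Finset.mem_Ico] at hm
        have : ¬ (x i = x (i + 1) + 1) := fun hh => hm ⟨⟨hi, by omega⟩, hh⟩
        omega
  funext i
  by_cases hi : 1 ≤ i ∧ i ≤ n
  · rw [mkx_apply _ _ _ _ hi.1 hi.2]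
    exact key (n - i) i hi.1 (by omega)
  · rw [mkx, if_neg hi, hx.1 i (by omega)]

lemma mkx_inj (n : ℕ) (hn : 1 < n) (D D' : Finset ℕ) (t t' : ℕ) (hD : D ⊆ Finset.Ico 1 n)
    (hD' : D' ⊆ Finset.Ico 1 n) (h : mkx n D t = mkx n D' t') : D = D' ∧ t = t' := by
  have h1 : ∀ i, 1 ≤ i → i ≤ n → t + tl D i = t' + tl D' i := by
    intro i hi hi'
    rw [← mkx_apply n _ _ _ hi hi', h, mkx_apply n _ _ _ hi hi']
  have hm : ∀ i, 1 ≤ i → i < n → (i ∈ D ↔ i ∈ D') := by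
    intro i hi hi'
    have a1 := h1 i hi (by omega)
    have a2 := h1 (i + 1) (by omega) (by omega)
    rw [tl_succ D i, tl_succ D' i] at a1
    by_cases b1 : i ∈ D <;> by_cases b2 : i ∈ D' <;> simp [b1, b2] at a1 ⊢ <;> omega
  constructor
  · ext i
    constructor
    · intro hi
      have := Finset.mem_Ico.1 (hD hi)
      exact (hm i this.1 this.2).1 hi
    · intro hi
      have := Finset.mem_Ico.1 (hD' hi)
      exact (hm i this.1 this.2).2 hi
  · have := h1 n (by omega) le_rfl
    rw [tl_n D n hD, tl_n D' n hD'] at this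
    omega

lemma count_slices (n : ℕ) (hn : 1 < n) (F : ℕ → ℕ) (r : Finset ℕ → ℕ)
    (hr : ∀ D, D ⊆ Finset.Ico 1 n → ∀ t, t < r D ↔ ∀ i, 1 ≤ i → i ≤ n → t + tl D i ≤ F i) :
    Nat.card {x : ℕ → ℕ // Slice n x ∧ ∀ i, x i ≤ F i} =
      ∑ D ∈ (Finset.Ico 1 n).powerset, r D := by
  set S := (Finset.Ico 1 n).powerset.sigma (fun D => Finset.range (r D)) with hS
  have hmem : ∀ p : S, p.1.1 ⊆ Finset.Ico 1 n ∧ p.1.2 < r p.1.1 := by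
    rintro ⟨p, hp⟩
    rw [hS, Finset.mem_sigma, Finset.mem_powerset, Finset.mem_range] at hp
    exact hp
  have e : S ≃ {x : ℕ → ℕ // Slice n x ∧ ∀ i, x i ≤ F i} := by
    refine Equiv.ofBijective (fun p => ⟨mkx n p.1.1 p.1.2, mkx_slice _ _ _, ?_⟩) ⟨?_, ?_⟩
    · intro i
      by_cases hi : 1 ≤ i ∧ i ≤ n
      · rw [mkx_apply _ _ _ _ hi.1 hi.2]
        exact (hr _ (hmem p).1 _).1 (hmem p).2 i hi.1 hi.2
      · rw [mkx, if_neg hi]; exact Nat.zero_le _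
    · rintro ⟨⟨D, t⟩, h⟩ ⟨⟨D', t'⟩, h'⟩ hh
      simp only [Subtype.mk.injEq] at hh
      obtain ⟨rfl, rfl⟩ := mkx_inj n hn _ _ _ _ (hmem ⟨_, h⟩).1 (hmem ⟨_, h'⟩).1 hh
      rfl
    · rintro ⟨x, hx, hxF⟩
      have h1 := mkx_surj n x hx
      refine ⟨⟨⟨(Finset.Ico 1 n).filter (fun i => x i = x (i + 1) + 1), x n⟩, ?_⟩, ?_⟩
      · rw [hS, Finset.mem_sigma, Finset.mem_powerset, Finset.mem_range]
        refine ⟨Finset.filter_subset _ _, (hr _ (Finset.filter_subset _ _) _).2 ?_⟩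
        intro i hi hi'
        dsimp only
        rw [← mkx_apply n _ _ i hi hi', ← h1]
        exact hxF i
      · exact Subtype.ext h1.symm
  rw [← Nat.card_congr e, Nat.card_eq_fintype_card, Fintype.card_coe, hS, Finset.card_sigma]
  simp

lemma sum_card_pow (s : Finset ℕ) : ∑ D ∈ s.powerset, D.card = s.card * 2 ^ (s.card - 1) := by
  rw [Finset.sum_powerset_apply_card (fun k => k), ← Nat.sum_range_mul_choose]
  apply Finset.sum_congr rfl
  intro i _
  simp [mul_comm]

lemma count_one (n N : ℕ) (hn : 1 < n) (hN : n ≤ N) (F : ℕ → ℕ) (hF : ∀ i, 1 ≤ i → i ≤ n → F i = N) :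
    (Nat.card {x : ℕ → ℕ // Slice n x ∧ ∀ i, x i ≤ F i} : ℤ) =
      2 ^ (n - 2) * (((2 * N : ℕ) : ℤ) - n + 3) := by
  rw [count_slices n hn F (fun D => N + 1 - D.card)]
  · obtain ⟨m, rfl⟩ : ∃ m, n = m + 2 := ⟨n - 2, by omega⟩
    have h1 : ∀ D ∈ (Finset.Ico 1 (m + 2)).powerset, ((N + 1 - D.card : ℕ) : ℤ) = (N + 1) - (D.card : ℤ) := by
      intro D hD
      have := Finset.card_le_card (Finset.mem_powerset.1 hD)
      rw [Nat.card_Ico] at this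
      omega
    have h2 := sum_card_pow (Finset.Ico 1 (m + 2))
    rw [Nat.card_Ico] at h2
    have h3 : (∑ D ∈ (Finset.Ico 1 (m + 2)).powerset, (D.card : ℤ)) = (m + 1) * 2 ^ m := by
      have h2' : (∑ D ∈ (Finset.Ico 1 (m + 2)).powerset, D.card) = (m + 1) * 2 ^ m := h2
      exact_mod_cast h2'
    push_cast [Finset.sum_congr rfl h1]
    rw [Finset.sum_sub_distrib, h3, Finset.sum_const, Finset.card_powerset, Nat.card_Ico]
    simp only [Nat.add_sub_cancel, show m + 2 - 1 = m + 1 from rfl, nsmul_eq_mul]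
    push_cast
    ring
  · intro D hD t
    constructor
    · intro h i hi hi'
      rw [hF i hi hi']
      have := tl_le_card D i
      omega
    · intro h
      have := h 1 le_rfl (by omega)
      rw [hF 1 le_rfl (by omega), tl_one D n hD] at this
      omega

lemma count_two (n A : ℕ) (hn : 1 < n) (F : ℕ → ℕ) (hF : ∀ i, 1 ≤ i → i ≤ n → F i = A + (n - i)) :
    (Nat.card {x : ℕ → ℕ // Slice n x ∧ ∀ i, x i ≤ F i} : ℤ) =
      2 ^ (n - 2) * (((2 * A + n - 1 : ℕ) : ℤ) - n + 3) := by
  rw [count_slices n hn F (fun D => A + 1)]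
  · obtain ⟨m, rfl⟩ : ∃ m, n = m + 2 := ⟨n - 2, by omega⟩
    rw [Finset.sum_const, Finset.card_powerset, Nat.card_Ico]
    simp only [Nat.add_sub_cancel, show m + 2 - 1 = m + 1 from rfl, smul_eq_mul,
      show 2 * A + (m + 2) - 1 = 2 * A + m + 1 by omega]
    push_cast
    ring
  · intro D hD t
    constructor
    · intro h i hi hi'
      rw [hF i hi hi']
      have := tl_le D n i hD
      omega
    · intro h
      have := h n (by omega) le_rfl
      rw [hF n (by omega) le_rfl, tl_n D n hD] at this
      omega

end CountPart

/-! ### Part 7 : path data of a path-like system -/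

section FinalPart

open Real

variable {B : Type*} {W : Type*} [Group W] [Fintype B] [DecidableEq B]

lemma pre_word {M : CoxeterMatrix B} {n : ℕ} (P : PD M n) (cs : CoxeterSystem M W) (i : ℕ) :
    P.pre cs i = cs.wordProd ((List.range' 1 i).map P.b) := by
  induction i with
  | zero => simp [PD.pre]
  | succ i ih =>
    rw [PD.pre_succ, ih, List.range'_concat, List.map_append, cs.wordProd_append]
    simp [add_comm]

/-- index of the path -/
def bidx {n : ℕ} (hn : 1 < n) (i : ℕ) : Fin n := ⟨(i - 1) % n, Nat.mod_lt _ (by omega)⟩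

lemma bidx_val {n : ℕ} (hn : 1 < n) (i : ℕ) (hi : 1 ≤ i) (hi' : i ≤ n) : (bidx hn i).val = i - 1 :=
  Nat.mod_eq_of_lt (by omega)

lemma pd_exists (M : CoxeterMatrix B) (hM : ∀ i j, M i j ≠ 0) (n : ℕ) (hn : 1 < n) (e : Fin n ≃ B)
    (hpath : ∀ i j : Fin n, 3 ≤ M (e i) (e j) ↔ (i.val + 1 = j.val ∨ j.val + 1 = i.val)) :
    ∃ P : PD M n, P.wd 0 = List.ofFn e := by
  have hv := bidx_val hn
  have hadj : ∀ i, 1 ≤ i → i < n → 3 ≤ M (e (bidx hn i)) (e (bidx hn (i + 1))) := by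
    intro i hi hi'
    rw [hpath, hv i hi (by omega), hv (i + 1) (by omega) (by omega)]
    omega
  have hnadj : ∀ i j, 1 ≤ i → j ≤ n → i + 2 ≤ j → M (e (bidx hn i)) (e (bidx hn j)) = 2 := by
    intro i j hi hj hij
    have h1 : ¬ 3 ≤ M (e (bidx hn i)) (e (bidx hn j)) := by
      rw [hpath, hv i hi (by omega), hv j (by omega) hj]
      omega
    have h2 : e (bidx hn i) ≠ e (bidx hn j) := by
      intro h
      have := congrArg Fin.val (e.injective h)
      rw [hv i hi (by omega), hv j (by omega) hj] at this
      omega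
    have := two_le_M M h2 (hM _ _)
    omega
  refine ⟨⟨fun i => e (bidx hn i), fun i => if 1 ≤ i ∧ i < n then
    2 * cos (π / M (e (bidx hn i)) (e (bidx hn (i + 1)))) else 0,
    ?_, ?_, ?_, ?_, ?_, ?_, ?_, ?_, ?_⟩, ?_⟩
  · intro i j hi hi' hj hj' h
    have := congrArg Fin.val (e.injective h)
    rw [hv i hi (by omega), hv j (by omega) hj'] at this
    omega
  · intro x
    refine ⟨(e.symm x).val + 1, by omega, (e.symm x).isLt, ?_⟩
    have : bidx hn ((e.symm x).val + 1) = e.symm x := by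
      apply Fin.ext
      rw [hv _ (by omega) (e.symm x).isLt]
      rfl
    rw [this, e.apply_symm_apply]
  · simp
  · simp
  · intro i hi hi'
    rw [if_pos ⟨hi, hi'⟩]
    have h3 : (3 : ℝ) ≤ M (e (bidx hn i)) (e (bidx hn (i + 1))) := by exact_mod_cast hadj i hi hi'
    have : 0 < cos (π / M (e (bidx hn i)) (e (bidx hn (i + 1)))) := by
      apply cos_pos_of_mem_Ioo
      have hp := pi_pos
      constructor
      · have : 0 < π / M (e (bidx hn i)) (e (bidx hn (i + 1))) := by positivity
        linarith
      · apply div_lt_div_of_pos_left hp (by norm_num)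
        linarith
    linarith
  · intro i hi hi'
    rw [if_pos ⟨hi, hi'⟩, kk]
    ring
  · intro i j hi hj hij
    rw [kk, hnadj i j hi hj hij]
    simp
  · exact hnadj
  · intro i hi hi' h
    have := hadj i hi hi'
    omega
  · apply List.ext_getElem
    · simp [PD.wd]
    · intro k h1 h2
      simp only [List.length_ofFn] at h2
      simp only [PD.wd, List.getElem_map, List.getElem_range', List.getElem_ofFn]
      congr 1
      apply Fin.ext
      rw [hv _ (by omega) (by omega)]
      simp

end FinalPart

/-- Minimum case for path-like systems: if the Coxeter graph of an irreducible finite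
Coxeter system of rank `n > 1` is a path `s₁ — s₂ — ⋯ — s_n` and `c = s₁s₂⋯s_n` is the
linear Coxeter element (the oriented Coxeter graph is a directed path, with exactly one
source and one sink), then the number of `c`-singletons is `2^{n−2}(h − n + 3)`,
where `h` is the Coxeter number. -/
theorem numSingletons_pathlike_linear {B W : Type*} [Group W] [Fintype B]
    [Finite W] (M : CoxeterMatrix B) (cs : CoxeterSystem M W)
    (n : ℕ) (hn : 1 < n) (hcard : Fintype.card B = n)
    (e : Fin n ≃ B)
    (hpath : ∀ i j : Fin n, 3 ≤ M (e i) (e j) ↔ (i.val + 1 = j.val ∨ j.val + 1 = i.val))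
    (w₀ : W) (hw₀ : ∀ v : W, cs.length v ≤ cs.length w₀) :
    (numSingletons cs (List.ofFn e) w₀ : ℤ) =
      2 ^ (n - 2) * ((orderOf (cs.wordProd (List.ofFn e)) : ℤ) - n + 3) := by
  classical
  have hM : ∀ i j, M i j ≠ 0 := M_ne_zero cs
  obtain ⟨P, hP⟩ := pd_exists M hM n hn e hpath
  have hc : cs.wordProd (List.ofFn e) = P.cox cs := by
    rw [← hP, PD.cox, pre_word]
    rfl
  rw [hc, ← hP, PD.num_eq hM hn w₀ hw₀]
  rcases PD.struct hM (P := P) (cs := cs) hn with ⟨N, hN, ho, h⟩ | ⟨A, hA, ho, h⟩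
  · rw [ho]
    apply count_one n N hn hN
    intro i hi hi'
    rw [PD.fin_apply i hi hi', (h i hi hi').1]
  · rw [ho]
    apply count_two n A hn
    intro i hi hi'
    rw [PD.fin_apply i hi hi', (h i hi hi').1]

end Cambrian
end
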